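/- Let G be a finite simple group of order 95040 (the Mathieu group M₁₂). Then the elementary abelian subgroups of G of order 9 fall into exactly 3 conjugacy classes under G-conjugation. -/

import Mathlib

/-- `E` is an elementary abelian `p`-subgroup of `G`: every element of `E` satisfies
`x ^ p = 1` and any two elements of `E` commute. -/
def IsElementaryAbelian (p : ℕ) {G : Type*} [Group G] (E : Subgroup G) : Prop :=
  (∀ x ∈ E, x ^ p = 1) ∧ ∀ x ∈ E, ∀ y ∈ E, x * y = y * x

/-- Two subgroups of `G` are conjugate in `G`. -/
def IsConjSubgroup {G : Type*} [Group G] (E F : Subgroup G) : Prop :=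
  ∃ g : G, E.map (MulAut.conj g).toMonoidHom = F

namespace GroupChar
open Matrix Finset

variable {G : Type*} [Group G] {r : ℕ} {d : Fin r → ℕ}

/-- A decomposition of the complex group algebra as a product of matrix algebras. -/
abbrev Wedderburn (G : Type*) [Group G] (r : ℕ) (d : Fin r → ℕ) :=
  MonoidAlgebra ℂ G ≃ₐ[ℂ] Π i, Matrix (Fin (d i)) (Fin (d i)) ℂ

theorem exists_wedderburn (G : Type*) [Group G] [Finite G] :
    ∃ (r : ℕ) (d : Fin r → ℕ), (∀ i, NeZero (d i)) ∧ Nonempty (Wedderburn G r d) :=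
  IsSemisimpleRing.exists_algEquiv_pi_matrix_of_isAlgClosed ℂ (MonoidAlgebra ℂ G)

/-- The `i`-th component of a decomposition, as an algebra homomorphism. -/
noncomputable def Wedderburn.comp (e : Wedderburn G r d) (i : Fin r) :
    MonoidAlgebra ℂ G →ₐ[ℂ] Matrix (Fin (d i)) (Fin (d i)) ℂ :=
  (Pi.evalAlgHom ℂ (fun i => Matrix (Fin (d i)) (Fin (d i)) ℂ) i).comp e.toAlgHom

/-- The `i`-th irreducible matrix representation. -/
noncomputable def irrep (e : Wedderburn G r d) (i : Fin r) :
    G →* Matrix (Fin (d i)) (Fin (d i)) ℂ :=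
  (e.comp i : MonoidAlgebra ℂ G →* _).comp (MonoidAlgebra.of ℂ G)

/-- The `i`-th irreducible character. -/
noncomputable def chi (e : Wedderburn G r d) (i : Fin r) (g : G) : ℂ := (irrep e i g).trace

variable (e : Wedderburn G r d)

theorem chi_one (i : Fin r) : chi e i 1 = d i := by simp [chi]

theorem chi_mul_comm (i : Fin r) (a b : G) : chi e i (a * b) = chi e i (b * a) := by
  simp only [chi, map_mul]
  exact Matrix.trace_mul_comm _ _

theorem chi_conj (i : Fin r) (g a : G) : chi e i (g * a * g⁻¹) = chi e i a := by
  rw [chi_mul_comm]; simp [mul_assoc]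

theorem irrep_apply (i : Fin r) (g : G) : irrep e i g = e (MonoidAlgebra.single g 1) i := rfl

theorem eq_sum_single [Fintype G] (a : MonoidAlgebra ℂ G) :
    a = ∑ g, a.coeff g • MonoidAlgebra.single g (1 : ℂ) := by
  ext x
  simp [MonoidAlgebra.coeff_sum, Finsupp.single_apply]

theorem e_eq_sum [Fintype G] (i : Fin r) (a : MonoidAlgebra ℂ G) :
    e a i = ∑ g, a.coeff g • irrep e i g := by
  conv_lhs => rw [eq_sum_single a]
  simp only [map_sum, map_smul, Finset.sum_apply, Pi.smul_apply, irrep_apply]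

theorem exists_matrix [Fintype G] (i : Fin r) (M : Matrix (Fin (d i)) (Fin (d i)) ℂ) :
    ∃ c : G → ℂ, M = ∑ g, c g • irrep e i g := by
  classical
  refine ⟨(e.symm (Pi.single i M)).coeff, ?_⟩
  rw [← e_eq_sum]; simp

/-- Schur's lemma in matrix form. -/
theorem scalar_of_commute [Fintype G] (i : Fin r) [NeZero (d i)]
    (A : Matrix (Fin (d i)) (Fin (d i)) ℂ)
    (hA : ∀ g, Commute (irrep e i g) A) : A = (A.trace / d i) • (1 : Matrix _ _ ℂ) := by
  have h1 : ∀ M, Commute M A := fun M => by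
    obtain ⟨c, rfl⟩ := exists_matrix e i M
    exact Commute.sum_left _ _ _ fun g _ => (hA g).smul_left _
  obtain ⟨z, rfl⟩ := Matrix.mem_range_scalar_of_commute_single (M := A) (fun a b _ => h1 _)
  have hd : (d i : ℂ) ≠ 0 := Nat.cast_ne_zero.2 (NeZero.ne _)
  simp only [Matrix.scalar_apply, Matrix.trace_diagonal]
  ext a b
  by_cases h : a = b <;> simp [h, Matrix.diagonal, Matrix.one_apply, hd]

theorem sum_conj_matrix [Fintype G] (i : Fin r) [NeZero (d i)]
    (A : Matrix (Fin (d i)) (Fin (d i)) ℂ) :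
    ∑ g, irrep e i g * A * irrep e i g⁻¹ =
      (Fintype.card G * A.trace / d i) • (1 : Matrix _ _ ℂ) := by
  have h := scalar_of_commute e i (∑ g, irrep e i g * A * irrep e i g⁻¹) ?_
  · rw [h]; congr 2
    rw [Matrix.trace_sum]
    simp_rw [Matrix.trace_mul_comm (_ * A), ← mul_assoc, ← map_mul]
    simp
  · intro h
    rw [Commute, SemiconjBy, Finset.mul_sum, Finset.sum_mul]
    rw [← Equiv.sum_comp (Equiv.mulLeft h⁻¹)]
    refine Finset.sum_congr rfl fun g _ => ?_
    simp only [Equiv.coe_mulLeft, _root_.mul_inv_rev, inv_inv, map_mul]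
    rw [← map_mul]
    simp only [← mul_assoc, ← map_mul, mul_inv_cancel, one_mul]
    simp only [map_mul, mul_assoc]

/-- A trace functional on the group algebra is a combination of the irreducible characters. -/
theorem trace_functional [Fintype G] [∀ i, NeZero (d i)] (L : MonoidAlgebra ℂ G →ₗ[ℂ] ℂ)
    (hL : ∀ a b, L (a * b) = L (b * a)) (a : MonoidAlgebra ℂ G) :
    L a = ∑ i, L (e.symm (Pi.single i (Matrix.single 0 0 1))) * (e a i).trace := by
  classical
  have hs : ∀ i (x y : Fin (d i)), L (e.symm (Pi.single i (Matrix.single x y 1))) =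
      if x = y then L (e.symm (Pi.single i (Matrix.single 0 0 1))) else 0 := by
    intro i x y
    have h1 : e.symm (Pi.single i (Matrix.single x y 1)) =
      e.symm (Pi.single i (Matrix.single x 0 1)) * e.symm (Pi.single i (Matrix.single 0 y 1)) := by
      rw [← map_mul, ← Pi.single_mul]; simp
    rw [h1, hL, ← map_mul, ← Pi.single_mul]
    split_ifs with h
    · subst h; simp
    · rw [Matrix.single_mul_single_of_ne _ _ _ _ (Ne.symm h)]; simp
  have ha : a = ∑ i, ∑ x, ∑ y, (e a i x y) • e.symm (Pi.single i (Matrix.single x y 1)) := by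
    apply e.injective
    simp only [map_sum, map_smul, AlgEquiv.apply_symm_apply]
    ext i x y
    simp only [Finset.sum_apply, Pi.smul_apply, Matrix.sum_apply, Matrix.smul_apply, smul_eq_mul]
    rw [Finset.sum_eq_single i]
    · simp only [Pi.single_eq_same, Matrix.single_apply, ite_and]
      simp
    · intro j _ hj; simp [Pi.single_eq_of_ne' hj]
    · simp
  conv_lhs => rw [ha]
  simp only [map_sum, map_smul, smul_eq_mul]
  refine Finset.sum_congr rfl fun i _ => ?_
  rw [Matrix.trace, Finset.mul_sum]
  refine Finset.sum_congr rfl fun x _ => ?_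
  rw [Finset.sum_eq_single x, hs, if_pos rfl]
  · exact mul_comm _ _
  · intro y _ hy; rw [hs, if_neg hy.symm, mul_zero]
  · simp

end GroupChar

namespace GroupChar
open Matrix Finset
variable {G : Type*} [Group G] [Fintype G] {r : ℕ} {d : Fin r → ℕ} [∀ i, NeZero (d i)]
  (e : Wedderburn G r d)

theorem coeff_single_mul (g h : G) (a : MonoidAlgebra ℂ G) :
    (MonoidAlgebra.single g (1 : ℂ) * a).coeff h = a.coeff (g⁻¹ * h) := by
  simp [MonoidAlgebra.coeff_single_mul_apply]

omit [Fintype G] in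
theorem natCast_dim_ne_zero (d : Fin r → ℕ) [∀ i, NeZero (d i)] (i : Fin r) : (d i : ℂ) ≠ 0 := Nat.cast_ne_zero.2 (NeZero.ne _)

theorem card_ne_zero' (G : Type*) [Group G] [Fintype G] : (Fintype.card G : ℂ) ≠ 0 :=
  Nat.cast_ne_zero.2 Fintype.card_ne_zero

theorem coeff_one_mul_comm (a b : MonoidAlgebra ℂ G) : (a * b).coeff 1 = (b * a).coeff 1 := by
  have h : ∀ a b : MonoidAlgebra ℂ G, (a * b).coeff 1 = ∑ g, a.coeff g * b.coeff g⁻¹ := by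
    intro a b
    conv_lhs => rw [eq_sum_single a]
    simp [Finset.sum_mul, MonoidAlgebra.coeff_sum, coeff_single_mul]
  rw [h, h, ← Equiv.sum_comp (Equiv.inv G)]
  exact Finset.sum_congr rfl fun g _ => by simp [mul_comm]

/-- Fourier inversion on a finite group. -/
theorem coeff_eq (a : MonoidAlgebra ℂ G) (g : G) :
    a.coeff g = ∑ i, (d i / Fintype.card G : ℂ) * (irrep e i g⁻¹ * e a i).trace := by
  classical
  obtain ⟨L, hL1⟩ : ∃ L : MonoidAlgebra ℂ G →ₗ[ℂ] ℂ, ∀ a, L a = a.coeff 1 :=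
    ⟨{ toFun := fun a => a.coeff 1
       map_add' := fun _ _ => rfl
       map_smul' := fun _ _ => rfl }, fun _ => rfl⟩
  have hL := trace_functional e L fun a b => by rw [hL1, hL1, coeff_one_mul_comm]
  have key : ∀ (a : MonoidAlgebra ℂ G) g, a.coeff g =
      ∑ i, L (e.symm (Pi.single i (Matrix.single 0 0 1))) * (irrep e i g⁻¹ * e a i).trace := by
    intro a g
    have h1 : a.coeff g = L (MonoidAlgebra.single g⁻¹ 1 * a) := by
      rw [hL1, coeff_single_mul]; simp
    rw [h1, hL]
    simp [irrep_apply]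
  rw [key]
  refine Finset.sum_congr rfl fun i _ => ?_
  congr 1
  set c := L (e.symm (Pi.single i (Matrix.single 0 0 1)))
  have h2 : ∀ g, (e.symm (Pi.single i (Matrix.single 0 0 1))).coeff g =
      c * irrep e i g⁻¹ 0 0 := by
    intro g
    rw [key, Finset.sum_eq_single i]
    · congr 1
      simp [Matrix.trace_mul_single]
    · intro j _ hj; simp [Pi.single_eq_of_ne hj]
    · simp
  have h3 := congrFun (congrFun (e_eq_sum e i (e.symm (Pi.single i (Matrix.single 0 0 1)))) 0) 0
  have h4 := congrFun (congrFun (sum_conj_matrix e i (Matrix.single 0 0 1)) 0) 0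
  simp only [AlgEquiv.apply_symm_apply, Pi.single_eq_same, Matrix.single_apply_same, h2,
    Matrix.sum_apply, Matrix.smul_apply, smul_eq_mul, Matrix.one_apply_eq, mul_one,
    Matrix.trace_single_eq_same] at h3 h4
  have h5 : ∀ g, (irrep e i g * Matrix.single 0 0 (1 : ℂ) * irrep e i g⁻¹ : Matrix _ _ ℂ) 0 0 =
      irrep e i g⁻¹ 0 0 * irrep e i g 0 0 := by
    intro g
    rw [Matrix.mul_apply, Finset.sum_eq_single 0]
    · simp [mul_comm]
    · intro j _ hj; simp [hj]
    · simp
  simp only [h5] at h4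
  simp only [mul_assoc, ← Finset.mul_sum, h4] at h3
  have := natCast_dim_ne_zero d i
  have := card_ne_zero' G
  field_simp at h3 ⊢
  linear_combination -h3

theorem sum_dim_chi [DecidableEq G] (g : G) :
    ∑ i, (d i : ℂ) * chi e i g = if g = 1 then (Fintype.card G : ℂ) else 0 := by
  have h := coeff_eq e (1 : MonoidAlgebra ℂ G) g⁻¹
  have := card_ne_zero' G
  simp only [MonoidAlgebra.one_def, MonoidAlgebra.coeff_single, Finsupp.single_apply] at h
  rw [← MonoidAlgebra.one_def] at h
  simp only [map_one, Pi.one_apply, mul_one, inv_inv] at h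
  have h2 : ∑ i, (d i : ℂ) * chi e i g = Fintype.card G *
     ∑ i, (d i / Fintype.card G : ℂ) * (irrep e i g).trace := by
    rw [Finset.mul_sum]; refine Finset.sum_congr rfl fun i _ => ?_
    rw [chi]; field_simp
  rw [h2, ← h]
  by_cases hg : g = 1 <;> simp [hg, eq_comm]

theorem row_orthogonality (i k : Fin r) :
    ∑ g, chi e i g⁻¹ * chi e k g = if i = k then (Fintype.card G : ℂ) else 0 := by
  classical
  have h1 := e_eq_sum e k (e.symm (Pi.single i 1))
  have h2 : ∀ g, (e.symm (Pi.single i 1)).coeff g = (d i / Fintype.card G : ℂ) * chi e i g⁻¹ := by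
    intro g
    rw [coeff_eq e, Finset.sum_eq_single i]
    · simp [chi]
    · intro j _ hj; simp [Pi.single_eq_of_ne hj]
    · simp
  have h3 := congrArg Matrix.trace h1
  simp only [AlgEquiv.apply_symm_apply, h2, Matrix.trace_sum, Matrix.trace_smul, smul_eq_mul] at h3
  simp only [mul_assoc, ← Finset.mul_sum] at h3
  have := natCast_dim_ne_zero d i
  have := card_ne_zero' G
  change _ = _ * ∑ g, chi e i g⁻¹ * chi e k g at h3
  split_ifs with h
  · subst h
    rw [Pi.single_eq_same, Matrix.trace_one, Fintype.card_fin] at h3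
    field_simp at h3; exact h3.symm
  · rw [Pi.single_eq_of_ne' h, Matrix.trace_zero] at h3
    field_simp at h3
    simpa [NeZero.ne] using h3.symm

theorem chi_mul_sum (i : Fin r) (a b : G) :
    (d i : ℂ) * ∑ g, chi e i (g * a * g⁻¹ * b) = Fintype.card G * chi e i a * chi e i b := by
  have h := congrArg Matrix.trace (congrArg (· * irrep e i b) (sum_conj_matrix e i (irrep e i a)))
  simp only [Finset.sum_mul, Matrix.trace_sum, ← map_mul, Matrix.smul_mul, one_mul,
    Matrix.trace_smul, smul_eq_mul] at h
  change ∑ g, chi e i _ = _ / _ * chi e i b at h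
  have := natCast_dim_ne_zero d i
  rw [h]; change _ * (_ * chi e i a / _ * _) = _; field_simp

theorem column_orthogonality [DecidableEq G] (a b : G) :
    ∑ i, chi e i a * chi e i b = #{g | g * a * g⁻¹ * b = 1} := by
  have h : ∑ g : G, ∑ i, (d i : ℂ) * chi e i (g * a * g⁻¹ * b) =
    Fintype.card G * ∑ i, chi e i a * chi e i b := by
    rw [Finset.sum_comm, Finset.mul_sum]
    refine Finset.sum_congr rfl fun i _ => ?_
    rw [← Finset.mul_sum, chi_mul_sum]; ring
  simp only [sum_dim_chi] at h
  rw [← Finset.sum_filter, Finset.sum_const, nsmul_eq_mul, mul_comm] at h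
  exact (mul_left_cancel₀ (card_ne_zero' G) h).symm

end GroupChar

namespace GroupChar
open Matrix Finset

theorem trace_idempotent {n : Type*} [Fintype n] [DecidableEq n] (P : Matrix n n ℂ)
    (hP : P * P = P) :
    ∃ k : ℕ, P.trace = k ∧ k ≤ Fintype.card n ∧ (k = Fintype.card n → P = 1) := by
  have key : ∀ P : Matrix n n ℂ, P * P = P → ∃ k : ℕ, P.trace = k ∧ (k = 0 → P = 0) := by
    intro P hP
    have h1 : IsIdempotentElem (Matrix.toLin' P) := by
      rw [IsIdempotentElem, Module.End.mul_eq_comp, ← Matrix.toLin'_mul, hP]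
    have h2 := (LinearMap.IsIdempotentElem.isProj_range _ h1).trace
    rw [Matrix.trace_toLin'_eq] at h2
    refine ⟨_, h2, fun h => ?_⟩
    have h3 := Submodule.finrank_eq_zero.1 h
    exact Matrix.toLin'.injective (by rw [LinearMap.range_eq_bot.1 h3, map_zero])
  obtain ⟨k, hk, -⟩ := key P hP
  obtain ⟨l, hl, hl0⟩ := key (1 - P) (by simp [sub_mul, mul_sub, hP])
  rw [Matrix.trace_sub, Matrix.trace_one, hk, sub_eq_iff_eq_add] at hl
  have h : Fintype.card n = l + k := by exact_mod_cast hl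
  exact ⟨k, hk, by omega, fun h' => (sub_eq_zero.1 (hl0 (by omega))).symm⟩

variable {G : Type*} [Group G] [Fintype G] {r : ℕ} {d : Fin r → ℕ} [∀ i, NeZero (d i)]
  (e : Wedderburn G r d)

/-- The character of a representation cut by a commuting idempotent is a sum of irreducibles. -/
theorem decompose {n : Type*} [Fintype n] [DecidableEq n] (φ : G →* Matrix n n ℂ)
    (S : Matrix n n ℂ) (hS : S * S = S) (hc : ∀ g, φ g * S = S * φ g) :
    ∃ m : Fin r → ℕ, ∀ g, (φ g * S).trace = ∑ k, (m k : ℂ) * chi e k g := by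
  classical
  let Φ := MonoidAlgebra.lift ℂ (Matrix n n ℂ) G φ
  have hΦ : ∀ g, Φ (MonoidAlgebra.single g 1) = φ g := fun g => by simp [Φ]
  have hcΦ : ∀ a, Φ a * S = S * Φ a := by
    intro a
    rw [eq_sum_single a]
    simp only [map_sum, map_smul, hΦ, Finset.sum_mul, Finset.mul_sum, Matrix.smul_mul,
      Matrix.mul_smul, hc]
  let L : MonoidAlgebra ℂ G →ₗ[ℂ] ℂ :=
    (Matrix.traceLinearMap n ℂ ℂ).comp ((LinearMap.mulRight ℂ S).comp Φ.toLinearMap)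
  have hL : ∀ a, L a = (Φ a * S).trace := fun a => rfl
  have h1 := trace_functional e L (fun a b => by
    rw [hL, hL, map_mul, map_mul, mul_assoc, Matrix.trace_mul_comm, mul_assoc, mul_assoc, hcΦ])
  have h2 : ∀ k, ∃ m : ℕ, L (e.symm (Pi.single k (Matrix.single 0 0 1))) = m := by
    intro k
    rw [hL]
    obtain ⟨m, hm, -⟩ := trace_idempotent
      (Φ (e.symm (Pi.single k (Matrix.single 0 0 1))) * S) (by
        rw [mul_assoc, ← mul_assoc S, ← hcΦ, mul_assoc, hS, ← mul_assoc, ← map_mul, ← map_mul,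
          ← Pi.single_mul]
        simp)
    exact ⟨m, hm⟩
  choose m hm using h2
  refine ⟨m, fun g => ?_⟩
  have h3 := h1 (MonoidAlgebra.single g 1)
  simp only [hL, hΦ] at h3
  rw [h3]
  exact Finset.sum_congr rfl fun k _ => by rw [← hL, hm]; rfl

theorem mean_powers {m : Type*} [Fintype m] [DecidableEq m] {n : ℕ} (hn : 0 < n)
    (N : Matrix m m ℂ) (hN : N ^ n = 1) (P : Matrix m m ℂ)
    (hP : P = (n : ℂ)⁻¹ • ∑ k ∈ range n, N ^ k) : N * P = P ∧ P * P = P := by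
  have hn0 : (n : ℂ) ≠ 0 := Nat.cast_ne_zero.2 hn.ne'
  have h1 : N * ∑ k ∈ range n, N ^ k = ∑ k ∈ range n, N ^ k := by
    have h := Finset.sum_range_succ (fun k => N ^ k) n
    rw [Finset.sum_range_succ', hN, pow_zero] at h
    rw [Finset.mul_sum]
    simpa [pow_succ'] using h
  have h2 : N * P = P := by rw [hP, Matrix.mul_smul, h1]
  have h3 : ∀ k : ℕ, N ^ k * P = P := by
    intro k
    induction k with
    | zero => simp
    | succ k ih => rw [pow_succ, mul_assoc, h2, ih]
  refine ⟨h2, ?_⟩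
  nth_rw 1 [hP]
  simp only [Matrix.smul_mul, Finset.sum_mul, h3, Finset.sum_const, Finset.card_range]
  rw [← Nat.cast_smul_eq_nsmul ℂ, smul_smul, inv_mul_cancel₀ hn0, one_smul]

/-- The sum of a character over a cyclic group of order dividing `n`. -/
theorem chi_mean (i : Fin r) {h : G} {n : ℕ} (hn : 0 < n) (hh : h ^ n = 1) :
    ∃ m : ℕ, ∑ k ∈ range n, chi e i (h ^ k) = n * m ∧ m ≤ d i ∧ (m = d i → irrep e i h = 1) := by
  have hN : irrep e i h ^ n = 1 := by rw [← map_pow, hh, map_one]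
  obtain ⟨h1, h2⟩ := mean_powers hn _ hN _ rfl
  obtain ⟨m, hm, hle, heq⟩ := trace_idempotent _ h2
  have hn0 : (n : ℂ) ≠ 0 := Nat.cast_ne_zero.2 hn.ne'
  rw [Fintype.card_fin] at hle heq
  refine ⟨m, ?_, hle, fun h' => ?_⟩
  · rw [← hm, Matrix.trace_smul, Matrix.trace_sum, smul_eq_mul, mul_inv_cancel_left₀ hn0]
    simp [chi, map_pow]
  · rwa [heq h', mul_one] at h1

theorem chi_powers (i : Fin r) {h : G} {n : ℕ} (hn : 0 < n) (hh : h ^ n = 1) {ζ : ℂ}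
    (hζ : IsPrimitiveRoot ζ n) :
    ∃ m : ℕ → ℕ, ∀ k < n, chi e i (h ^ k) = ∑ j ∈ range n, (m j : ℂ) * ζ ^ (j * k) := by
  have hn0 : (n : ℂ) ≠ 0 := Nat.cast_ne_zero.2 hn.ne'
  have hζ0 : ζ ≠ 0 := hζ.ne_zero hn.ne'
  have h1 : ∀ j : ℕ, ∃ m : ℕ, (m : ℂ) =
      (n : ℂ)⁻¹ * ∑ l ∈ range n, (ζ⁻¹ ^ j) ^ l * chi e i (h ^ l) := by
    intro j
    have hN : (ζ⁻¹ ^ j • irrep e i h) ^ n = 1 := by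
      rw [smul_pow, ← map_pow, hh, map_one, ← pow_mul, mul_comm, pow_mul, inv_pow, hζ.pow_eq_one]
      simp
    obtain ⟨m, hm, -⟩ := trace_idempotent _ (mean_powers hn _ hN _ rfl).2
    refine ⟨m, ?_⟩
    rw [← hm, Matrix.trace_smul, Matrix.trace_sum, smul_eq_mul]
    simp [chi, map_pow, smul_pow]
  choose m hm using h1
  refine ⟨m, fun k hk => ?_⟩
  simp only [hm, Finset.mul_sum, Finset.sum_mul]
  rw [Finset.sum_comm, Finset.sum_eq_single k]
  · rw [Finset.sum_congr rfl fun j _ => show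
      (n : ℂ)⁻¹ * ((ζ⁻¹ ^ j) ^ k * chi e i (h ^ k)) * ζ ^ (j * k) = (n : ℂ)⁻¹ * chi e i (h ^ k) by
        rw [pow_mul, inv_pow, inv_pow]; field_simp]
    rw [Finset.sum_const, Finset.card_range, nsmul_eq_mul, mul_inv_cancel_left₀ hn0]
  · intro l hl hlk
    have hl := Finset.mem_range.1 hl
    have h2 : ∀ j, (n : ℂ)⁻¹ * ((ζ⁻¹ ^ j) ^ l * chi e i (h ^ l)) * ζ ^ (j * k) =
        (n : ℂ)⁻¹ * chi e i (h ^ l) * (ζ ^ k * (ζ ^ l)⁻¹) ^ j := by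
      intro j
      have h3 : (ζ ^ k * (ζ ^ l)⁻¹) ^ j = ζ ^ (j * k) * (ζ⁻¹ ^ j) ^ l := by
        rw [mul_pow, inv_pow, inv_pow, inv_pow, ← pow_mul, ← pow_mul, ← pow_mul, mul_comm k,
          mul_comm l]
      rw [h3]; ring
    simp only [h2, ← Finset.mul_sum]
    have hw : ζ ^ k * (ζ ^ l)⁻¹ ≠ 1 := by
      intro h
      exact hlk (hζ.pow_inj hl hk (mul_inv_eq_one₀ (pow_ne_zero _ hζ0) |>.1 h).symm)
    rw [geom_sum_eq hw, mul_pow, inv_pow, ← pow_mul, ← pow_mul, mul_comm k, mul_comm l, pow_mul,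
      pow_mul, hζ.pow_eq_one]
    simp
  · intro h; exact absurd (Finset.mem_range.2 hk) h

theorem det_involution (i : Fin r) {t : G} (ht : t ^ 2 = 1) :
    ∃ m : ℕ, chi e i t = d i - 2 * m ∧ (irrep e i t).det = (-1) ^ m := by
  have h1 : ∀ z ∈ (irrep e i t).charpoly.roots, z = 1 ∨ z = -1 := by
    intro z hz
    have h1 := Matrix.mem_spectrum_iff_isRoot_charpoly.2 (Polynomial.isRoot_of_mem_roots hz)
    have h2 := spectrum.pow_mem_pow (irrep e i t) 2 h1
    rw [← map_pow, ht, map_one] at h2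
    simpa using h2
  have h2 : ((irrep e i t).charpoly.roots.card : ℂ) = d i := by
    rw [IsAlgClosed.card_roots_eq_natDegree, Matrix.charpoly_natDegree_eq_dim, Fintype.card_fin]
  rw [chi, Matrix.trace_eq_sum_roots_charpoly, Matrix.det_eq_prod_roots_charpoly, ← h2]
  generalize (irrep e i t).charpoly.roots = s at h1
  clear h2
  induction s using Multiset.induction_on with
  | empty => exact ⟨0, by simp⟩
  | cons a s ih =>
    obtain ⟨m, hm, hm'⟩ := ih fun z hz => h1 z (Multiset.mem_cons_of_mem hz)
    rcases h1 a (Multiset.mem_cons_self a s) with rfl | rfl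
    · exact ⟨m, by rw [Multiset.sum_cons, hm, Multiset.card_cons]; push_cast; ring, by simp [hm']⟩
    · exact ⟨m + 1, by rw [Multiset.sum_cons, hm, Multiset.card_cons]; push_cast; ring,
        by simp [hm', pow_succ]⟩

theorem chi_inv (i : Fin r) (g : G) : chi e i g⁻¹ = starRingEnd ℂ (chi e i g) := by
  by_cases hg : g = 1
  · subst hg; simp [chi_one]
  set n := Fintype.card G
  have hn : 1 < n := Fintype.one_lt_card_iff_nontrivial.2 ⟨g, 1, hg⟩
  have hζ := Complex.isPrimitiveRoot_exp n (by omega)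
  generalize Complex.exp _ = ζ at hζ
  have hgn : g ^ n = 1 := pow_card_eq_one
  obtain ⟨m, hm⟩ := chi_powers e i (by omega) hgn hζ
  have h1 : g⁻¹ = g ^ (n - 1) := by
    rw [inv_eq_iff_mul_eq_one, ← pow_succ', Nat.sub_add_cancel hn.le, hgn]
  have h2 := hm 1 hn
  rw [pow_one] at h2
  rw [h1, hm _ (by omega), h2, map_sum]
  refine Finset.sum_congr rfl fun j _ => ?_
  have hn1 : ‖ζ‖ = 1 := hζ.norm'_eq_one (by omega)
  rw [map_mul, map_natCast, map_pow, ← Complex.inv_eq_conj hn1, mul_one, mul_comm j, pow_mul]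
  congr 2
  refine eq_inv_of_mul_eq_one_left ?_
  rw [← pow_succ, Nat.sub_add_cancel hn.le, hζ.pow_eq_one]

theorem chi_isIntegral (i : Fin r) (g : G) : IsIntegral ℤ (chi e i g) := by
  by_cases hg : g = 1
  · subst hg; rw [chi_one]; exact (isIntegral_algebraMap (R := ℤ) (x := (d i : ℤ)))
  have hn : 1 < Fintype.card G := Fintype.one_lt_card_iff_nontrivial.2 ⟨g, 1, hg⟩
  have hζ := Complex.isPrimitiveRoot_exp (Fintype.card G) (by omega)
  obtain ⟨m, hm⟩ := chi_powers e i (by omega) (pow_card_eq_one (x := g)) hζ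
  rw [← pow_one g, hm 1 hn]
  exact IsIntegral.sum _ fun j _ => (isIntegral_algebraMap (R := ℤ) (x := (m j : ℤ))).mul ((hζ.isIntegral (by omega)).pow _)

theorem class_scalar (i : Fin r) (K : Finset G) (hK : ∀ g, ∀ c ∈ K, g * c * g⁻¹ ∈ K) :
    ∑ c ∈ K, irrep e i c = ((∑ c ∈ K, chi e i c) / d i) • (1 : Matrix _ _ ℂ) := by
  have h := scalar_of_commute e i (∑ c ∈ K, irrep e i c) ?_
  · rw [h, Matrix.trace_sum]; rfl
  · intro g
    rw [Commute, SemiconjBy, Finset.mul_sum, Finset.sum_mul]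
    refine Finset.sum_bij' (fun c _ => g * c * g⁻¹) (fun c _ => g⁻¹ * c * g)
      (fun c hc => hK g c hc) (fun c hc => by simpa using hK g⁻¹ c hc) ?_ ?_ ?_
    · intro c _; group
    · intro c _; group
    · intro c _
      rw [← map_mul, ← map_mul]; group

theorem class_isIntegral (i : Fin r) (K : Finset G) (hK : ∀ g, ∀ c ∈ K, g * c * g⁻¹ ∈ K) :
    IsIntegral ℤ ((∑ c ∈ K, chi e i c) / d i) := by
  let z : MonoidAlgebra ℤ G := ∑ c ∈ K, MonoidAlgebra.single c 1
  have hz : IsIntegral ℤ z := IsIntegral.of_finite ℤ z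
  have h1 := hz.map (MonoidAlgebra.lift ℤ (Matrix (Fin (d i)) (Fin (d i)) ℂ) G (irrep e i))
  have h2 : MonoidAlgebra.lift ℤ (Matrix (Fin (d i)) (Fin (d i)) ℂ) G (irrep e i) z =
      algebraMap ℂ _ ((∑ c ∈ K, chi e i c) / d i) := by
    rw [Algebra.algebraMap_eq_smul_one, ← class_scalar e i K hK]
    simp [z]
  rw [h2] at h1
  exact (isIntegral_algebraMap_iff (algebraMap ℂ (Matrix (Fin (d i)) (Fin (d i)) ℂ)).injective).1 h1

end GroupChar

namespace GroupChar
open Matrix Finset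
variable {G : Type*} [Group G] [Fintype G] {r : ℕ} {d : Fin r → ℕ} [∀ i, NeZero (d i)]
  (e : Wedderburn G r d)

theorem sum_combination (m l : Fin r → ℂ) :
    ∑ g, (∑ k, m k * chi e k g⁻¹) * ∑ k, l k * chi e k g = Fintype.card G * ∑ k, m k * l k := by
  simp only [Finset.sum_mul_sum]
  rw [Finset.sum_comm, Finset.mul_sum]
  refine Finset.sum_congr rfl fun i _ => ?_
  rw [Finset.sum_comm]
  have h : ∀ k, ∑ g, m i * chi e i g⁻¹ * (l k * chi e k g) =
      m i * l k * if i = k then (Fintype.card G : ℂ) else 0 := by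
    intro k
    rw [← row_orthogonality e, Finset.mul_sum]
    exact Finset.sum_congr rfl fun g _ => by ring
  simp only [h, mul_ite, mul_zero, Finset.sum_ite_eq, Finset.mem_univ, if_true]
  ring

theorem exists_chi_eq {n : Type*} [Fintype n] [DecidableEq n] (φ : G →* Matrix n n ℂ)
    (h : ∑ g, (φ g⁻¹).trace * (φ g).trace = Fintype.card G) :
    ∃ k, ∀ g, (φ g).trace = chi e k g := by
  obtain ⟨m, hm⟩ := decompose e φ 1 (by simp) (by simp)
  simp only [mul_one] at hm
  simp only [hm, sum_combination] at h
  have h1 : ∑ k, m k * m k = 1 := by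
    have := card_ne_zero' G
    have h2 := mul_left_cancel₀ this (h.trans (mul_one _).symm)
    exact_mod_cast h2
  obtain ⟨k, -, hk⟩ : ∃ k ∈ univ, m k * m k ≠ 0 := by
    by_contra! h0
    rw [Finset.sum_eq_zero h0] at h1
    exact absurd h1 (by norm_num)
  rw [← Finset.add_sum_erase _ _ (Finset.mem_univ k)] at h1
  have hk1 : m k = 1 := by
    have : m k ≠ 0 := fun h => hk (by simp [h])
    exact Nat.eq_one_of_mul_eq_one_right (le_antisymm (by omega) (Nat.pos_of_ne_zero hk))
  have h3 : ∑ x ∈ univ.erase k, m x * m x = 0 := by rw [hk1] at h1; omega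
  refine ⟨k, fun g => ?_⟩
  rw [hm, Finset.sum_eq_single k]
  · simp [hk1]
  · intro j _ hj
    have := (Finset.sum_eq_zero_iff.1 h3) j (by simp [hj])
    have : m j = 0 := by simpa using this
    simp [this]
  · simp

theorem chi_injective {i k : Fin r} (h : ∀ g, chi e i g = chi e k g) : i = k := by
  by_contra hik
  have h1 := row_orthogonality e i k
  have h2 := row_orthogonality e i i
  rw [if_neg hik] at h1
  simp only [← h, h2, if_pos] at h1
  exact card_ne_zero' G h1

theorem exists_dual (i : Fin r) : ∃ k, ∀ g, chi e k g = starRingEnd ℂ (chi e i g) := by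
  let φ : G →* Matrix (Fin (d i)) (Fin (d i)) ℂ :=
    { toFun := fun g => (irrep e i g⁻¹)ᵀ
      map_one' := by simp
      map_mul' := fun a b => by rw [_root_.mul_inv_rev, map_mul, Matrix.transpose_mul] }
  have hφ : ∀ g, (φ g).trace = chi e i g⁻¹ := fun g => Matrix.trace_transpose _
  obtain ⟨k, hk⟩ := exists_chi_eq e φ (by
    simp only [hφ, inv_inv]
    rw [← if_pos (c := i = i) rfl (t := (Fintype.card G : ℂ)) (e := 0), ← row_orthogonality e i i]
    exact Finset.sum_congr rfl fun g _ => mul_comm _ _)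
  exact ⟨k, fun g => by rw [← hk, hφ, chi_inv]⟩

theorem exists_trivial : ∃ k, ∀ g, chi e k g = 1 := by
  obtain ⟨k, hk⟩ := exists_chi_eq e (1 : G →* Matrix (Fin 1) (Fin 1) ℂ) (by simp)
  exact ⟨k, fun g => by rw [← hk]; simp⟩

open Kronecker in
/-- The tensor product of two irreducible representations. -/
noncomputable def tensor (i k : Fin r) :
    G →* Matrix (Fin (d i) × Fin (d k)) (Fin (d i) × Fin (d k)) ℂ where
  toFun g := irrep e i g ⊗ₖ irrep e k g
  map_one' := by simp
  map_mul' a b := by rw [map_mul, map_mul, Matrix.mul_kronecker_mul]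

theorem chi_mul_chi (i k : Fin r) :
    ∃ m : Fin r → ℕ, ∀ g, chi e i g * chi e k g = ∑ j, (m j : ℂ) * chi e j g := by
  obtain ⟨m, hm⟩ := decompose e (tensor e i k) 1 (by simp) (by simp)
  refine ⟨m, fun g => ?_⟩
  rw [← hm, mul_one]
  exact (Matrix.trace_kronecker _ _).symm

section Simple
variable [IsSimpleGroup G] {i₀ i : Fin r} (h₀ : ∀ g, chi e i₀ g = 1) (hi : i ≠ i₀)
include h₀ hi

theorem irrep_injective {g : G} (hg : irrep e i g = 1) : g = 1 := by
  rcases IsSimpleGroup.eq_bot_or_eq_top_of_normal (irrep e i).ker inferInstance with h | h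
  · have : g ∈ (irrep e i).ker := hg
    rw [h] at this; exact this
  · exfalso
    have h1 : ∀ g, chi e i g = d i := fun g => by
      have : g ∈ (irrep e i).ker := by rw [h]; trivial
      rw [chi, (MonoidHom.mem_ker).1 this]; simp
    have h2 := row_orthogonality e i₀ i
    rw [if_neg hi.symm] at h2
    simp only [h₀, h1, one_mul, Finset.sum_const, Finset.card_univ, nsmul_eq_mul] at h2
    exact mul_ne_zero (card_ne_zero' G) (natCast_dim_ne_zero d i) h2

variable (hG : ¬ ∀ a b : G, a * b = b * a)
include hG

theorem irrep_not_central {g : G} (hg : g ≠ 1) : ¬ ∀ h, Commute (irrep e i h) (irrep e i g) := by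
  intro hc
  refine hG fun a b => ?_
  let Z : Subgroup G :=
    { carrier := {g | ∀ h, Commute (irrep e i h) (irrep e i g)}
      one_mem' := fun h => by simp
      mul_mem' := fun ha hb h => by rw [map_mul]; exact (ha h).mul_right (hb h)
      inv_mem' := fun {a} ha h => by
        have h1 : (irrep e i a⁻¹) * irrep e i a = 1 := by rw [← map_mul]; simp
        have h2 : (irrep e i a) * irrep e i a⁻¹ = 1 := by rw [← map_mul]; simp
        calc irrep e i h * irrep e i a⁻¹
            = irrep e i a⁻¹ * (irrep e i a * irrep e i h) * irrep e i a⁻¹ := by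
              rw [← mul_assoc, h1, one_mul]
          _ = irrep e i a⁻¹ * irrep e i h := by
              rw [← (ha h).eq, mul_assoc, mul_assoc, h2, mul_one] }
  have hZ : Z.Normal := ⟨fun n hn g => by
    change ∀ h, Commute (irrep e i h) (irrep e i (g * n * g⁻¹))
    intro h
    have h2 := hn (g⁻¹ * h * g)
    rw [Commute, SemiconjBy, ← map_mul, ← map_mul] at h2 ⊢
    have h3 := congrArg (fun M => irrep e i g * M * irrep e i g⁻¹) h2
    simp only [← map_mul] at h3
    convert h3 using 2 <;> group⟩
  have hZt : Z = ⊤ := by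
    rcases IsSimpleGroup.eq_bot_or_eq_top_of_normal Z hZ with h | h
    · have : g ∈ Z := hc
      rw [h] at this; exact absurd this hg
    · exact h
  have hb : b ∈ Z := by rw [hZt]; trivial
  have h1 : irrep e i (a * b * (b * a)⁻¹) = 1 := by
    rw [map_mul, map_mul, (hb a).eq, ← map_mul, ← map_mul]; simp
  exact mul_inv_eq_one.1 (irrep_injective e h₀ hi h1)

theorem det_irrep (g : G) : (irrep e i g).det = 1 := by
  let δ : G →* ℂ := (Matrix.detMonoidHom).comp (irrep e i)
  rcases IsSimpleGroup.eq_bot_or_eq_top_of_normal δ.ker inferInstance with h | h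
  · exact absurd (fun a b => (MonoidHom.ker_eq_bot_iff δ).1 h (by
      rw [map_mul, map_mul, mul_comm])) hG
  · have : g ∈ δ.ker := by rw [h]; trivial
    exact this

theorem one_lt_dim : 1 < d i := by
  by_contra hd
  have hd1 : d i = 1 := by have := NeZero.ne (d i); omega
  have : Subsingleton (Fin (d i)) := by rw [hd1]; infer_instance
  have : Nontrivial G := inferInstance
  obtain ⟨g, hg⟩ := exists_ne (1 : G)
  refine irrep_not_central e h₀ hi hG hg fun h => ?_
  ext a b
  obtain rfl := Subsingleton.elim a b
  rw [Matrix.mul_apply, Matrix.mul_apply, Fintype.sum_subsingleton _ a,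
    Fintype.sum_subsingleton _ a, mul_comm]

/-- Values at an involution: `χ(t) = d - 2m` with `m` even and `0 < m < d`. -/
theorem chi_involution {t : G} (ht : t ^ 2 = 1) (ht1 : t ≠ 1) :
    ∃ m : ℕ, chi e i t = d i - 2 * m ∧ Even m ∧ 0 < m ∧ m < d i := by
  obtain ⟨m, hm, hdet⟩ := det_involution e i ht
  rw [det_irrep e h₀ hi hG] at hdet
  have hev : Even m := by
    rcases Nat.even_or_odd m with h | h
    · exact h
    · rw [h.neg_one_pow] at hdet; norm_num at hdet
  obtain ⟨k, hk, hle, heq⟩ := chi_mean e i (n := 2) (by norm_num) ht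
  rw [Finset.sum_range_succ, Finset.sum_range_one, pow_zero, pow_one, chi_one, hm] at hk
  have hkm : (d i : ℂ) = k + m := by
    have : (2 : ℂ) ≠ 0 := two_ne_zero
    apply mul_left_cancel₀ this; push_cast at hk; linear_combination hk
  have hkm' : d i = k + m := by exact_mod_cast hkm
  refine ⟨m, hm, hev, ?_, ?_⟩
  · by_contra h0
    exact ht1 (irrep_injective e h₀ hi (heq (by omega)))
  · by_contra h0
    have hk0 : k = 0 := by omega
    obtain ⟨P, hP⟩ : ∃ P : Matrix (Fin (d i)) (Fin (d i)) ℂ, P = (1 / 2 : ℂ) • (1 - irrep e i t) := ⟨_, rfl⟩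
    have hPP : P * P = P := by
      have h2 : irrep e i t * irrep e i t = 1 := by rw [← map_mul, ← pow_two, ht, map_one]
      rw [hP]
      simp only [Matrix.smul_mul, Matrix.mul_smul, mul_sub, sub_mul, h2, mul_one, one_mul]
      module
    obtain ⟨l, hl, -, hl1⟩ := trace_idempotent P hPP
    have hld : (l : ℂ) = m := by
      rw [← hl, hP, Matrix.trace_smul, Matrix.trace_sub, Matrix.trace_one, Fintype.card_fin]
      change (1 / 2 : ℂ) * (d i - chi e i t) = m
      rw [hm]; ring
    have hld' : l = m := by exact_mod_cast hld
    have hP1 := hl1 (by rw [Fintype.card_fin]; omega)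
    have ht' : irrep e i t = (-1 : ℂ) • (1 : Matrix _ _ ℂ) := by
      have : irrep e i t = 1 - (2 : ℂ) • P := by rw [hP]; module
      rw [this, hP1]; module
    refine irrep_not_central e h₀ hi hG ht1 fun h => ?_
    rw [ht']
    exact (Commute.one_right _).smul_right _

end Simple
end GroupChar

namespace GroupChar
open Matrix Finset
variable {G : Type*} [Group G] [Fintype G] [DecidableEq G] {r : ℕ} {d : Fin r → ℕ}
  [∀ i, NeZero (d i)] (e : Wedderburn G r d)

theorem class_mul (K L : Finset G) (hK : ∀ g, ∀ c ∈ K, g * c * g⁻¹ ∈ K)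
    (hL : ∀ g, ∀ c ∈ L, g * c * g⁻¹ ∈ L) (x : G) :
    ∑ i, (∑ c ∈ K, chi e i c) * (∑ c ∈ L, chi e i c) * chi e i x⁻¹ / d i =
      Fintype.card G * #{c ∈ K | c⁻¹ * x ∈ L} := by
  have h1 : ∀ i, ∑ c ∈ K, ∑ c' ∈ L, chi e i (c * c' * x⁻¹) =
      (∑ c ∈ K, chi e i c) * (∑ c ∈ L, chi e i c) * chi e i x⁻¹ / (d i * d i) := by
    intro i
    have h : ∑ c ∈ K, ∑ c' ∈ L, chi e i (c * c' * x⁻¹) =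
      ((∑ c ∈ K, irrep e i c) * (∑ c ∈ L, irrep e i c) * irrep e i x⁻¹).trace := by
      rw [Finset.sum_mul_sum]
      simp only [Finset.sum_mul, Matrix.trace_sum, ← map_mul]; rfl
    rw [h, class_scalar e i K hK, class_scalar e i L hL]
    simp only [Matrix.smul_mul, one_mul, Matrix.trace_smul, smul_eq_mul]
    change _ * (_ * chi e i x⁻¹) = _
    have := natCast_dim_ne_zero d i
    field_simp
  have h2 : ∀ i, (∑ c ∈ K, chi e i c) * (∑ c ∈ L, chi e i c) * chi e i x⁻¹ / d i =
      ∑ c ∈ K, ∑ c' ∈ L, d i * chi e i (c * c' * x⁻¹) := by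
    intro i
    simp only [← Finset.mul_sum]
    rw [h1]
    have := natCast_dim_ne_zero d i
    field_simp
  simp only [h2]
  rw [Finset.sum_comm]
  have h3 : ∀ c ∈ K, ∑ i, ∑ c' ∈ L, d i * chi e i (c * c' * x⁻¹) =
      if c⁻¹ * x ∈ L then (Fintype.card G : ℂ) else 0 := by
    intro c _
    rw [Finset.sum_comm]
    simp only [sum_dim_chi]
    have : ∀ c', c * c' * x⁻¹ = 1 ↔ c' = c⁻¹ * x := fun c' => by
      rw [mul_inv_eq_one, eq_inv_mul_iff_mul_eq]
    simp only [this, Finset.sum_ite_eq']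
  rw [Finset.sum_congr rfl h3, ← Finset.sum_filter, Finset.sum_const, nsmul_eq_mul, mul_comm]

theorem prime_dvd_card_factorizations {p : ℕ} [Fact p.Prime] (K L : Finset G)
    (hK : ∀ g, ∀ c ∈ K, g * c * g⁻¹ ∈ K) (hL : ∀ g, ∀ c ∈ L, g * c * g⁻¹ ∈ L) {x : G}
    (hx : orderOf x = p) (hKx : ∀ c ∈ K, ¬ Commute x c) : p ∣ #{c ∈ K | c⁻¹ * x ∈ L} := by
  set X : Finset G := {c ∈ K | c⁻¹ * x ∈ L} with hX
  have hmem : ∀ g ∈ Subgroup.zpowers x, ∀ c ∈ X, g * c * g⁻¹ ∈ X := by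
    intro g hg c hc
    simp only [hX, Finset.mem_filter] at hc ⊢
    refine ⟨hK g c hc.1, ?_⟩
    have hgx : g * x = x * g := by
      obtain ⟨k, rfl⟩ := Subgroup.mem_zpowers_iff.1 hg
      exact (Commute.zpow_self x k)
    have := hL g _ hc.2
    convert this using 1
    have : x = g * x * g⁻¹ := by rw [hgx]; group
    conv_lhs => rw [this]
    group
  letI : MulAction (Subgroup.zpowers x) X :=
    { smul := fun g c => ⟨g * c * (g : G)⁻¹, hmem g g.2 c c.2⟩
      one_smul := fun c => Subtype.ext (by change (1 : G) * c * (1 : G)⁻¹ = c; simp)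
      mul_smul := fun g h c => Subtype.ext (by
        change ((g : G) * h) * c * ((g : G) * h)⁻¹ = g * (h * c * (h : G)⁻¹) * (g : G)⁻¹
        group) }
  have hp : IsPGroup p (Subgroup.zpowers x) :=
    IsPGroup.of_card (n := 1) (by rw [Nat.card_zpowers, hx, pow_one])
  have h1 := hp.card_modEq_card_fixedPoints X
  have h2 : IsEmpty (MulAction.fixedPoints (Subgroup.zpowers x) X) := ⟨fun ⟨c, hc⟩ => by
    have h3 := congrArg Subtype.val (hc ⟨x, Subgroup.mem_zpowers x⟩)
    change x * c * x⁻¹ = c at h3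
    exact hKx c (Finset.mem_filter.1 c.2).1 (mul_inv_eq_iff_eq_mul.1 h3)⟩
  rw [Nat.card_of_isEmpty (α := MulAction.fixedPoints (Subgroup.zpowers x) X), Nat.card_eq_fintype_card, Fintype.card_coe] at h1
  exact (Nat.modEq_zero_iff_dvd).1 h1

theorem conj_ne_one {g c : G} (hc : c ≠ 1) : g⁻¹ * c * g ≠ 1 := by
  intro h
  apply hc
  have : c = g * (g⁻¹ * c * g) * g⁻¹ := by group
  rw [this, h]; group

/-- The nontrivial elements of the conjugates of the cyclic group generated by `h`. -/
noncomputable def rationalClass (h : G) : Finset G :=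
  open Classical in {c | c ≠ 1 ∧ ∃ a, a⁻¹ * c * a ∈ Subgroup.zpowers h}

theorem mem_rationalClass {h c : G} :
    c ∈ rationalClass h ↔ c ≠ 1 ∧ ∃ a, a⁻¹ * c * a ∈ Subgroup.zpowers h := by
  simp [rationalClass]

theorem rationalClass_conj (h g : G) : ∀ c ∈ rationalClass h, g * c * g⁻¹ ∈ rationalClass h := by
  intro c hc
  obtain ⟨h1, a, ha⟩ := mem_rationalClass.1 hc
  refine mem_rationalClass.2 ⟨by simpa using h1, g * a, ?_⟩
  convert ha using 1; group

theorem zpowers_eq_of_mem {p : ℕ} [Fact p.Prime] {h c : G} (hh : orderOf h = p)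
    (hc : c ∈ Subgroup.zpowers h) (hc1 : c ≠ 1) : Subgroup.zpowers c = Subgroup.zpowers h := by
  have hfin : Finite (Subgroup.zpowers h) :=
    Nat.finite_of_card_ne_zero (by rw [Nat.card_zpowers, hh]; exact (Fact.out : p.Prime).ne_zero)
  refine Subgroup.eq_of_le_of_card_ge ((Subgroup.zpowers_le).2 hc) ?_
  rw [Nat.card_zpowers, Nat.card_zpowers, hh]
  have h1 : orderOf c ∣ p := hh ▸ Nat.card_zpowers h ▸ (Subgroup.orderOf_dvd_natCard _ hc)
  rcases (Nat.dvd_prime Fact.out).1 h1 with h2 | h2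
  · exact absurd (orderOf_eq_one_iff.1 h2) hc1
  · exact h2.ge

theorem sum_rationalClass {p : ℕ} [Fact p.Prime] {h : G} (hh : orderOf h = p) (i : Fin r) :
    (Nat.card (Subgroup.normalizer (Subgroup.zpowers h : Set G)) : ℂ) * ∑ c ∈ rationalClass h, chi e i c =
      Fintype.card G * (∑ k ∈ range p, chi e i (h ^ k) - d i) := by
  classical
  have hp : 0 < p := (Fact.out : p.Prime).pos
  have h1 : ∑ k ∈ range p, chi e i (h ^ k) - d i =
      ∑ z ∈ ({z | z ∈ Subgroup.zpowers h ∧ z ≠ 1} : Finset G), chi e i z := by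
    obtain ⟨q, rfl⟩ : ∃ q, p = q + 1 := ⟨p - 1, by omega⟩
    rw [Finset.sum_range_succ', pow_zero, chi_one, add_sub_cancel_right]
    refine Finset.sum_bij (fun k _ => h ^ (k + 1)) ?_ ?_ ?_ ?_
    · intro k hk
      have hk := Finset.mem_range.1 hk
      simp only [Finset.mem_filter, Finset.mem_univ, true_and]
      refine ⟨Subgroup.npow_mem_zpowers h _, fun h0 => ?_⟩
      have := Nat.le_of_dvd (by omega) (hh ▸ orderOf_dvd_of_pow_eq_one h0)
      omega
    · intro a ha b hb hab
      have ha := Finset.mem_range.1 ha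
      have hb := Finset.mem_range.1 hb
      have := pow_injOn_Iio_orderOf (x := h) (by simp; omega) (by simp; omega) hab
      omega
    · intro z hz
      simp only [Finset.mem_filter, Finset.mem_univ, true_and] at hz
      obtain ⟨k, hk, rfl⟩ : ∃ k < orderOf h, h ^ k = z := by
        have := (isOfFinOrder_of_finite h).mem_powers_iff_mem_range_orderOf.1
          ((isOfFinOrder_of_finite h).mem_powers_iff_mem_zpowers.2 hz.1)
        simpa using this
      rcases k with _ | k
      · simp at hz
      · exact ⟨k, Finset.mem_range.2 (by omega), rfl⟩
    · intro k _; rfl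
  rw [h1]
  set Z : Finset G := {z | z ∈ Subgroup.zpowers h ∧ z ≠ 1}
  have h2 : (Fintype.card G : ℂ) * ∑ z ∈ Z, chi e i z = ∑ a : G, ∑ z ∈ Z, chi e i (a * z * a⁻¹) := by
    simp only [chi_conj, Finset.sum_const, Finset.card_univ, nsmul_eq_mul]
  have h3 : ∀ a : G, ∑ z ∈ Z, chi e i (a * z * a⁻¹) =
      ∑ c ∈ rationalClass h, if a⁻¹ * c * a ∈ Subgroup.zpowers h then chi e i c else 0 := by
    intro a
    rw [← Finset.sum_filter]
    refine Finset.sum_bij' (fun z _ => a * z * a⁻¹) (fun c _ => a⁻¹ * c * a) ?_ ?_ ?_ ?_ ?_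
    · intro z hz
      simp only [Z, Finset.mem_filter, Finset.mem_univ, true_and] at hz
      have : a⁻¹ * (a * z * a⁻¹) * a = z := by group
      exact Finset.mem_filter.2 ⟨mem_rationalClass.2 ⟨by simpa using hz.2, a, by rw [this]; exact hz.1⟩,
        by rw [this]; exact hz.1⟩
    · intro c hc
      have := Finset.mem_filter.1 hc
      simp only [Z, Finset.mem_filter, Finset.mem_univ, true_and]
      refine ⟨this.2, ?_⟩
      exact conj_ne_one (mem_rationalClass.1 this.1).1
    · intro z _; group
    · intro z _; group
    · intro z _; rfl
  rw [h2, Finset.sum_congr rfl fun a _ => h3 a, Finset.sum_comm, Finset.mul_sum]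
  refine Finset.sum_congr rfl fun c hc => ?_
  rw [← Finset.sum_filter, Finset.sum_const, nsmul_eq_mul]
  congr 2
  obtain ⟨hc1, b, hb⟩ := mem_rationalClass.1 hc
  have hz1 : b⁻¹ * c * b ≠ 1 := conj_ne_one hc1
  have key : ∀ a, a⁻¹ * c * a ∈ Subgroup.zpowers h ↔
      b⁻¹ * a ∈ Subgroup.normalizer (Subgroup.zpowers h : Set G) := by
    intro a
    rw [Subgroup.mem_normalizer_iff'']
    generalize hn : b⁻¹ * a = n
    have ha : a = b * n := by rw [← hn]; group
    have hzn : a⁻¹ * c * a = n⁻¹ * (b⁻¹ * c * b) * n := by rw [ha]; group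
    rw [hzn]
    generalize b⁻¹ * c * b = z at hb hz1
    refine ⟨fun hm w => ?_, fun hm => (hm z).1 hb⟩
    have e1 := zpowers_eq_of_mem hh hb hz1
    have e2 := zpowers_eq_of_mem hh hm (conj_ne_one hz1)
    have hpow : ∀ k : ℤ, (n⁻¹ * z * n) ^ k = n⁻¹ * z ^ k * n := fun k => by
      simpa using (conj_zpow (a := n⁻¹) (b := z) (i := k))
    constructor
    · intro hw
      rw [← e1] at hw
      obtain ⟨k, rfl⟩ := Subgroup.mem_zpowers_iff.1 hw
      rw [← hpow]
      exact Subgroup.zpow_mem _ hm k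
    · intro hw
      rw [← e2] at hw
      obtain ⟨k, hk⟩ := Subgroup.mem_zpowers_iff.1 hw
      rw [hpow] at hk
      have : w = z ^ k := by simpa using hk.symm
      rw [this]
      exact Subgroup.zpow_mem _ hb k
  rw [Nat.card_eq_fintype_card, Fintype.card_subtype]
  refine Finset.card_bij' (fun n _ => b * n) (fun a _ => b⁻¹ * a) ?_ ?_ ?_ ?_
  · intro n hn
    simp only [Finset.mem_filter, Finset.mem_univ, true_and] at hn ⊢
    rw [key]; simpa using hn
  · intro a ha
    simp only [Finset.mem_filter, Finset.mem_univ, true_and] at ha ⊢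
    exact (key a).1 ha
  · intro n _; group
  · intro n _; group

/-- Column orthogonality: the norm of a column is the order of the centralizer. -/
theorem sum_normSq_chi (g : G) :
    ∑ i, Complex.normSq (chi e i g) = Nat.card (Subgroup.centralizer {g}) := by
  have h1 := column_orthogonality e g g⁻¹
  simp only [chi_inv, Complex.mul_conj] at h1
  have h2 : #{a | a * g * a⁻¹ * g⁻¹ = 1} = Nat.card (Subgroup.centralizer {g}) := by
    classical
    rw [Nat.card_eq_fintype_card, Fintype.card_subtype]
    congr 1
    ext a
    simp only [Finset.mem_filter, Finset.mem_univ, true_and, Subgroup.mem_centralizer_singleton_iff]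
    rw [mul_inv_eq_one, mul_inv_eq_iff_eq_mul]
  rw [h2] at h1
  exact_mod_cast h1

/-- The sum of a character over the nontrivial powers of an element. -/
noncomputable def powerSum (i : Fin r) (h : G) (p : ℕ) : ℂ := ∑ k ∈ range p, chi e i (h ^ k) - d i

theorem powerSum_eq (i : Fin r) (h : G) {p : ℕ} (hp : 0 < p) :
    powerSum e i h p = ∑ k ∈ Ico 1 p, chi e i (h ^ k) := by
  rw [powerSum, Finset.range_eq_Ico, Finset.sum_eq_sum_Ico_succ_bot hp, pow_zero, chi_one,
    add_sub_cancel_left]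

theorem sum_powerSum_mul_chi {p : ℕ} [Fact p.Prime] {h : G} (hh : orderOf h = p) {j : ℕ}
    (hj : j ∈ Ico 1 p) : ∑ i, powerSum e i h p * chi e i (h ^ j) =
      Nat.card (Subgroup.normalizer (Subgroup.zpowers h : Set G)) := by
  classical
  have hp : p.Prime := Fact.out
  rw [mem_Ico] at hj
  simp only [powerSum_eq e _ h hp.pos, Finset.sum_mul]
  rw [Finset.sum_comm]
  simp only [column_orthogonality]
  rw [← Nat.cast_sum, Nat.cast_inj]
  simp only [Finset.card_filter]
  rw [Finset.sum_comm, Nat.subtype_card (univ.filter fun g => g ∈ Subgroup.normalizer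
    (Subgroup.zpowers h : Set G)) (by simp), Finset.card_filter]
  have hne : ∀ k, 1 ≤ k → k < p → h ^ k ≠ 1 := fun k h1 h2 h0 =>
    absurd (Nat.le_of_dvd h1 (hh ▸ orderOf_dvd_of_pow_eq_one h0)) (by omega)
  refine Finset.sum_congr rfl fun g _ => ?_
  split_ifs with hg
  · have h1 : g⁻¹ * (h ^ j)⁻¹ * g ∈ Subgroup.zpowers h :=
      (Subgroup.mem_normalizer_iff''.1 hg _).1 (inv_mem (Subgroup.npow_mem_zpowers h j))
    rw [← mem_powers_iff_mem_zpowers, mem_powers_iff_mem_range_orderOf, hh, mem_image] at h1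
    obtain ⟨k, hk, hk1⟩ := h1
    have hk' := mem_range.1 hk
    have hk0 : k ≠ 0 := by
      rintro rfl
      refine hne j hj.1 hj.2 ?_
      have : g * (g⁻¹ * (h ^ j)⁻¹ * g) * g⁻¹ = 1 := by rw [← hk1]; simp
      rw [← inv_eq_one, ← this]
      group
    rw [Finset.sum_eq_single k]
    · rw [if_pos]
      rw [hk1]; group
    · intro l hl hlk
      rw [if_neg]
      intro h2
      refine hlk ?_
      have h3 : h ^ l = h ^ k := by
        rw [hk1, ← eq_inv_of_mul_eq_one_left h2]; group
      exact pow_injOn_Iio_orderOf (by rw [hh]; exact (mem_Ico.1 hl).2) (by rw [hh]; exact hk') h3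
    · intro h2
      exact absurd (mem_Ico.2 ⟨by omega, hk'⟩) h2
  · refine Finset.sum_eq_zero fun k hk => if_neg fun h2 => hg ?_
    rw [mem_Ico] at hk
    have hn : MulAut.conj g (h ^ k) = (h ^ j)⁻¹ := eq_inv_of_mul_eq_one_left h2
    have h3 : (Subgroup.zpowers h).map (MulAut.conj g).toMonoidHom = Subgroup.zpowers h := by
      conv_lhs => rw [← zpowers_eq_of_mem hh (Subgroup.npow_mem_zpowers h k) (hne k hk.1 hk.2)]
      rw [MonoidHom.map_zpowers]
      show Subgroup.zpowers (MulAut.conj g (h ^ k)) = _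
      rw [hn, Subgroup.zpowers_inv]
      exact zpowers_eq_of_mem hh (Subgroup.npow_mem_zpowers h j) (hne j hj.1 hj.2)
    rw [Subgroup.mem_normalizer_iff]
    intro y
    conv_rhs => rw [← h3]
    exact ⟨fun hy => ⟨y, hy, rfl⟩, fun ⟨z, hz, hzy⟩ => by
      have : z = y := (MulAut.conj g).injective hzy
      rwa [← this]⟩

theorem sum_powerSum_sq {p : ℕ} [Fact p.Prime] {h : G} (hh : orderOf h = p) :
    ∑ i, powerSum e i h p ^ 2 =
      (p - 1 : ℕ) * Nat.card (Subgroup.normalizer (Subgroup.zpowers h : Set G)) := by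
  have h1 : ∀ i, powerSum e i h p ^ 2 = ∑ j ∈ Ico 1 p, powerSum e i h p * chi e i (h ^ j) :=
    fun i => by rw [← Finset.mul_sum, ← powerSum_eq e i h (Fact.out : p.Prime).pos, sq]
  simp only [h1]
  rw [Finset.sum_comm, Finset.sum_congr rfl fun j hj => sum_powerSum_mul_chi e hh hj]
  simp

theorem sum_powerSum_mul_powerSum {p q : ℕ} [Fact p.Prime] [Fact q.Prime] (hpq : p ≠ q) {h h' : G}
    (hh : orderOf h = p) (hh' : orderOf h' = q) :
    ∑ i, powerSum e i h p * powerSum e i h' q = 0 := by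
  simp only [powerSum_eq e _ _ (Fact.out : p.Prime).pos, powerSum_eq e _ _ (Fact.out : q.Prime).pos,
    Finset.sum_mul_sum]
  rw [Finset.sum_comm]
  refine Finset.sum_eq_zero fun k hk => ?_
  rw [Finset.sum_comm]
  refine Finset.sum_eq_zero fun l _ => ?_
  rw [column_orthogonality, Nat.cast_eq_zero, Finset.card_eq_zero, Finset.filter_eq_empty_iff]
  intro g _ h1
  have h2 : (g * h ^ k * g⁻¹) ^ p = 1 := by
    rw [conj_pow, ← pow_mul, mul_comm, pow_mul, ← hh, pow_orderOf_eq_one]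
    simp
  have h3 : (g * h ^ k * g⁻¹) ^ q = 1 := by
    rw [eq_inv_of_mul_eq_one_left h1, inv_pow, ← pow_mul, mul_comm, pow_mul, ← hh',
      pow_orderOf_eq_one]
    simp
  have h4 : g * h ^ k * g⁻¹ = 1 := by
    have := (Nat.coprime_primes (Fact.out : p.Prime) (Fact.out : q.Prime)).2 hpq
    have h5 := Nat.dvd_gcd (orderOf_dvd_of_pow_eq_one h2) (orderOf_dvd_of_pow_eq_one h3)
    rw [this] at h5
    exact orderOf_eq_one_iff.1 (Nat.dvd_one.1 h5)
  rw [conj_eq_one_iff] at h4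
  rw [mem_Ico] at hk
  exact absurd (Nat.le_of_dvd hk.1 (hh ▸ orderOf_dvd_of_pow_eq_one h4)) (by omega)

theorem sum_dim_mul_powerSum {p : ℕ} [Fact p.Prime] {h : G} (hh : orderOf h = p) :
    ∑ i, (d i : ℂ) * powerSum e i h p = 0 := by
  simp only [powerSum_eq e _ _ (Fact.out : p.Prime).pos, Finset.mul_sum]
  rw [Finset.sum_comm]
  refine Finset.sum_eq_zero fun k hk => ?_
  rw [sum_dim_chi, if_neg]
  intro h1
  rw [mem_Ico] at hk
  exact absurd (Nat.le_of_dvd hk.1 (hh ▸ orderOf_dvd_of_pow_eq_one h1)) (by omega)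

end GroupChar

namespace FixCount
open MulAction Subgroup
variable {G : Type*} [Group G] [Finite G]

theorem mk_mem_fixedBy {G : Type*} [Group G] {H : Subgroup G} {o g : G} :
    (g : G ⧸ H) ∈ fixedBy (G ⧸ H) o ↔ g⁻¹ * o * g ∈ H := by
  rw [mem_fixedBy, MulAction.Quotient.smul_coe, eq_comm, QuotientGroup.eq, smul_eq_mul, mul_assoc]

theorem fixedBy_subset_pow {G X : Type*} [Group G] [MulAction G X] (o : G) (n : ℕ) :
    fixedBy X o ⊆ fixedBy X (o ^ n) := by
  simpa using fixedBy_subset_fixedBy_zpow X o n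

theorem ncard_inter_fixedBy_modEq {X : Type*} [Finite X] [MulAction G X] {p k : ℕ} [Fact p.Prime]
    {o : G} (ho : o ^ p ^ k = 1) {s : Set X} (hs : ∀ a ∈ s, o • a ∈ s) :
    s.ncard ≡ (s ∩ fixedBy X o).ncard [MOD p] := by
  have hpow : ∀ n : ℕ, ∀ a ∈ s, o ^ n • a ∈ s := by
    intro n
    induction n with
    | zero => simp
    | succ n ih => intro a ha; rw [pow_succ', mul_smul]; exact hs _ (ih a ha)
  let S : SubMulAction (zpowers o) X :=
    { carrier := s
      smul_mem' := by
        rintro ⟨c, hc⟩ a ha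
        obtain ⟨n, rfl⟩ := (mem_powers_iff_mem_zpowers.mpr hc)
        exact hpow n a ha }
  have hP : IsPGroup p (zpowers o) := by
    obtain ⟨j, -, hj⟩ := (Nat.dvd_prime_pow Fact.out).1 (orderOf_dvd_of_pow_eq_one ho)
    exact IsPGroup.of_card (n := j) (by rw [Nat.card_zpowers, hj])
  have key := hP.card_modEq_card_fixedPoints (α := S)
  have e2 : Nat.card (fixedPoints (zpowers o) S) = (s ∩ fixedBy X o).ncard := by
    rw [← Nat.card_coe_set_eq]
    refine Nat.card_congr
      ⟨fun a => ⟨a.1.1, a.1.2, congrArg Subtype.val (a.2 ⟨o, mem_zpowers o⟩)⟩,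
        fun a => ⟨⟨a.1, a.2.1⟩, ?_⟩, fun _ => rfl, fun _ => rfl⟩
    rintro ⟨c, hc⟩
    obtain ⟨n, rfl⟩ := (mem_powers_iff_mem_zpowers.mpr hc)
    apply Subtype.ext
    change o ^ n • a.1 = a.1
    exact fixedBy_subset_pow o n a.2.2
  rw [e2] at key
  exact key

theorem ncard_fixedBy_modEq {X : Type*} [Finite X] [MulAction G X] {p k : ℕ} [Fact p.Prime]
    {o : G} (ho : o ^ p ^ k = 1) : Nat.card X ≡ (fixedBy X o).ncard [MOD p] := by
  have := ncard_inter_fixedBy_modEq (X := X) ho (s := Set.univ) (by simp)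
  simpa [Set.ncard_univ] using this

theorem ncard_fixedBy_le {X : Type*} [Finite X] [MulAction G X] (o : G) :
    (fixedBy X o).ncard ≤ Nat.card X :=
  Set.ncard_le_card _

theorem ncard_fixedBy_lt [IsSimpleGroup G] {H : Subgroup G} (hH : H ≠ ⊤) {o : G} (ho : o ≠ 1) :
    (fixedBy (G ⧸ H) o).ncard < Nat.card (G ⧸ H) := by
  refine lt_of_le_of_ne (ncard_fixedBy_le o) fun h => ho ?_
  have hu : fixedBy (G ⧸ H) o = Set.univ :=
    Set.eq_of_subset_of_ncard_le (Set.subset_univ _) (by rw [Set.ncard_univ, h]) (Set.toFinite _)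
  have hc : H.normalCore = ⊥ := by
    refine (IsSimpleGroup.eq_bot_or_eq_top_of_normal _ H.normalCore_normal).resolve_right fun ht => ?_
    exact hH (top_le_iff.1 (ht ▸ H.normalCore_le))
  have : o ∈ H.normalCore := by
    intro b
    have : ((b⁻¹ : G) : G ⧸ H) ∈ fixedBy (G ⧸ H) o := hu ▸ Set.mem_univ _
    simpa using mk_mem_fixedBy.1 this
  rwa [hc, mem_bot] at this

theorem four_dvd_card_sub [IsSimpleGroup G] (hG : 2 < Nat.card G) {X : Type*} [Finite X]
    [MulAction G X] {o : G} (ho : o ^ 2 = 1) : 4 ∣ Nat.card X - (fixedBy X o).ncard := by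
  classical
  have := Fintype.ofFinite X
  have hsign : ∀ g : G, Equiv.Perm.sign (MulAction.toPerm g : Equiv.Perm X) = 1 := by
    let f : G →* ℤˣ := Equiv.Perm.sign.comp (MulAction.toPermHom G X)
    have hk : f.ker = ⊤ := by
      refine (IsSimpleGroup.eq_bot_or_eq_top_of_normal _ f.normal_ker).resolve_left fun hb => ?_
      have := Nat.card_le_card_of_injective f ((MonoidHom.ker_eq_bot_iff f).1 hb)
      have h2 : Nat.card ℤˣ = 2 := by simp [Nat.card_eq_fintype_card]
      omega
    intro g
    exact (MonoidHom.mem_ker (f := f)).1 (hk ▸ mem_top g)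
  have h1 := Equiv.Perm.sign_of_pow_two_eq_one (σ := (MulAction.toPerm o : Equiv.Perm X)) (by
    rw [← MulAction.toPermHom_apply, ← map_pow, ho, map_one])
  have e1 : Fintype.card (Function.fixedPoints (MulAction.toPerm o : Equiv.Perm X))
      = (fixedBy X o).ncard := by
    rw [← Nat.card_coe_set_eq, ← Nat.card_eq_fintype_card]; rfl
  rw [hsign, e1, ← Nat.card_eq_fintype_card] at h1
  have h2 := ncard_fixedBy_modEq (X := X) (p := 2) (k := 1) (o := o) (by simpa using ho)
  have hle := ncard_fixedBy_le (X := X) o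
  have heven : Even ((Nat.card X - (fixedBy X o).ncard) / 2) := by
    by_contra hodd
    rw [(Nat.not_even_iff_odd.1 hodd).neg_one_pow] at h1
    exact absurd h1 (by decide)
  obtain ⟨j, hj⟩ := heven
  have h3 : 2 ∣ Nat.card X - (fixedBy X o).ncard := (Nat.modEq_iff_dvd' hle).1 h2.symm
  omega

/-- `x` acts on the fixed points of an element commuting with it. -/
theorem ncard_fixedBy_modEq_inter {X : Type*} [Finite X] [MulAction G X] {p : ℕ} [Fact p.Prime]
    {x o : G} (hx : x ^ p = 1) (hxo : Commute x o) :
    (fixedBy X o).ncard ≡ (fixedBy X o ∩ fixedBy X x).ncard [MOD p] := by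
  refine ncard_inter_fixedBy_modEq (k := 1) (by simpa using hx) fun a ha => ?_
  rw [mem_fixedBy] at ha ⊢
  rw [← mul_smul, ← hxo.eq, mul_smul, ha]

/-- An action on 45 points in which `x` of order 11 has a unique fixed point. -/
theorem forty_five [IsSimpleGroup G] (hG : 2 < Nat.card G) {H : Subgroup G}
    (hH : Nat.card (G ⧸ H) = 45) {x : G} (hx : x ^ 11 = 1)
    (hfix : (fixedBy (G ⧸ H) x).ncard = 1) {O : Subgroup G} (hO : Nat.card O = 8)
    (hxO : ∀ o ∈ O, Commute x o) : False := by
  have htop : H ≠ ⊤ := by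
    rintro rfl
    have : Nat.card (G ⧸ (⊤ : Subgroup G)) = 1 := Subgroup.index_top
    omega
  have hpow : ∀ o ∈ O, o ^ 2 ^ 3 = 1 := by
    intro o ho
    have := pow_card_eq_one' (x := (⟨o, ho⟩ : O))
    rw [hO] at this
    simpa using congrArg Subtype.val this
  have hpar : ∀ o ∈ O, (fixedBy (G ⧸ H) o).ncard % 2 = 1 := by
    intro o ho
    have := ncard_fixedBy_modEq (X := G ⧸ H) (p := 2) (hpow o ho)
    rw [hH] at this
    exact this.symm
  haveI : Fact (Nat.Prime 11) := ⟨by norm_num⟩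
  have hone : ∀ o ∈ O, o ≠ 1 → o ^ 2 = 1 → (fixedBy (G ⧸ H) o).ncard = 1 := by
    intro o ho h1 h2
    have ha := hpar o ho
    have hb := four_dvd_card_sub hG (X := G ⧸ H) h2
    have hc := ncard_fixedBy_lt htop h1
    have hd := ncard_fixedBy_modEq_inter (X := G ⧸ H) hx (hxO o ho)
    have he : (fixedBy (G ⧸ H) o ∩ fixedBy (G ⧸ H) x).ncard ≤ 1 :=
      hfix ▸ Set.ncard_le_ncard Set.inter_subset_right (Set.toFinite _)
    rw [hH] at hb hc
    unfold Nat.ModEq at hd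
    have hf : (fixedBy (G ⧸ H) o ∩ fixedBy (G ⧸ H) x).ncard ≡ 1 [MOD 11] := by
      have h3 := ncard_fixedBy_modEq_inter (X := G ⧸ H) (p := 2) h2 (hxO o ho).symm
      rw [hfix, Set.inter_comm] at h3
      unfold Nat.ModEq at h3
      interval_cases h : (fixedBy (G ⧸ H) o ∩ fixedBy (G ⧸ H) x).ncard
      · omega
      · rfl
    unfold Nat.ModEq at hf
    omega
  have hall : ∀ o ∈ O, o ≠ 1 → (fixedBy (G ⧸ H) o).ncard = 1 := by
    intro o ho h1
    have : ∃ j : ℕ, o ^ j ≠ 1 ∧ (o ^ j) ^ 2 = 1 := by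
      by_cases h2 : o ^ 2 = 1
      · exact ⟨1, by simpa using h1, by simpa using h2⟩
      by_cases h4 : o ^ 4 = 1
      · exact ⟨2, h2, by rw [← pow_mul]; exact h4⟩
      · exact ⟨4, h4, by rw [← pow_mul]; exact hpow o ho⟩
    obtain ⟨j, hj1, hj2⟩ := this
    have h5 := hone _ (O.pow_mem ho j) hj1 hj2
    have h6 : (fixedBy (G ⧸ H) o).ncard ≤ (fixedBy (G ⧸ H) (o ^ j)).ncard :=
      Set.ncard_le_ncard (fixedBy_subset_pow o j) (Set.toFinite _)
    have := hpar o ho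
    omega
  classical
  have := Fintype.ofFinite O
  have := Fintype.ofFinite (G ⧸ H)
  have hb := MulAction.sum_card_fixedBy_eq_card_orbits_mul_card_group O (G ⧸ H)
  rw [← Nat.card_eq_fintype_card (α := O), hO] at hb
  have hs : ∀ o : O, Fintype.card (fixedBy (G ⧸ H) o) = if o = 1 then 45 else 1 := by
    intro o
    have e : Fintype.card (fixedBy (G ⧸ H) o) = (fixedBy (G ⧸ H) (o : G)).ncard := by
      rw [← Nat.card_coe_set_eq, ← Nat.card_eq_fintype_card]; rfl
    rw [e]
    split_ifs with h
    · subst h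
      rw [OneMemClass.coe_one, ← hH, ← Set.ncard_univ]
      congr 1
      ext a
      simp
    · exact hall o o.2 (fun hh => h (Subtype.ext hh))
  rw [Finset.sum_congr rfl (fun o _ => hs o),
    ← Finset.add_sum_erase _ _ (Finset.mem_univ (1 : O)), if_pos rfl,
    Finset.sum_congr rfl (fun o ho => if_neg (Finset.ne_of_mem_erase ho)),
    Finset.sum_const, Finset.card_erase_of_mem (Finset.mem_univ _), Finset.card_univ,
    ← Nat.card_eq_fintype_card, hO] at hb
  simp only [smul_eq_mul] at hb
  omega
end FixCount

namespace FixCount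
open MulAction Subgroup
variable {G : Type*} [Group G] [Finite G]

theorem ncard_mul_card_inf (K L : Subgroup G) {s : Set (G ⧸ L)}
    (hs : ∀ g : G, (g : G ⧸ L) ∈ s ↔ ∃ k ∈ K, g⁻¹ * k ∈ L) :
    s.ncard * Nat.card (K ⊓ L : Subgroup G) = Nat.card K := by
  have horb : orbit K ((1 : G) : G ⧸ L) = s := by
    ext a
    obtain ⟨g, rfl⟩ := QuotientGroup.mk_surjective a
    rw [hs, mem_orbit_iff]
    constructor
    · rintro ⟨k, hk⟩
      refine ⟨k, k.2, ?_⟩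
      have : ((k : G) * 1 : G) = (g : G ⧸ L) := hk
      rw [mul_one] at this
      exact QuotientGroup.eq.1 this.symm
    · rintro ⟨k, hk, hg⟩
      refine ⟨⟨k, hk⟩, ?_⟩
      change ((k * 1 : G) : G ⧸ L) = g
      rw [mul_one]
      exact (QuotientGroup.eq.2 hg).symm
  have hst : stabilizer K ((1 : G) : G ⧸ L) = L.subgroupOf K := by
    ext k
    rw [mem_stabilizer_iff, mem_subgroupOf]
    change (((k : G) * 1 : G) : G ⧸ L) = (1 : G) ↔ _
    rw [mul_one, eq_comm, QuotientGroup.eq]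
    simp
  have h := Subgroup.card_mul_index (stabilizer K ((1 : G) : G ⧸ L))
  rw [MulAction.index_stabilizer, horb, hst] at h
  rw [← h, mul_comm]
  congr 1
  exact Nat.card_congr
    ⟨fun a => ⟨⟨a.1, a.2.1⟩, a.2.2⟩, fun a => ⟨a.1.1, a.1.2, a.2⟩, fun _ => rfl, fun _ => rfl⟩

variable {p : ℕ} [Fact p.Prime] (Q : Sylow p G)

theorem mem_sylow_of_pow {k : ℕ} {z : G} (hz : z ^ p ^ k = 1) (hN : z ∈ normalizer (Q : Set G)) :
    z ∈ Q := by
  have hP : IsPGroup p (zpowers z) := by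
    obtain ⟨j, -, hj⟩ := (Nat.dvd_prime_pow Fact.out).1 (orderOf_dvd_of_pow_eq_one hz)
    exact IsPGroup.of_card (n := j) (by rw [Nat.card_zpowers, hj])
  have h := hP.inf_normalizer_sylow Q
  have : z ∈ zpowers z ⊓ normalizer (Q : Set G) := ⟨mem_zpowers z, hN⟩
  rw [h] at this
  exact this.2

variable {Q} {x : G} (hQ : zpowers x = Q) (hx : orderOf x = p)
include hQ

theorem mem_centralizer_iff_commute {o : G} : o ∈ centralizer (Q : Set G) ↔ Commute x o := by
  rw [mem_centralizer_iff]
  constructor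
  · intro h
    exact h x (hQ ▸ mem_zpowers x : x ∈ (Q : Subgroup G))
  · intro h z hz
    obtain ⟨n, rfl⟩ : z ∈ zpowers x := by rw [hQ]; exact hz
    exact (h.zpow_left n).eq

theorem mem_normalizer_of_commute {o : G} (ho : Commute x o) : o ∈ normalizer (Q : Set G) :=
  centralizer_le_normalizer _ ((mem_centralizer_iff_commute hQ).2 ho)

theorem commute_conj_of_mem_normalizer {o k : G} (ho : Commute x o)
    (hk : k ∈ normalizer (Q : Set G)) : Commute x (k * o * k⁻¹) := by
  have h1 : k⁻¹ * x * k ∈ (Q : Subgroup G) :=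
    (mem_normalizer_iff''.1 hk x).1 (hQ ▸ mem_zpowers x)
  rw [← hQ] at h1
  obtain ⟨n, hn⟩ := h1
  have h2 : Commute (k⁻¹ * x * k) o := hn ▸ ho.zpow_left n
  have h3 := h2.map (MulAut.conj k).toMonoidHom
  simpa [mul_assoc] using h3

include hx

theorem mem_normalizer_of_conj_mem {g : G} (hg : g⁻¹ * x * g ∈ normalizer (Q : Set G)) :
    g ∈ normalizer (Q : Set G) := by
  have hz : g⁻¹ * x * g = MulAut.conj g⁻¹ x := by simp
  have hord : orderOf (g⁻¹ * x * g) = p := by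
    rw [hz, ← hx]
    exact orderOf_injective (MulAut.conj g⁻¹).toMonoidHom (MulAut.conj g⁻¹).injective x
  have h1 : g⁻¹ * x * g ∈ Q := mem_sylow_of_pow Q (k := 1)
    (by rw [pow_one, ← hord, pow_orderOf_eq_one]) hg
  have h2 : zpowers (g⁻¹ * x * g) = (Q : Subgroup G) := by
    refine eq_of_le_of_card_ge (zpowers_le.2 h1) ?_
    rw [← hQ, Nat.card_zpowers, Nat.card_zpowers, hord, hx]
  have h3 : ((zpowers x).map (MulAut.conj g⁻¹).toMonoidHom) = zpowers (g⁻¹ * x * g) := by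
    rw [MonoidHom.map_zpowers, hz]; rfl
  refine mem_normalizer_iff''.2 fun h => ?_
  change h ∈ (Q : Subgroup G) ↔ _ ∈ (Q : Subgroup G)
  rw [h2, hQ] at h3
  have e : g⁻¹ * h * g = (MulAut.conj g⁻¹).toMonoidHom h := by simp
  rw [e]
  have h4 := mem_map_iff_mem (f := (MulAut.conj g⁻¹).toMonoidHom) (MulAut.conj g⁻¹).injective
    (K := (Q : Subgroup G)) (x := h)
  rw [h3] at h4
  exact h4.symm

theorem fixedBy_normalizer :
    fixedBy (G ⧸ normalizer (Q : Set G)) x = {((1 : G) : G ⧸ normalizer (Q : Set G))} := by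
  ext a
  obtain ⟨g, rfl⟩ := QuotientGroup.mk_surjective a
  rw [mk_mem_fixedBy, Set.mem_singleton_iff, eq_comm, QuotientGroup.eq, inv_one, one_mul]
  refine ⟨mem_normalizer_of_conj_mem hQ hx, fun hg => ?_⟩
  have : x ∈ normalizer (Q : Set G) := le_normalizer (hQ ▸ mem_zpowers x : x ∈ (Q : Subgroup G))
  exact mul_mem (mul_mem (inv_mem hg) this) hg

theorem card_quotient_normalizer_modEq : Nat.card (G ⧸ normalizer (Q : Set G)) ≡ 1 [MOD p] := by
  have := ncard_fixedBy_modEq (X := G ⧸ normalizer (Q : Set G)) (p := p) (k := 1) (o := x)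
    (by rw [pow_one, ← hx, pow_orderOf_eq_one])
  rwa [fixedBy_normalizer hQ hx, Set.ncard_singleton] at this

theorem ncard_fixedBy_normalizer_modEq {o : G} (ho : Commute x o) :
    (fixedBy (G ⧸ normalizer (Q : Set G)) o).ncard ≡ 1 [MOD p] := by
  have := ncard_fixedBy_modEq_inter (X := G ⧸ normalizer (Q : Set G)) (p := p) (x := x) (o := o)
    (by rw [← hx, pow_orderOf_eq_one]) ho
  rw [fixedBy_normalizer hQ hx, Set.inter_eq_right.2, Set.ncard_singleton] at this
  · exact this
  · rw [Set.singleton_subset_iff, mk_mem_fixedBy, inv_one, one_mul, mul_one]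
    exact mem_normalizer_of_commute hQ ho

omit hx in
/-- Fixed points of `o ∈ C(Q)` among the conjugates of `Q`. -/
theorem ncard_fixedBy_mul {o : G} (ho : Commute x o)
    (h : ∀ g, g⁻¹ * o * g ∈ normalizer (Q : Set G) → g⁻¹ * o * g ∈ centralizer (Q : Set G)) :
    (fixedBy (G ⧸ normalizer (Q : Set G)) o).ncard *
      Nat.card (centralizer {o} ⊓ normalizer (Q : Set G) : Subgroup G)
      = Nat.card (centralizer {o}) := by
  refine ncard_mul_card_inf _ _ fun g => ?_
  rw [mk_mem_fixedBy]
  constructor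
  · intro hg
    obtain ⟨n, hn, hgn⟩ := Q.conj_eq_normalizer_conj_of_mem_centralizer o g
      ((mem_centralizer_iff_commute hQ).2 ho) (h g hg)
    refine ⟨g * n⁻¹, ?_, by simpa using hn⟩
    rw [mem_centralizer_singleton_iff]
    have : o * g = g * (n⁻¹ * o * n) := by rw [← hgn]; group
    symm
    calc o * (g * n⁻¹) = (o * g) * n⁻¹ := by group
      _ = g * n⁻¹ * o := by rw [this]; group
  · rintro ⟨k, hk, hg⟩
    rw [mem_centralizer_singleton_iff] at hk
    have e : g⁻¹ * o * g = (g⁻¹ * k) * o * (g⁻¹ * k)⁻¹ := by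
      have : o = k * o * k⁻¹ := by rw [hk]; group
      conv_lhs => rw [this]
      group
    rw [e]
    have : o ∈ normalizer (Q : Set G) := mem_normalizer_of_commute hQ ho
    exact mul_mem (mul_mem hg this) (inv_mem hg)

omit hx in
/-- Fixed points of `x` on the conjugates of `o ∈ C(Q)`. -/
theorem ncard_fixedBy_centralizer_mul {o : G} (ho : Commute x o) :
    (fixedBy (G ⧸ centralizer {o}) x).ncard *
      Nat.card (normalizer (Q : Set G) ⊓ centralizer {o} : Subgroup G)
      = Nat.card (normalizer (Q : Set G)) := by
  refine ncard_mul_card_inf _ _ fun g => ?_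
  rw [mk_mem_fixedBy]
  constructor
  · intro hg
    rw [mem_centralizer_singleton_iff] at hg
    have h1 : Commute x (g * o * g⁻¹) := by
      have h3 := (show Commute (g⁻¹ * x * g) o from hg).map (MulAut.conj g).toMonoidHom
      simpa [mul_assoc] using h3
    obtain ⟨n, hn, hgn⟩ := Q.conj_eq_normalizer_conj_of_mem_centralizer o g⁻¹
      ((mem_centralizer_iff_commute hQ).2 ho)
      ((mem_centralizer_iff_commute hQ).2 (by simpa using h1))
    refine ⟨n⁻¹, inv_mem hn, ?_⟩
    rw [mem_centralizer_singleton_iff]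
    rw [inv_inv] at hgn
    calc g⁻¹ * n⁻¹ * o = g⁻¹ * (n⁻¹ * o * n) * n⁻¹ := by group
      _ = o * (g⁻¹ * n⁻¹) := by rw [← hgn]; group
  · rintro ⟨k, hk, hg⟩
    rw [mem_centralizer_singleton_iff] at hg ⊢
    have e : k * o * k⁻¹ = g * o * g⁻¹ := by
      calc k * o * k⁻¹ = g * (g⁻¹ * k * o) * k⁻¹ := by group
        _ = g * o * g⁻¹ := by rw [hg]; group
    have h1 := commute_conj_of_mem_normalizer hQ ho hk
    rw [e] at h1
    have h3 := h1.map (MulAut.conj g⁻¹).toMonoidHom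
    have h4 : Commute (g⁻¹ * x * g) o := by simpa [mul_assoc] using h3
    exact h4.eq

end FixCount

namespace FixCount
open MulAction Subgroup
variable {G : Type*} [Group G] [Finite G] [Fact (Nat.Prime 11)] {Q : Sylow 11 G} {x : G}

/-- Burnside's transfer theorem for simple groups. -/
theorem not_normalizer_le_centralizer {G : Type*} [Group G] [Finite G] [IsSimpleGroup G] {p : ℕ}
    [Fact p.Prime] (P : Sylow p G) (h1 : Nat.card P ≠ 1) (h2 : Nat.card P ≠ Nat.card G) :
    ¬ normalizer (P : Set G) ≤ centralizer (P : Set G) := by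
  intro hP
  have hc := MonoidHom.ker_transferSylow_isComplement' P hP
  have hm := hc.card_mul
  rcases IsSimpleGroup.eq_bot_or_eq_top_of_normal _ (MonoidHom.transferSylow P hP).normal_ker
    with h | h
  · rw [h, card_bot, one_mul] at hm
    exact h2 hm
  · rw [h, card_top] at hm
    exact h1 (Nat.eq_of_mul_eq_mul_left Nat.card_pos (hm.trans (mul_one _).symm))

theorem normalizer_ne_top [IsSimpleGroup G] (hcard : Nat.card G = 95040)
    (hQc : Nat.card Q = 11) : normalizer (Q : Set G) ≠ ⊤ := by
  intro h
  have hn : (Q : Subgroup G).Normal := normalizer_eq_top_iff.1 h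
  rcases IsSimpleGroup.eq_bot_or_eq_top_of_normal _ hn with h | h
  · have : Nat.card (Q : Subgroup G) = 1 := by rw [h]; simp
    have : Nat.card (Q : Subgroup G) = 11 := hQc
    omega
  · have h1 : Nat.card (Q : Subgroup G) = Nat.card G := by rw [h]; simp
    have : Nat.card (Q : Subgroup G) = 11 := hQc
    omega

theorem exists_index_data [IsSimpleGroup G] (hcard : Nat.card G = 95040) (hQ : zpowers x = Q)
    (hx : orderOf x = 11) : ∃ e c n : ℕ, Nat.card (normalizer (Q : Set G)) = 11 * (e * c) ∧
      Nat.card (centralizer (Q : Set G)) = 11 * c ∧ Nat.card (G ⧸ normalizer (Q : Set G)) = n ∧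
      e * c * n = 8640 ∧ n % 11 = 1 ∧ (e = 2 ∨ e = 5 ∨ e = 10) ∧
      ∀ z ∈ normalizer (Q : Set G), z ^ e ∈ centralizer (Q : Set G) := by
  have hQc : Nat.card (Q : Subgroup G) = 11 := by rw [← hQ, Nat.card_zpowers, hx]
  set N := normalizer (Q : Set G) with hN
  set C := centralizer (Q : Set G) with hC
  have hCN : C ≤ N := centralizer_le_normalizer _
  have hker : C.subgroupOf N = (Subgroup.normalizerMonoidHom (Q : Subgroup G)).ker :=
    (normalizerMonoidHom_ker (Q : Subgroup G)).symm
  haveI hnor : (C.subgroupOf N).Normal := by rw [hker]; infer_instance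
  obtain ⟨c, hc⟩ : 11 ∣ Nat.card C := by
    rw [← hQc]
    refine Subgroup.card_dvd_of_le ?_
    intro z hz
    obtain ⟨n, rfl⟩ : z ∈ zpowers x := by rw [hQ]; exact hz
    exact (mem_centralizer_iff_commute hQ).2 ((Commute.refl x).zpow_right n)
  have hindex : (C.subgroupOf N).index * Nat.card C = Nat.card N := by
    have := (C.subgroupOf N).index_mul_card
    rwa [Nat.card_congr (subgroupOfEquivOfLe hCN).toEquiv] at this
  refine ⟨(C.subgroupOf N).index, c, _, ?_, hc, rfl, ?_, ?_, ?_, ?_⟩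
  · rw [← hindex, hc]; ring
  · have h1 := N.card_mul_index
    rw [hcard, ← hindex, hc] at h1
    change _ * Nat.card (G ⧸ N) = _ at h1
    have : 11 * ((C.subgroupOf N).index * c * Nat.card (G ⧸ N)) = 11 * 8640 := by
      rw [show 11 * 8640 = 95040 by norm_num, ← h1]; ring
    omega
  · exact card_quotient_normalizer_modEq hQ hx
  · have h1 : (C.subgroupOf N).index ∣ 10 := by
      have hcyc : IsCyclic (Q : Subgroup G) := isCyclic_of_prime_card hQc
      rw [hker, index_ker, show 10 = Nat.card (MulAut (Q : Subgroup G)) by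
        rw [IsCyclic.card_mulAut, hQc]; decide]
      exact card_subgroup_dvd_card _
    have h2 : (C.subgroupOf N).index ≠ 1 := by
      intro h
      refine not_normalizer_le_centralizer Q ?_ ?_ (subgroupOf_eq_top.1 (index_eq_one.1 h))
      · change Nat.card (Q : Subgroup G) ≠ 1
        omega
      · change Nat.card (Q : Subgroup G) ≠ _
        omega
    generalize (C.subgroupOf N).index = e at h1 h2
    have := Nat.le_of_dvd (by norm_num) h1
    interval_cases e <;> revert h1 h2 <;> decide
  · intro z hz
    have := pow_index_mem (C.subgroupOf N) (⟨z, hz⟩ : N)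
    exact this


/-- An element of order prime to `|N(Q) : C(Q)|` normalizing `Q` centralizes it. -/
theorem mem_of_pow_mem {G : Type*} [Group G] {C : Subgroup G} {z : G} {e m : ℕ}
    (h : z ^ e ∈ C) (hm : z ^ m = 1) (hem : e.Coprime m) : z ∈ C := by
  have : z = (z ^ e) ^ (e.gcdA m) * (z ^ m) ^ (e.gcdB m) := by
    rw [← zpow_natCast, ← zpow_natCast, ← zpow_mul, ← zpow_mul, ← zpow_add, ← Nat.gcd_eq_gcd_ab,
      hem.gcd_eq_one, Nat.cast_one, zpow_one]
  rw [this, hm, one_zpow, mul_one]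
  exact C.zpow_mem h _

theorem exists_orderOf_of_dvd_centralizer (hQ : zpowers x = Q) {p : ℕ} [Fact p.Prime]
    (h : p ∣ Nat.card (centralizer (Q : Set G))) : ∃ o : G, orderOf o = p ∧ Commute x o := by
  obtain ⟨⟨o, ho⟩, h1⟩ := exists_prime_orderOf_dvd_card' p h
  exact ⟨o, by rwa [orderOf_mk] at h1, (mem_centralizer_iff_commute hQ).1 ho⟩

theorem pow_eq_one_of_orderOf {o : G} {p : ℕ} (h : orderOf o = p) : o ^ p = 1 := by
  rw [← h, pow_orderOf_eq_one]

theorem ne_one_of_orderOf {o : G} {p : ℕ} (h : orderOf o = p) (hp : p ≠ 1) : o ≠ 1 := by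
  rintro rfl
  exact hp (by simpa using h.symm)

/-- If `C(o) ∩ N(Q)` has order `s` then `|C(o)| = m s`, where `m` counts fixed points. -/
theorem exists_fixedBy_data [IsSimpleGroup G] (hcard : Nat.card G = 95040) (hQ : zpowers x = Q)
    (hx : orderOf x = 11) {n e : ℕ} (hn : Nat.card (G ⧸ normalizer (Q : Set G)) = n)
    (he : ∀ z ∈ normalizer (Q : Set G), z ^ e ∈ centralizer (Q : Set G)) {o : G} {p : ℕ}
    [Fact p.Prime] (ho : orderOf o = p) (hxo : Commute x o) (hep : e.Coprime p) :
    ∃ m, m % 11 = 1 ∧ n % p = m % p ∧ m < n ∧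
      m * Nat.card (centralizer {o} ⊓ normalizer (Q : Set G) : Subgroup G)
        = Nat.card (centralizer {o}) := by
  have hQc : Nat.card Q = 11 := by
    change Nat.card (Q : Subgroup G) = 11
    rw [← hQ, Nat.card_zpowers, hx]
  refine ⟨_, ncard_fixedBy_normalizer_modEq hQ hx hxo, ?_, ?_, ncard_fixedBy_mul hQ hxo ?_⟩
  · rw [← hn]
    exact ncard_fixedBy_modEq (k := 1) (by rw [pow_one, pow_eq_one_of_orderOf ho])
  · rw [← hn]
    exact ncard_fixedBy_lt (normalizer_ne_top hcard hQc)
      (ne_one_of_orderOf ho (Fact.out : p.Prime).ne_one)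
  · intro g hg
    refine mem_of_pow_mem (he _ hg) (m := p) ?_ hep
    have : g⁻¹ * o * g = MulAut.conj g⁻¹ o := by simp
    rw [this, ← map_pow, pow_eq_one_of_orderOf ho, map_one]

end FixCount

namespace FixCount
open MulAction Subgroup
/-- The cosets of `C(o)` correspond to the conjugates of `o`. -/
theorem exists_conj_map {G : Type*} [Group G] (o : G) : ∃ f : G ⧸ centralizer {o} → G,
    Function.Injective f ∧ (∀ g : G, f g = g * o * g⁻¹) ∧
      ∀ v a, a ∈ fixedBy (G ⧸ centralizer {o}) v ↔ Commute v (f a) := by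
  have key : ∀ a b : G, a⁻¹ * b ∈ centralizer {o} ↔ a * o * a⁻¹ = b * o * b⁻¹ := by
    intro a b
    rw [mem_centralizer_singleton_iff]
    constructor
    · intro h
      calc a * o * a⁻¹ = a * (o * (a⁻¹ * b)) * b⁻¹ := by group
        _ = b * o * b⁻¹ := by rw [← h]; group
    · intro h
      calc a⁻¹ * b * o = a⁻¹ * (b * o * b⁻¹) * b := by group
        _ = o * (a⁻¹ * b) := by rw [← h]; group
  refine ⟨fun q => Quotient.liftOn' q (fun g => g * o * g⁻¹) fun a b h =>
    (key a b).1 (QuotientGroup.leftRel_apply.1 h), ?_, fun _ => rfl, ?_⟩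
  · intro p q
    induction p using QuotientGroup.induction_on
    induction q using QuotientGroup.induction_on
    intro h
    exact QuotientGroup.eq.2 ((key _ _).2 h)
  · intro v a
    induction a using QuotientGroup.induction_on with
    | H g =>
    rw [mk_mem_fixedBy, mem_centralizer_singleton_iff]
    change _ ↔ Commute v (g * o * g⁻¹)
    constructor
    · intro h
      have := (show Commute (g⁻¹ * v * g) o from h).map (MulAut.conj g).toMonoidHom
      simpa [mul_assoc] using this
    · intro h
      have := h.map (MulAut.conj g⁻¹).toMonoidHom
      have h4 : Commute (g⁻¹ * v * g) o := by simpa [mul_assoc] using this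
      exact h4.eq

theorem card_quotient_centralizer_mul {G : Type*} [Group G] (o : G) :
    Nat.card (centralizer {o}) * Nat.card (G ⧸ centralizer {o}) = Nat.card G :=
  (centralizer {o}).card_mul_index

variable {G : Type*} [Group G] [Finite G] [Fact (Nat.Prime 11)] {Q : Sylow 11 G} {x : G}

theorem index_ne_twelve [IsSimpleGroup G] (hcard : Nat.card G = 95040) (hQ : zpowers x = Q)
    (hx : orderOf x = 11) (h3 : 3 ∣ Nat.card (centralizer (Q : Set G)))
    (hn : Nat.card (G ⧸ normalizer (Q : Set G)) = 12) : False := by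
  haveI : Fact (Nat.Prime 3) := ⟨by norm_num⟩
  obtain ⟨o, ho, hxo⟩ := exists_orderOf_of_dvd_centralizer hQ h3
  have h1 := ncard_fixedBy_normalizer_modEq hQ hx hxo
  have h2 := ncard_fixedBy_modEq (X := G ⧸ normalizer (Q : Set G)) (p := 3) (k := 1) (o := o)
    (by rw [pow_one, pow_eq_one_of_orderOf ho])
  have hQc : Nat.card Q = 11 := by
    change Nat.card (Q : Subgroup G) = 11
    rw [← hQ, Nat.card_zpowers, hx]
  have h4 := ncard_fixedBy_lt (normalizer_ne_top hcard hQc) (ne_one_of_orderOf ho (by norm_num))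
  rw [hn] at h2 h4
  unfold Nat.ModEq at h1 h2
  omega

theorem exists_subgroup_centralizer (hQ : zpowers x = Q)
    (h8 : 8 ∣ Nat.card (centralizer (Q : Set G))) :
    ∃ O : Subgroup G, Nat.card O = 8 ∧ (∀ o ∈ O, Commute x o) := by
  haveI : Fact (Nat.Prime 2) := ⟨by norm_num⟩
  obtain ⟨K, hK⟩ := Sylow.exists_subgroup_card_pow_prime (G := centralizer (Q : Set G)) 2 (n := 3)
    (by simpa using h8)
  refine ⟨K.map (Subgroup.subtype _), ?_, ?_⟩
  · rw [Subgroup.card_map_of_injective (subtype_injective _), hK]; norm_num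
  · rintro _ ⟨o, -, rfl⟩
    exact (mem_centralizer_iff_commute hQ).1 o.2

theorem index_ne_forty_five [IsSimpleGroup G] (hcard : Nat.card G = 95040) (hQ : zpowers x = Q)
    (hx : orderOf x = 11) (h8 : 8 ∣ Nat.card (centralizer (Q : Set G)))
    (hn : Nat.card (G ⧸ normalizer (Q : Set G)) = 45) : False := by
  obtain ⟨O, hO, hxO⟩ := exists_subgroup_centralizer hQ h8
  refine forty_five (by omega) hn (pow_eq_one_of_orderOf hx) ?_ hO hxO
  rw [fixedBy_normalizer hQ hx, Set.ncard_singleton]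


end FixCount

namespace FixCount
open MulAction Subgroup

/-- A nontrivial normal subgroup of a finite `p`-group contains a central element of order `p`. -/
theorem exists_orderOf_mem_center {K : Type*} [Group K] [Finite K] {p : ℕ} [Fact p.Prime]
    (hK : IsPGroup p K) {E : Subgroup K} (hE : E.Normal) (h1 : E ≠ ⊥) :
    ∃ t ∈ E, orderOf t = p ∧ ∀ k, Commute k t := by
  have hdvd : p ∣ Nat.card E := by
    rcases (hK.to_subgroup E).card_eq_or_dvd with h | h
    · exact absurd (card_eq_one.1 h) h1
    · exact h
  have hK' : IsPGroup p (ConjAct K) := hK.of_equiv ConjAct.toConjAct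
  have hone : (1 : E) ∈ fixedPoints (ConjAct K) E := fun g => smul_one g
  obtain ⟨⟨b, hbE⟩, hb, hb1⟩ := hK'.exists_fixed_point_of_prime_dvd_card_of_fixed_point E hdvd hone
  have hb0 : b ≠ 1 := fun h => hb1 (Subtype.ext h.symm)
  have hcomm : ∀ k, Commute k b := by
    intro k
    have := congrArg Subtype.val (hb (ConjAct.toConjAct k))
    have h2 : k * b * k⁻¹ = b := this
    exact mul_inv_eq_iff_eq_mul.1 h2
  obtain ⟨j, hj⟩ := IsPGroup.iff_orderOf.1 hK b
  have hj0 : j ≠ 0 := by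
    rintro rfl
    exact hb0 (orderOf_eq_one_iff.1 (by simpa using hj))
  obtain ⟨i, rfl⟩ := Nat.exists_eq_succ_of_ne_zero hj0
  refine ⟨b ^ p ^ i, pow_mem hbE _, ?_, fun k => (hcomm k).pow_right _⟩
  rw [orderOf_pow' b (pow_ne_zero _ (Fact.out : p.Prime).ne_zero), hj,
    Nat.gcd_eq_right (pow_dvd_pow p (Nat.le_succ i)), pow_succ,
    Nat.mul_div_cancel_left _ (pow_pos (Fact.out : p.Prime).pos _)]

variable {G : Type*} [Group G] [Finite G] [Fact (Nat.Prime 11)] {Q : Sylow 11 G} {x : G}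

theorem centralizer_ne_top [IsSimpleGroup G] (hcard : Nat.card G = 95040) {t : G}
    (ht : t ≠ 1) (hlt : orderOf t < 95040) : centralizer {t} ≠ ⊤ := by
  intro h
  have hc : ∀ g, g * t = t * g := fun g =>
    mem_centralizer_singleton_iff.1 (h ▸ mem_top g)
  have hn : (zpowers t).Normal := by
    refine ⟨fun z hz g => ?_⟩
    obtain ⟨n, rfl⟩ := hz
    have : Commute g (t ^ n) := (show Commute g t from hc g).zpow_right n
    simp only
    rw [this.eq, mul_inv_cancel_right]
    exact zpow_mem (mem_zpowers t) n
  rcases IsSimpleGroup.eq_bot_or_eq_top_of_normal _ hn with h | h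
  · exact ht (zpowers_eq_bot.1 h)
  · have h2 := Nat.card_zpowers t
    rw [h, card_top, hcard] at h2
    omega

theorem exists_subgroup_thirty_two (hcard : Nat.card G = 95040)
    (hC : Nat.card (centralizer (Q : Set G)) = 88) (hN : Nat.card (normalizer (Q : Set G)) = 176) :
    ∃ S K : Subgroup G, Nat.card S = 16 ∧ S ≤ normalizer (Q : Set G) ∧ S ≤ K ∧ Nat.card K = 32 ∧
      8 ≤ Nat.card (centralizer (Q : Set G) ⊓ K : Subgroup G) := by
  haveI : Fact (Nat.Prime 2) := ⟨by norm_num⟩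
  set C := centralizer (Q : Set G)
  set N := normalizer (Q : Set G)
  have hCN : C ≤ N := centralizer_le_normalizer _
  obtain ⟨O, hO⟩ := Sylow.exists_subgroup_card_pow_prime (G := C) 2 (n := 3) (by rw [hC]; norm_num)
  obtain ⟨S, hS, hOS⟩ := Sylow.exists_subgroup_card_pow_succ (G := N) (p := 2) (n := 3)
    (by rw [hN]; norm_num) (H := O.map (inclusion hCN))
    (by rw [Subgroup.card_map_of_injective (inclusion_injective hCN), hO])
  have hS' : Nat.card (S.map N.subtype) = 2 ^ 4 := by
    rw [Subgroup.card_map_of_injective (subtype_injective _), hS]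
  obtain ⟨K, hK, hSK⟩ := Sylow.exists_subgroup_card_pow_succ (p := 2) (n := 4)
    (by rw [hcard]; norm_num) hS'
  refine ⟨S.map N.subtype, K, by rw [hS']; norm_num, map_subtype_le S, hSK, by rw [hK]; norm_num, ?_⟩
  have hO' : Nat.card (O.map C.subtype) = 8 := by
    rw [Subgroup.card_map_of_injective (subtype_injective _), hO]; norm_num
  rw [← hO']
  refine card_le_of_le (le_inf (map_subtype_le O) ?_)
  rintro _ ⟨o, ho, rfl⟩
  exact hSK ⟨inclusion hCN o, hOS ⟨o, ho, rfl⟩, rfl⟩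

/-- A subgroup of index at most 4 in a group of order 32 has nontrivial core. -/
theorem normalCore_ne_bot {K : Type*} [Group K] [Finite K] (hK : Nat.card K = 32) {D : Subgroup K}
    (hD : 8 ≤ Nat.card D) : D.normalCore ≠ ⊥ := by
  intro h
  rw [normalCore_eq_ker] at h
  have h1 := Nat.card_le_card_of_injective _ ((MonoidHom.ker_eq_bot_iff _).1 h)
  rw [Nat.card_perm, hK] at h1
  have h2 := D.card_mul_index
  rw [hK] at h2
  have h3 : Nat.card (K ⧸ D) ≤ 4 := by
    change D.index ≤ 4
    nlinarith
  have := Nat.factorial_le h3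
  have h4 : Nat.factorial 4 = 24 := by decide
  omega

theorem centralizer_eq_normalizer [IsSimpleGroup G] (hcard : Nat.card G = 95040)
    (hQ : zpowers x = Q) (hx : orderOf x = 11) (h8 : 8 ∣ Nat.card (centralizer (Q : Set G)))
    (hN : Nat.card (normalizer (Q : Set G)) = 176) {t : G} (ht : orderOf t = 2)
    (hNt : normalizer (Q : Set G) ≤ centralizer {t}) :
    centralizer {t} ≤ normalizer (Q : Set G) := by
  have hxN : x ∈ normalizer (Q : Set G) := mem_normalizer_of_commute hQ (Commute.refl x)
  have hxt : Commute x t := mem_centralizer_singleton_iff.1 (hNt hxN)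
  have ht1 : t ≠ 1 := ne_one_of_orderOf ht (by norm_num)
  have htop := centralizer_ne_top hcard ht1 (by omega)
  let s : Set (G ⧸ normalizer (Q : Set G)) :=
    {a | ∃ k ∈ centralizer {t}, (k : G ⧸ normalizer (Q : Set G)) = a}
  have h1 := ncard_mul_card_inf (centralizer {t}) (normalizer (Q : Set G)) (s := s) (by
    intro g
    refine ⟨fun ⟨k, hk, h⟩ => ⟨k, hk, QuotientGroup.eq.1 h.symm⟩,
      fun ⟨k, hk, h⟩ => ⟨k, hk, (QuotientGroup.eq.2 h).symm⟩⟩)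
  rw [inf_eq_right.2 hNt, hN] at h1
  have h2 := ncard_inter_fixedBy_modEq (p := 11) (k := 1) (o := x) (s := s)
    (by rw [pow_one, pow_eq_one_of_orderOf hx]) (by
      rintro _ ⟨k, hk, rfl⟩
      exact ⟨x * k, mul_mem (hNt hxN) hk, rfl⟩)
  have h3 : s ∩ fixedBy (G ⧸ normalizer (Q : Set G)) x =
      {((1 : G) : G ⧸ normalizer (Q : Set G))} := by
    rw [fixedBy_normalizer hQ hx, Set.inter_eq_right, Set.singleton_subset_iff]
    exact ⟨1, one_mem _, rfl⟩
  rw [h3, Set.ncard_singleton] at h2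
  have h4 := card_quotient_centralizer_mul t
  rw [← h1, hcard] at h4
  have h5 := ncard_fixedBy_centralizer_mul hQ hxt
  rw [inf_eq_left.2 hNt, hN] at h5
  have hw : (fixedBy (G ⧸ centralizer {t}) x).ncard = 1 := by omega
  set m := s.ncard
  set X := Nat.card (G ⧸ centralizer {t}) with hX
  have h6 : m * X = 540 := by nlinarith
  have hX1 : X ≠ 1 := fun h => htop (index_eq_one.1 h)
  have h7 : m = 1 ∨ X = 45 ∨ X = 12 := by
    have hd : m ∈ Nat.divisors 540 := Nat.mem_divisors.2 ⟨⟨X, h6.symm⟩, by norm_num⟩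
    have : ∀ m ∈ Nat.divisors 540, m % 11 = 1 → m = 1 ∨ m = 12 ∨ m = 45 ∨ m = 540 := by decide +kernel
    rcases this m hd h2 with h | h | h | h <;> rw [h] at h6 <;> omega
  rcases h7 with h | h | h
  · have hc : Nat.card (centralizer {t}) = Nat.card (normalizer (Q : Set G)) := by
      rw [hN, ← h1, h, one_mul]
    exact (eq_of_le_of_card_ge hNt hc.le).ge
  · exfalso
    obtain ⟨O, hO, hxO⟩ := exists_subgroup_centralizer hQ h8
    exact forty_five (by omega) h (pow_eq_one_of_orderOf hx) hw hO hxO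
  · exfalso
    have h8 := ncard_fixedBy_modEq_inter (X := G ⧸ centralizer {t}) (pow_eq_one_of_orderOf hx) hxt
    obtain ⟨a, ha⟩ := Set.ncard_eq_one.1 hw
    have hb : ((1 : G) : G ⧸ centralizer {t}) ∈ fixedBy (G ⧸ centralizer {t}) x := by
      rw [mk_mem_fixedBy]; simpa using hNt hxN
    have hb' : ((1 : G) : G ⧸ centralizer {t}) ∈ fixedBy (G ⧸ centralizer {t}) t := by
      rw [mk_mem_fixedBy, inv_one, one_mul, mul_one]
      exact mem_centralizer_singleton_iff.2 rfl
    rw [ha, Set.mem_singleton_iff] at hb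
    rw [ha, ← hb, Set.inter_eq_right.2 (Set.singleton_subset_iff.2 hb'), Set.ncard_singleton] at h8
    haveI : Fact (Nat.Prime 2) := ⟨by norm_num⟩
    have h9 := ncard_fixedBy_modEq (X := G ⧸ centralizer {t}) (p := 2) (k := 1) (o := t)
      (by rw [pow_one, pow_eq_one_of_orderOf ht])
    have h10 := ncard_fixedBy_lt htop ht1
    rw [← hX, h] at h9 h10
    unfold Nat.ModEq at h8 h9
    omega

theorem index_ne_five_forty [IsSimpleGroup G] (hcard : Nat.card G = 95040)
    (hQ : zpowers x = Q) (hx : orderOf x = 11) (hC : Nat.card (centralizer (Q : Set G)) = 88)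
    (hN : Nat.card (normalizer (Q : Set G)) = 176) : False := by
  haveI : Fact (Nat.Prime 2) := ⟨by norm_num⟩
  obtain ⟨S, K, hS, hSN, hSK, hK, hCK⟩ := exists_subgroup_thirty_two hcard hC hN
  have hD : 8 ≤ Nat.card ((centralizer (Q : Set G)).subgroupOf K) := by
    refine hCK.trans (Nat.le_of_eq ?_)
    exact Nat.card_congr
      ⟨fun a => ⟨⟨a.1, a.2.2⟩, a.2.1⟩, fun a => ⟨a.1.1, a.2, a.1.2⟩, fun _ => rfl, fun _ => rfl⟩
  obtain ⟨⟨t, htK⟩, htE, hord, hcomm⟩ := exists_orderOf_mem_center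
    (IsPGroup.of_card (n := 5) (by rw [hK]; norm_num) : IsPGroup 2 K) (normalCore_normal _)
    (normalCore_ne_bot hK hD)
  have ht : orderOf t = 2 := by rwa [orderOf_mk] at hord
  have htC : t ∈ centralizer (Q : Set G) := (normalCore_le ((centralizer (Q : Set G)).subgroupOf K)) htE
  have hxt : Commute x t := (mem_centralizer_iff_commute hQ).1 htC
  have hKt : K ≤ centralizer {t} := fun k hk =>
    mem_centralizer_singleton_iff.2 (congrArg Subtype.val (hcomm ⟨k, hk⟩).eq)
  have hNt : normalizer (Q : Set G) ≤ centralizer {t} := by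
    have h1 : 16 ∣ Nat.card (centralizer {t} ⊓ normalizer (Q : Set G) : Subgroup G) := by
      rw [← hS]
      exact card_dvd_of_le (le_inf (hSK.trans hKt) hSN)
    have h2 : 11 ∣ Nat.card (centralizer {t} ⊓ normalizer (Q : Set G) : Subgroup G) := by
      have hzx : Nat.card (zpowers x) = 11 := by rw [Nat.card_zpowers, hx]
      refine hzx.symm.dvd.trans (card_dvd_of_le ?_)
      rw [zpowers_le]
      exact ⟨mem_centralizer_singleton_iff.2 hxt, mem_normalizer_of_commute hQ (Commute.refl x)⟩
    have h3 : 16 * 11 ∣ Nat.card (centralizer {t} ⊓ normalizer (Q : Set G) : Subgroup G) :=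
      Nat.Coprime.mul_dvd_of_dvd_of_dvd (by norm_num) h1 h2
    have h4 := Nat.le_of_dvd Nat.card_pos h3
    have h5 := eq_of_le_of_card_ge
      (inf_le_right : centralizer {t} ⊓ normalizer (Q : Set G) ≤ _) (by omega)
    exact inf_eq_right.1 h5
  have h6 := card_dvd_of_le
    (hKt.trans (centralizer_eq_normalizer hcard hQ hx (by rw [hC]; norm_num) hN ht hNt))
  rw [hK, hN] at h6
  omega

end FixCount

namespace FixCount
open MulAction Subgroup

theorem card_sylow_three {K : Type*} [Group K] [Finite K] [Fact (Nat.Prime 3)] {m : ℕ}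
    (hK : Nat.card K = 3 * m) (hm : ¬ 3 ∣ m) (P : Sylow 3 K) : Nat.card P = 3 := by
  have h0 : m ≠ 0 := by rintro rfl; simp at hm
  rw [Sylow.card_eq_multiplicity, hK, Nat.factorization_mul (by norm_num) h0]
  simp [Nat.factorization_eq_zero_of_not_dvd hm, Nat.Prime.factorization_self Nat.prime_three]

theorem eq_or_eq_sq_of_mem_zpowers {K : Type*} [Group K] {y z : K} (hy : orderOf y = 3)
    (hz : orderOf z = 3) (h : z ∈ zpowers y) : z = y ∨ z = y ^ 2 := by
  have hf : IsOfFinOrder y := orderOf_pos_iff.1 (by omega)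
  obtain ⟨n, rfl⟩ := hf.mem_powers_iff_mem_zpowers.2 h
  have h1 : y ^ n = y ^ (n % 3) := by rw [← hy, pow_mod_orderOf]
  simp only at hz ⊢
  rw [h1] at hz ⊢
  have : n % 3 < 3 := Nat.mod_lt _ (by norm_num)
  interval_cases n % 3
  · simp at hz
  · simp
  · simp

theorem exists_sylow_eq_zpowers {K : Type*} [Group K] [Finite K] [Fact (Nat.Prime 3)]
    (hP : ∀ P : Sylow 3 K, Nat.card P = 3) {y : K} (hy : orderOf y = 3) :
    ∃ P : Sylow 3 K, zpowers y = P := by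
  have h1 : IsPGroup 3 (zpowers y) := IsPGroup.of_card (n := 1) (by rw [Nat.card_zpowers, hy]; rfl)
  obtain ⟨P, hPy⟩ := h1.exists_le_sylow
  refine ⟨P, eq_of_le_of_card_ge hPy ?_⟩
  rw [Nat.card_zpowers, hy]
  exact (hP P).le

/-- In a group of order 6 or 12 either the Sylow 3-subgroup is normal, or the 2-elements
are those of a subgroup of order 4. -/
theorem order_three_or_involutions {K : Type*} [Group K] [Finite K]
    (hK : Nat.card K = 6 ∨ Nat.card K = 12) :
    (∀ y z : K, orderOf y = 3 → orderOf z = 3 → z = y ∨ z = y ^ 2) ∨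
      Nat.card K = 12 ∧ ∃ T : Subgroup K, Nat.card T = 4 ∧ ∀ u : K, orderOf u = 2 → u ∈ T := by
  classical
  haveI : Fact (Nat.Prime 3) := ⟨by norm_num⟩
  haveI : Fact (Nat.Prime 2) := ⟨by norm_num⟩
  have hP : ∀ P : Sylow 3 K, Nat.card P = 3 := by
    rcases hK with h | h
    · exact card_sylow_three (m := 2) h (by norm_num)
    · exact card_sylow_three (m := 4) h (by norm_num)
  obtain ⟨P₀⟩ : Nonempty (Sylow 3 K) := inferInstance
  have hdvd := P₀.card_dvd_index
  have hidx := (P₀ : Subgroup K).index_mul_card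
  rw [show Nat.card (P₀ : Subgroup K) = 3 from hP P₀] at hidx
  have hmod : Nat.card (Sylow 3 K) % 3 = 1 := card_sylow_modEq_one 3 K
  have hle := Nat.le_of_dvd (by omega) hdvd
  have hcase : Nat.card (Sylow 3 K) = 1 ∨ Nat.card K = 12 ∧ Nat.card (Sylow 3 K) = 4 := by omega
  rcases hcase with h | ⟨h12, h4⟩
  · left
    intro y z hy hz
    haveI := (Nat.card_eq_one_iff_unique.1 h).1
    obtain ⟨P, hPy⟩ := exists_sylow_eq_zpowers hP hy
    obtain ⟨P', hPz⟩ := exists_sylow_eq_zpowers hP hz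
    refine eq_or_eq_sq_of_mem_zpowers hy hz ?_
    rw [hPy, Subsingleton.elim P P', ← hPz]
    exact mem_zpowers z
  · right
    refine ⟨h12, ?_⟩
    obtain ⟨T, hT⟩ := Sylow.exists_subgroup_card_pow_prime (G := K) 2 (n := 2)
      (by rw [h12]; norm_num)
    refine ⟨T, hT, ?_⟩
    have := Fintype.ofFinite K
    have := Fintype.ofFinite (Sylow 3 K)
    let D : Finset K := Finset.univ.biUnion fun P : Sylow 3 K =>
      ((P : Set K).toFinset).erase 1
    have hmem : ∀ z ∈ D, orderOf z = 3 := by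
      intro z hz
      simp only [D, Finset.mem_biUnion, Finset.mem_univ, true_and, Finset.mem_erase,
        Set.mem_toFinset] at hz
      obtain ⟨P, hz1, hzP⟩ := hz
      have h3 : z ^ 3 = 1 := by
        have := pow_card_eq_one' (x := (⟨z, hzP⟩ : (P : Subgroup K)))
        rw [hP P] at this
        exact congrArg Subtype.val this
      exact orderOf_eq_prime h3 hz1
    have hD : D.card = 8 := by
      rw [Finset.card_biUnion]
      · have : ∀ P : Sylow 3 K, ((P : Set K).toFinset.erase 1).card = 2 := by
          intro P
          rw [Finset.card_erase_of_mem (by simpa using P.one_mem), ← Set.ncard_eq_toFinset_card',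
            ← Nat.card_coe_set_eq]
          have := hP P
          change Nat.card P - 1 = 2
          omega
        rw [Finset.sum_congr rfl fun P _ => this P, Finset.sum_const, Finset.card_univ,
          ← Nat.card_eq_fintype_card, h4]
        rfl
      · intro P _ P' _ hne
        rw [Function.onFun, Finset.disjoint_left]
        intro z hz hz'
        have hz3 : orderOf z = 3 := hmem z (Finset.mem_biUnion.2 ⟨P, Finset.mem_univ _, hz⟩)
        simp only [Finset.mem_erase, Set.mem_toFinset] at hz hz'
        apply hne
        have key : ∀ P : Sylow 3 K, z ∈ (P : Set K) → zpowers z = P := fun P h =>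
          eq_of_le_of_card_ge (zpowers_le.2 h) (by
            rw [Nat.card_zpowers, hz3]; exact (hP P).le)
        exact Sylow.ext ((key P hz.2).symm.trans (key P' hz'.2))
    have hsub : (T : Set K).toFinset ⊆ Dᶜ := by
      intro z hz
      rw [Finset.mem_compl]
      intro hzD
      have h1 : orderOf (⟨z, by simpa using hz⟩ : T) ∣ Nat.card T := orderOf_dvd_natCard _
      rw [orderOf_mk, hmem z hzD, hT] at h1
      omega
    have heq := Finset.eq_of_subset_of_card_le hsub (by
      rw [Finset.card_compl, hD, ← Nat.card_eq_fintype_card, h12, ← Set.ncard_eq_toFinset_card',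
          ← Nat.card_coe_set_eq]
      exact (by omega : 12 - 8 ≤ 2 ^ 2).trans hT.ge)
    intro u hu
    have : u ∈ Dᶜ := by
      rw [Finset.mem_compl]
      intro huD
      have := hmem u huD
      omega
    rw [← heq] at this
    simpa using this

variable {G : Type*} [Group G] [Finite G] [Fact (Nat.Prime 11)] {Q : Sylow 11 G} {x : G}

theorem exists_quotient_hom.{u} {G : Type u} [Group G] [Finite G] {Q : Sylow 11 G} {x : G}
    (hQ : zpowers x = Q) (hx : orderOf x = 11) {c : ℕ}
    (hC : Nat.card (centralizer (Q : Set G)) = 11 * c) :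
    ∃ (K : Type u) (_ : Group K) (_ : Finite K) (φ : centralizer (Q : Set G) →* K),
      Nat.card K = c ∧ ∀ z z' m, Nat.Coprime 11 m → z ^ m = 1 → z' ^ m = 1 → φ z = φ z' → z = z' := by
  set C := centralizer (Q : Set G)
  have hQc : Nat.card (Q : Subgroup G) = 11 := by rw [← hQ, Nat.card_zpowers, hx]
  have hQC : (Q : Subgroup G) ≤ C := by
    intro z hz
    rw [← hQ] at hz
    obtain ⟨n, rfl⟩ := hz
    exact (mem_centralizer_iff_commute hQ).2 ((Commute.refl x).zpow_right n)
  have hcomm : ∀ (q : G), q ∈ (Q : Subgroup G) → ∀ z ∈ C, q * z = z * q := fun q hq z hz =>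
    (mem_centralizer_iff.1 hz) q hq
  haveI hn : ((Q : Subgroup G).subgroupOf C).Normal := by
    refine ⟨fun q hq z => ?_⟩
    have : z * q * z⁻¹ = q := by
      rw [mul_inv_eq_iff_eq_mul]
      exact Subtype.ext (hcomm q hq z z.2).symm
    rwa [this]
  refine ⟨C ⧸ (Q : Subgroup G).subgroupOf C, inferInstance, inferInstance, QuotientGroup.mk' _,
    ?_, ?_⟩
  · have h1 := ((Q : Subgroup G).subgroupOf C).card_mul_index
    rw [Nat.card_congr (subgroupOfEquivOfLe hQC).toEquiv, hQc, hC] at h1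
    exact Nat.eq_of_mul_eq_mul_left (show 0 < 11 by norm_num) h1
  · intro z z' m hm hz hz' h
    have hq : z⁻¹ * z' ∈ (Q : Subgroup G).subgroupOf C := QuotientGroup.eq.1 h
    set q := z⁻¹ * z' with hqdef
    have hz'' : z' = z * q := by simp [hqdef]
    have hcm : Commute z q := Subtype.ext (hcomm q hq z z.2).symm
    have h2 : q ^ m = 1 := by
      rw [hz'', hcm.mul_pow, hz, one_mul] at hz'
      exact hz'
    have h3 : q ^ 11 = 1 := by
      have hq' : (q : G) ∈ zpowers x := by rw [hQ]; exact hq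
      obtain ⟨n, hn⟩ := hq'
      apply Subtype.ext
      have h4 : x ^ n = (q : G) := hn
      change (q : G) ^ 11 = 1
      rw [← h4, ← zpow_natCast, zpow_comm, zpow_natCast, ← hx, pow_orderOf_eq_one, one_zpow]
    have h5 : q = 1 := by
      rw [← orderOf_eq_one_iff]
      exact Nat.eq_one_of_dvd_coprimes hm (orderOf_dvd_of_pow_eq_one h3) (orderOf_dvd_of_pow_eq_one h2)
    rw [hz'', h5, mul_one]

end FixCount

namespace FixCount
open MulAction Subgroup
variable {G : Type*} [Group G] [Finite G] [Fact (Nat.Prime 11)] {Q : Sylow 11 G} {x : G}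

theorem index_ne_one_four_four [IsSimpleGroup G] (hcard : Nat.card G = 95040)
    (hQ : zpowers x = Q) (hx : orderOf x = 11) {e c : ℕ} (hec : e = 2 ∧ c = 30 ∨ e = 5 ∧ c = 12 ∨ e = 10 ∧ c = 6)
    (hN : Nat.card (normalizer (Q : Set G)) = 660)
    (hC : Nat.card (centralizer (Q : Set G)) = 11 * c)
    (hn : Nat.card (G ⧸ normalizer (Q : Set G)) = 144)
    (he : ∀ z ∈ normalizer (Q : Set G), z ^ e ∈ centralizer (Q : Set G)) : False := by
  have hdiv : ∀ t : G, Nat.card (centralizer {t}) ∣ 95040 := fun t => hcard ▸ card_subgroup_dvd_card _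
  haveI : Fact (Nat.Prime 2) := ⟨by norm_num⟩
  haveI : Fact (Nat.Prime 3) := ⟨by norm_num⟩
  haveI : Fact (Nat.Prime 5) := ⟨by norm_num⟩
  have h2C : 2 ∣ Nat.card (centralizer (Q : Set G)) := by rw [hC]; omega
  have h3C : 3 ∣ Nat.card (centralizer (Q : Set G)) := by rw [hC]; omega
  by_cases he2 : e = 2
  · obtain ⟨o, ho, hxo⟩ := exists_orderOf_of_dvd_centralizer hQ (p := 5) (by rw [hC]; omega)
    obtain ⟨m, h1, h2, h3, h4⟩ := exists_fixedBy_data hcard hQ hx hn he ho hxo (by rw [he2]; norm_num)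
    have : ∀ m < 144, m % 11 = 1 → 144 % 5 = m % 5 → ¬ m ∣ 95040 := by decide +kernel
    exact this m h3 h1 h2 ((Dvd.intro _ h4).trans (hdiv o))
  have hc : c = 6 ∨ c = 12 := by omega
  obtain ⟨K, _, _, φ, hK, hinj⟩ := exists_quotient_hom hQ hx hC
  have hord : ∀ (z : G) (hz : z ∈ centralizer (Q : Set G)) (p : ℕ), Fact p.Prime → Nat.Coprime 11 p →
      orderOf z = p → orderOf (φ ⟨z, hz⟩) = p := by
    intro z hz p hp hpc hzp
    have h1 : (⟨z, hz⟩ : centralizer (Q : Set G)) ^ p = 1 :=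
      Subtype.ext (pow_eq_one_of_orderOf hzp)
    refine orderOf_eq_prime (by rw [← map_pow, h1, map_one]) fun h => ?_
    have := hinj ⟨z, hz⟩ 1 p hpc h1 (one_pow p) (by rw [h, map_one])
    exact ne_one_of_orderOf hzp hp.out.ne_one (congrArg Subtype.val this)
  have hmemC : ∀ {z : G}, Commute x z → z ∈ centralizer (Q : Set G) :=
    fun h => (mem_centralizer_iff_commute hQ).2 h
  have hconj : ∀ o g : G, orderOf (g * o * g⁻¹) = orderOf o := by
    intro o g
    have : g * o * g⁻¹ = MulAut.conj g o := by simp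
    rw [this]
    exact orderOf_injective (MulAut.conj g).toMonoidHom (MulAut.conj g).injective o
  rcases order_three_or_involutions (K := K) (by rw [hK]; exact hc) with h | ⟨h12, T, hT, hTu⟩
  · obtain ⟨y, hy, hxy⟩ := exists_orderOf_of_dvd_centralizer hQ h3C
    have honly : ∀ z, orderOf z = 3 → Commute x z → z = y ∨ z = y ^ 2 := by
      intro z hz hxz
      have hy3 : (⟨y, hmemC hxy⟩ : centralizer (Q : Set G)) ^ 3 = 1 :=
        Subtype.ext (pow_eq_one_of_orderOf hy)
      have hz3 : (⟨z, hmemC hxz⟩ : centralizer (Q : Set G)) ^ 3 = 1 :=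
        Subtype.ext (pow_eq_one_of_orderOf hz)
      rcases h _ _ (hord y (hmemC hxy) 3 inferInstance (by norm_num) hy)
        (hord z (hmemC hxz) 3 inferInstance (by norm_num) hz) with h | h
      · left
        exact congrArg Subtype.val (hinj _ _ 3 (by norm_num) hz3 hy3 h)
      · right
        rw [← map_pow] at h
        exact congrArg Subtype.val (hinj _ _ 3 (by norm_num) hz3
          (by rw [← pow_mul, mul_comm, pow_mul, hy3, one_pow]) h)
    obtain ⟨m, h1, h2, h3, h4⟩ := exists_fixedBy_data hcard hQ hx hn he hy hxy (by
      rcases hec with h | h | h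
      · exact absurd h.1 he2
      · rw [h.1]; norm_num
      · rw [h.1]; norm_num)
    have h5 := ncard_fixedBy_centralizer_mul hQ hxy
    rw [hN, inf_comm] at h5
    obtain ⟨f, hf, hfg, hfix⟩ := exists_conj_map y
    have hfx : ∀ a ∈ fixedBy (G ⧸ centralizer {y}) x, f a = y ∨ f a = y ^ 2 := by
      intro a ha
      refine honly _ ?_ ((hfix x a).1 ha)
      obtain ⟨g, rfl⟩ := QuotientGroup.mk_surjective a
      rw [hfg, hconj, hy]
    have hw : (fixedBy (G ⧸ centralizer {y}) x).ncard ≤ 2 := by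
      rw [← Set.ncard_image_of_injective _ hf]
      refine (Set.ncard_le_ncard (t := {y, y ^ 2}) ?_ (Set.toFinite _)).trans ((Set.ncard_insert_le _ _).trans
        (by rw [Set.ncard_singleton]))
      rintro _ ⟨a, ha, rfl⟩
      exact hfx a ha
    have hsub : fixedBy (G ⧸ centralizer {y}) x ⊆ fixedBy (G ⧸ centralizer {y}) y := by
      intro a ha
      rw [hfix]
      rcases hfx a ha with h | h <;> rw [h]
      exact (Commute.refl y).pow_right 2
    have h6 := ncard_fixedBy_modEq_inter (X := G ⧸ centralizer {y}) (pow_eq_one_of_orderOf hx) hxy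
    have h7 := ncard_fixedBy_modEq (X := G ⧸ centralizer {y}) (p := 11) (k := 1) (o := x)
      (by rw [pow_one, pow_eq_one_of_orderOf hx])
    have h8 := ncard_fixedBy_modEq (X := G ⧸ centralizer {y}) (p := 3) (k := 1) (o := y)
      (by rw [pow_one, pow_eq_one_of_orderOf hy])
    have h9 := ncard_fixedBy_lt (centralizer_ne_top hcard (ne_one_of_orderOf hy (by norm_num))
      (by omega)) (ne_one_of_orderOf hy (by norm_num))
    have h10 := card_quotient_centralizer_mul y
    rw [Set.inter_eq_right.2 hsub] at h6
    unfold Nat.ModEq at h6 h7 h8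
    have hdy := hdiv y
    rw [← h4] at h10 hdy
    rw [hcard] at h10
    generalize Nat.card (centralizer {y} ⊓ normalizer (Q : Set G) : Subgroup G) = s at *
    have hm : m = 12 ∨ m = 45 := by
      have : ∀ m < 144, m % 11 = 1 → 144 % 3 = m % 3 → m ∣ 95040 → m = 12 ∨ m = 45 := by
        decide +kernel
      exact this m h3 h1 h2 ((Dvd.intro _ rfl).trans hdy)
    have hs : s = 660 ∨ s = 330 := by
      generalize (fixedBy (G ⧸ centralizer {y}) x).ncard = w at *
      interval_cases w <;> omega
    rcases hm with rfl | rfl <;> rcases hs with rfl | rfl <;> omega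
  · obtain ⟨u, hu, hxu⟩ := exists_orderOf_of_dvd_centralizer hQ h2C
    have he5 : e = 5 := by omega
    obtain ⟨m, h1, h2, h3, h4⟩ := exists_fixedBy_data hcard hQ hx hn he hu hxu
      (by rw [he5]; norm_num)
    have h5 := ncard_fixedBy_centralizer_mul hQ hxu
    rw [hN, inf_comm] at h5
    obtain ⟨f, hf, hfg, hfix⟩ := exists_conj_map u
    have hTcomm : ∀ a ∈ T, ∀ b ∈ T, a * b = b * a := by
      intro a ha b hb
      have := IsPGroup.commutative_of_card_eq_prime_sq (p := 2) (G := T) (by rw [hT]; norm_num)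
        ⟨a, ha⟩ ⟨b, hb⟩
      exact congrArg Subtype.val this
    have hford : ∀ a, orderOf (f a) = 2 := by
      intro a
      obtain ⟨g, rfl⟩ := QuotientGroup.mk_surjective a
      rw [hfg, hconj, hu]
    have hfC : ∀ a : fixedBy (G ⧸ centralizer {u}) x, f a ∈ centralizer (Q : Set G) :=
      fun a => hmemC ((hfix x a).1 a.2)
    have hsq : ∀ (z : G) (hz : z ∈ centralizer (Q : Set G)), orderOf z = 2 →
        (⟨z, hz⟩ : centralizer (Q : Set G)) ^ 2 = 1 := fun z hz h =>
      Subtype.ext (pow_eq_one_of_orderOf h)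
    have hsub : fixedBy (G ⧸ centralizer {u}) x ⊆ fixedBy (G ⧸ centralizer {u}) u := by
      intro a ha
      rw [hfix]
      have hfa := hfC ⟨a, ha⟩
      have hcm := hTcomm _ (hTu _ (hord u (hmemC hxu) 2 inferInstance (by norm_num) hu)) _
        (hTu _ (hord (f a) hfa 2 inferInstance (by norm_num) (hford a)))
      have h1 : φ (⟨u, hmemC hxu⟩ * ⟨f a, hfa⟩ * ⟨u, hmemC hxu⟩⁻¹) = φ ⟨f a, hfa⟩ := by
        rw [map_mul, map_mul, hcm, map_inv, mul_inv_cancel_right]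
      have h2 := hinj _ _ 2 (by norm_num) (by
        rw [conj_pow, hsq _ hfa (hford a), mul_one, mul_inv_cancel]) (hsq _ hfa (hford a)) h1
      exact mul_inv_eq_iff_eq_mul.1 (congrArg Subtype.val h2)
    have hw : (fixedBy (G ⧸ centralizer {u}) x).ncard ≤ 3 := by
      let F : fixedBy (G ⧸ centralizer {u}) x → {t : T // t ≠ 1} := fun a =>
        ⟨⟨φ ⟨f a, hfC a⟩, hTu _ (hord _ (hfC a) 2 inferInstance (by norm_num) (hford a))⟩, fun h => by
          have h1 := hord _ (hfC a) 2 inferInstance (by norm_num) (hford a)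
          rw [show φ ⟨f a, hfC a⟩ = 1 from congrArg Subtype.val h, orderOf_one] at h1
          omega⟩
      have hF : Function.Injective F := by
        intro a b hab
        have h1 : φ ⟨f a, hfC a⟩ = φ ⟨f b, hfC b⟩ :=
          congrArg (fun t : {t : T // t ≠ 1} => (t.1 : K)) hab
        have h2 := hinj _ _ 2 (by norm_num) (hsq _ (hfC a) (hford a)) (hsq _ (hfC b) (hford b)) h1
        exact Subtype.ext (hf (congrArg Subtype.val h2))
      have h1 := Nat.card_le_card_of_injective F hF
      rw [Nat.card_coe_set_eq] at h1
      refine h1.trans ?_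
      classical
      have := Fintype.ofFinite T
      have h2 := Fintype.card_subtype_lt (p := fun t : T => t ≠ 1) (x := 1) (by simp)
      rw [← Nat.card_eq_fintype_card, ← Nat.card_eq_fintype_card, hT] at h2
      omega
    have h6 := ncard_fixedBy_modEq_inter (X := G ⧸ centralizer {u}) (pow_eq_one_of_orderOf hx) hxu
    have h7 := ncard_fixedBy_modEq (X := G ⧸ centralizer {u}) (p := 11) (k := 1) (o := x)
      (by rw [pow_one, pow_eq_one_of_orderOf hx])
    have h8 := four_dvd_card_sub (by omega) (X := G ⧸ centralizer {u}) (pow_eq_one_of_orderOf hu)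
    have h9 := ncard_fixedBy_lt (centralizer_ne_top hcard (ne_one_of_orderOf hu (by norm_num))
      (by omega)) (ne_one_of_orderOf hu (by norm_num))
    have h10 := card_quotient_centralizer_mul u
    rw [Set.inter_eq_right.2 hsub] at h6
    unfold Nat.ModEq at h6 h7
    have hdu := hdiv u
    rw [← h4] at h10 hdu
    rw [hcard] at h10
    generalize Nat.card (centralizer {u} ⊓ normalizer (Q : Set G) : Subgroup G) = s at *
    have hm : m = 12 := by
      have : ∀ m < 144, m % 11 = 1 → 144 % 2 = m % 2 → m ∣ 95040 → m = 12 := by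
        decide +kernel
      exact this m h3 h1 h2 ((Dvd.intro _ rfl).trans hdu)
    subst hm
    generalize (fixedBy (G ⧸ centralizer {u}) x).ncard = w at *
    generalize (fixedBy (G ⧸ centralizer {u}) u).ncard = v at *
    generalize Nat.card (G ⧸ centralizer {u}) = n at *
    have hs : s = 660 ∨ s = 330 ∨ s = 220 := by
      interval_cases w <;> omega
    rcases hs with rfl | rfl | rfl <;> omega

end FixCount

namespace FixCount
open MulAction Subgroup
variable {G : Type*} [Group G] [Finite G]

theorem index_data_unique {e c n : ℕ} (h : e * c * n = 8640) (hn : n % 11 = 1)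
    (he : e = 2 ∨ e = 5 ∨ e = 10) :
    n = 1 ∨ (n = 12 ∧ 3 ∣ c) ∨ (n = 45 ∧ c = 96) ∨
      (n = 144 ∧ (e = 2 ∧ c = 30 ∨ e = 5 ∧ c = 12 ∨ e = 10 ∧ c = 6)) ∨
      (n = 540 ∧ e = 2 ∧ c = 8) ∨ (n = 1728 ∧ e = 5 ∧ c = 1) := by
  have h1 : ∀ n ∈ Nat.divisors 8640, n % 11 = 1 →
      n = 1 ∨ n = 12 ∨ n = 45 ∨ n = 144 ∨ n = 320 ∨ n = 540 ∨ n = 1728 := by decide +kernel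
  have h2 := h1 n (Nat.mem_divisors.2 ⟨Dvd.intro_left _ h, by norm_num⟩) hn
  rcases he with rfl | rfl | rfl <;> rcases h2 with rfl | rfl | rfl | rfl | rfl | rfl | rfl <;> omega

/-- A Sylow 11-subgroup of a simple group of order 95040 is self-centralizing with normalizer
quotient of order 5. -/
theorem exists_order_eleven [IsSimpleGroup G] (hcard : Nat.card G = 95040) :
    ∃ x : G, orderOf x = 11 ∧ Nat.card (centralizer {x}) = 11 ∧ (∃ g, g * x * g⁻¹ = x ^ 3) ∧
      ∀ g, g * x * g⁻¹ ≠ x⁻¹ := by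
  haveI : Fact (Nat.Prime 11) := ⟨by norm_num⟩
  obtain ⟨x, hx⟩ := exists_prime_orderOf_dvd_card' (G := G) 11 (by rw [hcard]; norm_num)
  have hcz : Nat.card (zpowers x) = 11 := by rw [Nat.card_zpowers, hx]
  let Q : Sylow 11 G := Sylow.ofCard (zpowers x) (by
    rw [hcz, hcard]
    rw [show (95040 : ℕ) = 11 * 8640 by norm_num, Nat.factorization_mul (by norm_num) (by norm_num)]
    have h1 : (11 : ℕ).factorization 11 = 1 := Nat.Prime.factorization_self (by norm_num)
    have h2 : (8640 : ℕ).factorization 11 = 0 :=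
      Nat.factorization_eq_zero_of_not_dvd (by norm_num)
    simp [h1, h2])
  have hQ : zpowers x = Q := rfl
  obtain ⟨e, c, n, hN, hC, hn, hecn, hn11, he, hpow⟩ := exists_index_data hcard hQ hx
  rcases index_data_unique hecn hn11 he with rfl | ⟨rfl, h3⟩ | ⟨rfl, rfl⟩ | ⟨rfl, hec⟩ |
    ⟨rfl, rfl, rfl⟩ | ⟨rfl, rfl, rfl⟩
  · exact absurd (Subgroup.index_eq_one.1 hn) (normalizer_ne_top hcard hcz)
  · exact (index_ne_twelve hcard hQ hx (hC ▸ h3.mul_left 11) hn).elim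
  · exact (index_ne_forty_five hcard hQ hx (by rw [hC]; norm_num) hn).elim
  · exact (index_ne_one_four_four hcard hQ hx hec (by rw [hN]; omega) hC hn hpow).elim
  · exact (index_ne_five_forty hcard hQ hx hC hN).elim
  · have hne := ne_one_of_orderOf hx (by norm_num)
    have hx11 := pow_eq_one_of_orderOf hx
    have hCx : Nat.card (centralizer {x}) = 11 := by
      rw [← hC.trans (mul_one 11)]
      congr 2
      ext z
      rw [mem_centralizer_iff_commute hQ, mem_centralizer_singleton_iff]
      exact ⟨fun h => h.symm, fun h => h.symm⟩
    have hmemN : ∀ g : G, g * x * g⁻¹ ∈ zpowers x → g⁻¹ ∈ normalizer (Q : Set G) := fun g hg =>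
      mem_normalizer_of_conj_mem hQ hx (by
        rw [inv_inv]
        exact (Subgroup.le_normalizer (H := (Q : Subgroup G))) (hQ ▸ hg))
    have hfive : ∀ g : G, g * x * g⁻¹ ∈ zpowers x → Commute x (g ^ 5) := by
      intro g hg
      have := hpow _ ((normalizer (Q : Set G)).inv_mem (hmemN g hg))
      rw [inv_inv] at this
      exact (mem_centralizer_iff_commute hQ).1 this
    have hpows : ∀ (g : G) (j : ℕ), g * x * g⁻¹ = x ^ j → ∀ k : ℕ, g ^ k * x * (g ^ k)⁻¹ = x ^ j ^ k := by
      intro g j hj k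
      induction k with
      | zero => simp
      | succ k ih =>
        rw [pow_succ', mul_inv_rev, show g * g ^ k * x * ((g ^ k)⁻¹ * g⁻¹) =
          g * (g ^ k * x * (g ^ k)⁻¹) * g⁻¹ by group, ih, ← conj_pow, hj, ← pow_mul, pow_succ']
    refine ⟨x, hx, hCx, ?_, ?_⟩
    · obtain ⟨g, hgN, hgC⟩ := Set.not_subset.1 (fun h : (normalizer (Q : Set G) : Set G) ⊆
        centralizer (Q : Set G) => by
          have := Nat.le_of_dvd (by rw [hC]; norm_num) (card_dvd_of_le h)
          omega)
      have hgx : g * x * g⁻¹ ∈ zpowers x := by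
        have := (mem_normalizer_iff.1 hgN x).1 (mem_zpowers x)
        exact this
      classical
      obtain ⟨j, hj, hgj⟩ := (mem_zpowers_iff_mem_range_orderOf.1 hgx) |> Finset.mem_image.1
      rw [Finset.mem_range, hx] at hj
      have h5 := hpows g j hgj.symm 5
      rw [(hfive g hgx).symm.eq, mul_inv_cancel_right] at h5
      have hmod : j ^ 5 % 11 = 1 := by
        have := (pow_inj_mod (x := x) (n := j ^ 5) (m := 1)).1 (by rw [pow_one]; exact h5.symm)
        rw [hx] at this
        exact this
      have hj1 : j ≠ 1 := by
        rintro rfl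
        refine hgC ((mem_centralizer_iff_commute hQ).2 ?_)
        have := mul_inv_eq_iff_eq_mul.1 (hgj.symm.trans (pow_one x))
        exact this.symm
      have hjs : j = 3 ∨ j = 4 ∨ j = 5 ∨ j = 9 := by
        have : ∀ j < 11, j ^ 5 % 11 = 1 → j ≠ 1 → j = 3 ∨ j = 4 ∨ j = 5 ∨ j = 9 := by decide
        exact this j hj hmod hj1
      have key : ∀ k, j ^ k % 11 = 3 → ∃ g : G, g * x * g⁻¹ = x ^ 3 := by
        intro k hk
        refine ⟨g ^ k, (hpows g j hgj.symm k).trans (pow_inj_mod.2 ?_)⟩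
        rw [hx, hk]
      rcases hjs with rfl | rfl | rfl | rfl
      · exact key 1 (by norm_num)
      · exact key 4 (by norm_num)
      · exact key 2 (by norm_num)
      · exact key 3 (by norm_num)
    · intro g hg
      have h10 : g * x * g⁻¹ = x ^ 10 := by
        rw [hg, inv_eq_iff_mul_eq_one, ← pow_succ', hx11]
      have h5 := hpows g 10 h10 5
      rw [(hfive g (hg ▸ (zpowers x).inv_mem (mem_zpowers x))).symm.eq, mul_inv_cancel_right] at h5
      have := (pow_inj_mod (x := x) (n := 10 ^ 5) (m := 1)).1 (by rw [pow_one]; exact h5.symm)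
      rw [hx] at this
      norm_num at this

end FixCount

namespace GroupChar
open Matrix Finset
variable {G : Type*} [Group G] [Fintype G] {r : ℕ} {d : Fin r → ℕ} [∀ i, NeZero (d i)]
  (e : Wedderburn G r d)

theorem exists_int_of_isIntegral {z : ℂ} (hz : IsIntegral ℤ z) {q : ℚ} (hq : z = q) :
    ∃ n : ℤ, z = n := by
  have h1 : IsIntegral ℤ (algebraMap ℚ ℂ q) := by rw [eq_ratCast, ← hq]; exact hz
  have h2 : IsIntegral ℤ q := (isIntegral_algebraMap_iff (algebraMap ℚ ℂ).injective).1 h1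
  obtain ⟨n, hn⟩ := IsIntegrallyClosed.isIntegral_iff.1 h2
  exact ⟨n, by rw [hq, ← hn]; simp⟩

theorem dvd_of_isIntegral_div {a b : ℤ} (hb : b ≠ 0) (h : IsIntegral ℤ ((a : ℂ) / b)) : b ∣ a := by
  obtain ⟨n, hn⟩ := exists_int_of_isIntegral h (q := a / b) (by push_cast; rfl)
  have hb' : (b : ℂ) ≠ 0 := by exact_mod_cast hb
  rw [div_eq_iff hb'] at hn
  exact ⟨n, by rw [mul_comm]; exact_mod_cast hn⟩

theorem isIntegral_conj {z : ℂ} (hz : IsIntegral ℤ z) : IsIntegral ℤ (starRingEnd ℂ z) :=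
  hz.map (Complex.conjAe.toAlgHom.restrictScalars ℤ)

/-- The quadratic Gauss periods of conductor 11. -/
theorem gauss_periods {ζ : ℂ} (hζ : IsPrimitiveRoot ζ 11) :
    (ζ + ζ ^ 3 + ζ ^ 4 + ζ ^ 5 + ζ ^ 9) + (ζ ^ 2 + ζ ^ 6 + ζ ^ 7 + ζ ^ 8 + ζ ^ 10) = -1 ∧
    ((ζ + ζ ^ 3 + ζ ^ 4 + ζ ^ 5 + ζ ^ 9) - (ζ ^ 2 + ζ ^ 6 + ζ ^ 7 + ζ ^ 8 + ζ ^ 10)) ^ 2 = -11 := by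
  have h1 : ζ ^ 11 = 1 := hζ.pow_eq_one
  have h2 := hζ.geom_sum_eq_zero (by norm_num)
  simp only [Finset.sum_range_succ, Finset.sum_range_zero] at h2
  have hred : ∀ k, 11 ≤ k → ζ ^ k = ζ ^ (k - 11) := by
    intro k hk
    obtain ⟨l, rfl⟩ := Nat.exists_eq_add_of_le hk
    rw [pow_add, h1, one_mul, Nat.add_sub_cancel_left]
  refine ⟨by linear_combination h2, ?_⟩
  ring_nf
  simp only [hred, Nat.reduceLeDiff, Nat.reduceSub]
  linear_combination h2

theorem chi_eleven (i : Fin r) {x g : G} (hx : orderOf x = 11) (hg : g * x * g⁻¹ = x ^ 3) :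
    ∃ A b : ℤ, chi e i x + starRingEnd ℂ (chi e i x) = A ∧
      (chi e i x - starRingEnd ℂ (chi e i x)) ^ 2 = -11 * (b : ℂ) ^ 2 ∧ (2 : ℤ) ∣ A - b ∧
      (11 : ℤ) ∣ A - 2 * d i := by
  have hx11 : x ^ 11 = 1 := hx ▸ pow_orderOf_eq_one x
  have hζ := Complex.isPrimitiveRoot_exp 11 (by norm_num)
  set ζ := Complex.exp (2 * Real.pi * Complex.I / (11 : ℕ))
  obtain ⟨hη1, hη2⟩ := gauss_periods hζ
  set η := ζ + ζ ^ 3 + ζ ^ 4 + ζ ^ 5 + ζ ^ 9 with hη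
  set η' := ζ ^ 2 + ζ ^ 6 + ζ ^ 7 + ζ ^ 8 + ζ ^ 10 with hη'
  have hred : ∀ k, 11 ≤ k → ζ ^ k = ζ ^ (k - 11) := by
    intro k hk
    obtain ⟨l, rfl⟩ := Nat.exists_eq_add_of_le hk
    rw [pow_add, hζ.pow_eq_one, one_mul, Nat.add_sub_cancel_left]
  obtain ⟨m, hm⟩ := chi_powers e i (by norm_num) hx11 hζ
  have hthree : ∀ k, chi e i (x ^ (3 * k)) = chi e i (x ^ k) := by
    intro k
    rw [pow_mul, ← hg, conj_pow, chi_conj]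
  have hredx : ∀ k, chi e i (x ^ (k + 11)) = chi e i (x ^ k) := by
    intro k
    rw [pow_add, hx11, mul_one]
  have a1 := hm 1 (by norm_num)
  have a3 := hm 3 (by norm_num)
  have a9 := hm 9 (by norm_num)
  have a5 := hm 5 (by norm_num)
  have a4 := hm 4 (by norm_num)
  have b10 := hm 10 (by norm_num)
  have b8 := hm 8 (by norm_num)
  have b2 := hm 2 (by norm_num)
  have b6 := hm 6 (by norm_num)
  have b7 := hm 7 (by norm_num)
  have c0 := hm 0 (by norm_num)
  have d3 := hthree 1
  have d9 := hthree 3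
  have d5 : chi e i (x ^ 5) = chi e i (x ^ 9) := by
    rw [← hthree 9, ← hredx 5, ← hredx 16]
  have d4 : chi e i (x ^ 4) = chi e i (x ^ 5) := by
    rw [← hthree 5, ← hredx 4]
  have d6 := hthree 2
  have d7 : chi e i (x ^ 7) = chi e i (x ^ 6) := by
    rw [← hthree 6, ← hredx 7]
  have d8 : chi e i (x ^ 10) = chi e i (x ^ 7) := by
    rw [← hthree 7, ← hredx 10]
  have d10 : chi e i (x ^ 8) = chi e i (x ^ 10) := by
    rw [← hthree 10, ← hredx 8, ← hredx 19]
  have hβ : chi e i (x ^ 10) = starRingEnd ℂ (chi e i x) := by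
    rw [← chi_inv, ← eq_inv_of_mul_eq_one_left (a := x ^ 10) (b := x) (by rw [← pow_succ, hx11])]
  have hα : chi e i (x ^ 1) = chi e i x := by rw [pow_one]
  have hd : chi e i 1 = d i := chi_one e i
  simp only [Finset.sum_range_succ, Finset.sum_range_zero, Nat.reduceMul, hred, Nat.reduceLeDiff,
    Nat.reduceSub, mul_zero, zero_mul, zero_add, pow_zero, mul_one] at a1 a3 a9 a5 a4 b10 b8 b2 b6 b7 c0 d3 d9 d6
  set α := chi e i x
  set β := starRingEnd ℂ α with hβdef
  let R : ℕ := m 1 + m 3 + m 4 + m 5 + m 9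
  let N : ℕ := m 2 + m 6 + m 7 + m 8 + m 10
  have e1 : 5 * α = 5 * m 0 + R * η + N * η' := by
    simp only [R, N, hη, hη']
    push_cast
    linear_combination a1 + a3 + a9 + a5 + a4 - 5 * hα - 4 * d3 - 3 * d9 - 2 * d5 - d4
  have e2 : 5 * β = 5 * m 0 + R * η' + N * η := by
    simp only [R, N, hη, hη']
    push_cast
    linear_combination b10 + b8 + b2 + b6 + b7 - 5 * hβ + 3 * d8 + 2 * d7 + d6 - d10
  have e3 : (d i : ℂ) = m 0 + R + N := by
    simp only [R, N]
    push_cast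
    linear_combination c0 - hd
  have hαint : IsIntegral ℤ α := chi_isIntegral e i x
  have hβint : IsIntegral ℤ β := isIntegral_conj hαint
  obtain ⟨A, hA⟩ := exists_int_of_isIntegral (hαint.add hβint) (q := (10 * m 0 - R - N) / 5) (by
    push_cast
    linear_combination (e1 + e2 + (R + N) * hη1) / 5)
  have e4 : (5 * (α - β)) ^ 2 = -11 * ((R : ℂ) - N) ^ 2 := by
    have : 5 * (α - β) = (R - N) * (η - η') := by linear_combination e1 - e2
    rw [this, mul_pow, hη2]; ring
  obtain ⟨k, hk⟩ := exists_int_of_isIntegral ((hαint.sub hβint).pow 2)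
    (q := -11 * (R - N) ^ 2 / 25) (by
    push_cast
    linear_combination e4 / 25)
  have e5 : 25 * k = -11 * ((R : ℤ) - N) ^ 2 := by
    have : (25 * k : ℂ) = -11 * ((R : ℂ) - N) ^ 2 := by rw [← hk, ← e4]; ring
    exact_mod_cast this
  have h5 : (5 : ℤ) ∣ (R : ℤ) - N := by
    refine Int.Prime.dvd_pow' (p := 5) (k := 2) (by norm_num) ?_
    push_cast
    omega
  obtain ⟨b, hb⟩ := h5
  have hkb : k = -11 * b ^ 2 := by
    rw [hb] at e5
    linarith [e5, (by ring : (5 * b) ^ 2 = 25 * b ^ 2)]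
  have e6 : 5 * A = 10 * m 0 - R - N := by
    have : (5 * A : ℂ) = 10 * m 0 - R - N := by
      rw [← hA]; linear_combination e1 + e2 + (R + N) * hη1
    exact_mod_cast this
  have e7 : (d i : ℤ) = m 0 + R + N := by exact_mod_cast e3
  refine ⟨A, b, hA, ?_, by omega, by omega⟩
  rw [hk, hkb]
  push_cast
  ring

end GroupChar

namespace GroupChar
open Matrix Finset

theorem sum_sq_eq_four {ι : Type*} [DecidableEq ι] (T : Finset ι) (c : ι → ℤ)
    (h : ∑ i ∈ T, c i ^ 2 = 4) :
    (∃ f ∈ T, c f ^ 2 = 4 ∧ ∀ i ∈ T, i ≠ f → c i = 0) ∨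
      (#{i ∈ T | c i ≠ 0} = 4 ∧ ∀ i ∈ T, c i ≠ 0 → c i ^ 2 = 1) := by
  by_cases hf : ∃ f ∈ T, 1 < c f ^ 2
  · left
    obtain ⟨f, hf, h1⟩ := hf
    have h2 : 4 ≤ c f ^ 2 := by
      by_contra h3
      have : |c f| < 2 := by
        rw [← sq_lt_sq₀ (abs_nonneg _) (by norm_num), sq_abs]; omega
      have h4 : |c f| = 0 ∨ |c f| = 1 := by have := abs_nonneg (c f); omega
      rw [← sq_abs] at h1
      rcases h4 with h4 | h4 <;> rw [h4] at h1 <;> norm_num at h1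
    rw [← Finset.add_sum_erase _ _ hf] at h
    have h3 : ∀ i ∈ T.erase f, 0 ≤ c i ^ 2 := fun i _ => sq_nonneg _
    have h4 := Finset.sum_nonneg h3
    refine ⟨f, hf, by omega, fun i hi hif => ?_⟩
    have h5 := (Finset.sum_eq_zero_iff_of_nonneg h3).1 (by omega) i (Finset.mem_erase.2 ⟨hif, hi⟩)
    exact pow_eq_zero_iff (by norm_num) |>.1 h5
  · right
    push Not at hf
    have h1 : ∀ i ∈ T, c i ≠ 0 → c i ^ 2 = 1 := fun i hi h0 => by
      have := hf i hi
      have := pow_pos (abs_pos.2 h0) 2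
      rw [sq_abs] at this
      omega
    refine ⟨?_, h1⟩
    rw [← Finset.sum_filter_add_sum_filter_not T (fun i => c i ≠ 0),
      Finset.sum_congr rfl (g := fun _ => (1 : ℤ)) (fun i hi => by
        rw [Finset.mem_filter] at hi; exact h1 i hi.1 hi.2),
      Finset.sum_eq_zero (s := {i ∈ T | ¬ c i ≠ 0}) (fun i hi => by
        rw [Finset.mem_filter, not_not] at hi; rw [hi.2]; norm_num)] at h
    simp at h
    exact_mod_cast h

/-- The values of the irreducible characters on an element of order 11 which is self-centralizing,
not real, and conjugate to its cube. -/
structure Block {G : Type*} [Group G] [Fintype G] {r : ℕ} {d : Fin r → ℕ}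
    [∀ i, NeZero (d i)] (e : Wedderburn G r d) (x : G) where
  (i₀ p q : Fin r) (f : Fin 4 → Fin r) (c : Fin 4 → ℤ) (a : ℤ)
  chi_i₀ : ∀ g, chi e i₀ g = 1
  f_inj : Function.Injective f
  f_ne : ∀ j, f j ≠ i₀ ∧ f j ≠ p ∧ f j ≠ q
  p_ne : p ≠ i₀
  q_ne : q ≠ i₀
  p_ne_q : p ≠ q
  chi_q : ∀ g, chi e q g = starRingEnd ℂ (chi e p g)
  c_sq : ∀ j, c j ^ 2 = 1
  a_sq : a ^ 2 = 1
  chi_f : ∀ j, chi e (f j) x = c j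
  chi_pq : chi e p x + chi e q x = a
  chi_else : ∀ i, i ≠ i₀ → i ≠ p → i ≠ q → (∀ j, i ≠ f j) → chi e i x = 0
  chi_p_im : chi e p x ≠ starRingEnd ℂ (chi e p x)
  dim_f : ∀ j, (11 : ℤ) ∣ c j * d (f j) - 1
  dim_p : (11 : ℤ) ∣ a * d p - 6
  dvd_f : ∀ j, d (f j) ∣ 8640
  dvd_p : d p ∣ 8640
  dim_else : ∀ i, i ≠ i₀ → i ≠ p → i ≠ q → (∀ j, i ≠ f j) → 11 ∣ d i
  mono : Monotone fun j => c j * (d (f j) : ℤ)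

variable {G : Type*} [Group G] [Fintype G] [DecidableEq G] {r : ℕ} {d : Fin r → ℕ}
  [∀ i, NeZero (d i)] (e : Wedderburn G r d)

theorem dim_eq_of_conj {p q : Fin r} (h : ∀ g, chi e q g = starRingEnd ℂ (chi e p g)) :
    d q = d p := by
  have := h 1
  rw [chi_one, chi_one, map_natCast] at this
  exact_mod_cast this

theorem dim_trivial {i : Fin r} (h : ∀ g, chi e i g = 1) : d i = 1 := by
  have := h 1
  rw [chi_one] at this
  exact_mod_cast this

/-- The conjugacy class of an element, as a finset. -/
def conjClass (o : G) : Finset G := univ.image fun g => g * o * g⁻¹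

theorem mem_conjClass {o c : G} : c ∈ conjClass o ↔ ∃ g, g * o * g⁻¹ = c := by
  simp [conjClass]

theorem conj_mem_conjClass {o c g : G} (hc : c ∈ conjClass o) : g * c * g⁻¹ ∈ conjClass o := by
  obtain ⟨a, rfl⟩ := mem_conjClass.1 hc
  exact mem_conjClass.2 ⟨g * a, by group⟩

theorem card_conjClass (o : G) :
    Nat.card (Subgroup.centralizer {o}) * #(conjClass o) = Nat.card G := by
  obtain ⟨f, hf, hfg, -⟩ := FixCount.exists_conj_map o
  rw [← FixCount.card_quotient_centralizer_mul o, ← Set.ncard_univ (G ⧸ Subgroup.centralizer {o}),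
    ← Set.ncard_image_of_injective _ hf, ← Set.ncard_coe_finset]
  congr 2
  ext c
  rw [mem_coe, mem_conjClass, Set.image_univ, Set.mem_range]
  constructor
  · rintro ⟨g, rfl⟩
    exact ⟨g, hfg g⟩
  · rintro ⟨a, rfl⟩
    obtain ⟨g, rfl⟩ := QuotientGroup.mk_surjective a
    exact ⟨g, (hfg g).symm⟩

theorem sum_conjClass (o : G) (i : Fin r) :
    ∑ c ∈ conjClass o, chi e i c = #(conjClass o) * chi e i o := by
  rw [← nsmul_eq_mul, ← Finset.sum_const]
  refine Finset.sum_congr rfl fun c hc => ?_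
  obtain ⟨g, _, rfl⟩ := mem_image.1 hc
  rw [chi_conj]

theorem isIntegral_conjClass (o : G) (i : Fin r) :
    IsIntegral ℤ (#(conjClass o) * chi e i o / d i) := by
  rw [← sum_conjClass]
  exact class_isIntegral e i _ fun g c hc => conj_mem_conjClass hc

theorem isIntegral_eleven (hcard : Nat.card G = 95040) {x : G}
    (hC : Nat.card (Subgroup.centralizer {x}) = 11) (i : Fin r) :
    IsIntegral ℤ (8640 * chi e i x / d i) := by
  have h1 := isIntegral_conjClass e x i
  have h2 := card_conjClass x
  rw [hC, hcard] at h2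
  rw [show #(conjClass x) = 8640 by omega] at h1
  exact_mod_cast h1

end GroupChar

namespace GroupChar
open Matrix Finset
variable {G : Type*} [Group G] [Fintype G] [DecidableEq G] {r : ℕ} {d : Fin r → ℕ}
  [∀ i, NeZero (d i)] (e : Wedderburn G r d)

theorem not_comm_of_centralizer {x : G} (hC : Nat.card (Subgroup.centralizer {x}) ≠ Nat.card G) :
    ¬ ∀ a b : G, a * b = b * a := by
  intro h
  refine hC ?_
  rw [show Subgroup.centralizer {x} = ⊤ from eq_top_iff.2 fun g _ =>
    Subgroup.mem_centralizer_singleton_iff.2 (h _ _)]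
  exact Nat.card_congr Subgroup.topEquiv.toEquiv

theorem sum_int_sq_eleven {x : G} (hC : Nat.card (Subgroup.centralizer {x}) = 11)
    (hr : ∀ g, g * x * g⁻¹ ≠ x⁻¹) {A b : Fin r → ℤ}
    (hA : ∀ i, chi e i x + starRingEnd ℂ (chi e i x) = A i)
    (hb : ∀ i, (chi e i x - starRingEnd ℂ (chi e i x)) ^ 2 = -11 * (b i : ℂ) ^ 2) :
    ∑ i, A i ^ 2 = 22 ∧ ∑ i, b i ^ 2 = 2 := by
  have s1 : ∑ i, chi e i x ^ 2 = 0 := by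
    simp only [sq]
    rw [column_orthogonality, Nat.cast_eq_zero, Finset.card_eq_zero, Finset.filter_eq_empty_iff]
    exact fun g _ h => hr g (eq_inv_of_mul_eq_one_left h)
  have s2 : ∑ i, starRingEnd ℂ (chi e i x) ^ 2 = 0 := by
    have := congrArg (starRingEnd ℂ) s1
    simpa only [map_sum, map_pow, map_zero] using this
  have s3 : ∑ i, chi e i x * starRingEnd ℂ (chi e i x) = 11 := by
    have h := sum_normSq_chi e x
    rw [hC] at h
    simp only [Complex.mul_conj]
    exact_mod_cast congrArg (fun z : ℝ => (z : ℂ)) h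
  constructor
  · have : ∑ i, (A i : ℂ) ^ 2 = 22 := by
      calc ∑ i, (A i : ℂ) ^ 2 = ∑ i, (chi e i x ^ 2 + 2 * (chi e i x * starRingEnd ℂ (chi e i x)) +
            starRingEnd ℂ (chi e i x) ^ 2) := Finset.sum_congr rfl fun i _ => by rw [← hA]; ring
        _ = 22 := by
          rw [Finset.sum_add_distrib, Finset.sum_add_distrib, ← Finset.mul_sum, s1, s2, s3]; norm_num
    exact_mod_cast this
  · have : -11 * ∑ i, (b i : ℂ) ^ 2 = -22 := by
      calc -11 * ∑ i, (b i : ℂ) ^ 2 = ∑ i, (chi e i x ^ 2 -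
            2 * (chi e i x * starRingEnd ℂ (chi e i x)) + starRingEnd ℂ (chi e i x) ^ 2) := by
            rw [Finset.mul_sum]
            exact Finset.sum_congr rfl fun i _ => by rw [← hb]; ring
        _ = -22 := by
          rw [Finset.sum_add_distrib, Finset.sum_sub_distrib, ← Finset.mul_sum, s1, s2, s3]; norm_num
    have h2 : ∑ i, (b i : ℂ) ^ 2 = 2 := by linear_combination this / (-11)
    exact_mod_cast h2

theorem odd_sq_le_nine {a : ℤ} (ha : ¬ (2 : ℤ) ∣ a) (h : a ^ 2 ≤ 11) : a ^ 2 = 1 ∨ a = 3 ∨ a = -3 := by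
  have h1 : a ≤ 3 := by nlinarith
  have h2 : -3 ≤ a := by nlinarith
  interval_cases a <;> omega

theorem no_double_value {f g : ℕ} {c a : ℤ} (hf : f ∣ 17280) (hg : g ∣ 8640) (hc : c ^ 2 = 4)
    (ha : a ^ 2 = 1) (h11 : (11 : ℤ) ∣ c - f) (h : 1 + c * f + a * g = 0) : f = 2 := by
  have h1 : ∀ f ∈ Nat.divisors 17280, f % 11 = 2 ∨ f % 11 = 9 → 2 * f + 1 ∣ 8640 ∨ 2 * f - 1 ∣ 8640 →
      f = 2 := by decide +kernel
  have hf0 : 0 < f := Nat.pos_of_dvd_of_pos hf (by norm_num)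
  have hc' : c = 2 ∨ c = -2 := by
    have : (c - 2) * (c + 2) = 0 := by linear_combination hc
    rcases mul_eq_zero.1 this with h | h <;> omega
  have ha' : a = 1 ∨ a = -1 := by
    have : (a - 1) * (a + 1) = 0 := by linear_combination ha
    rcases mul_eq_zero.1 this with h | h <;> omega
  refine h1 f (Nat.mem_divisors.2 ⟨hf, by norm_num⟩) ?_ ?_
  · rcases hc' with rfl | rfl <;> omega
  · rcases hc' with rfl | rfl <;> rcases ha' with rfl | rfl
    · omega
    · left; rwa [show 2 * f + 1 = g by omega]
    · right; rwa [show 2 * f - 1 = g by omega]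
    · omega

theorem exists_block [IsSimpleGroup G] (hcard : Nat.card G = 95040) {x g₀ : G}
    (hx : orderOf x = 11) (hC : Nat.card (Subgroup.centralizer {x}) = 11)
    (hg₀ : g₀ * x * g₀⁻¹ = x ^ 3) (hr : ∀ g, g * x * g⁻¹ ≠ x⁻¹) : Nonempty (Block e x) := by
  have hG : ¬ ∀ a b : G, a * b = b * a := not_comm_of_centralizer (x := x) (by rw [hC, hcard]; norm_num)
  choose A b hA hb hpar hmod using fun i => chi_eleven e i hx hg₀
  obtain ⟨hA2, hb2⟩ := sum_int_sq_eleven e hC hr hA hb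
  obtain ⟨i₀, hi₀⟩ := exists_trivial e
  have hAi₀ : A i₀ = 2 := by
    have := hA i₀
    rw [hi₀, map_one] at this
    exact_mod_cast this.symm.trans (by norm_num : (1 : ℂ) + 1 = ((2 : ℤ) : ℂ))
  have hbz : ∀ i, chi e i x = starRingEnd ℂ (chi e i x) ↔ b i = 0 := by
    intro i
    have := hb i
    constructor
    · intro h
      rw [← h, sub_self] at this
      have h2 : (b i : ℂ) ^ 2 = 0 := by linear_combination this / 11
      exact_mod_cast pow_eq_zero_iff (two_ne_zero) |>.1 h2
    · intro h
      rw [h] at this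
      have h2 : (chi e i x - starRingEnd ℂ (chi e i x)) ^ 2 = 0 := by rw [this]; simp
      exact sub_eq_zero.1 (pow_eq_zero_iff (two_ne_zero) |>.1 h2)
  obtain ⟨p, hp⟩ : ∃ p, b p ≠ 0 := by
    by_contra! h
    simp [h] at hb2
  obtain ⟨q, hq⟩ := exists_dual e p
  have hpq : p ≠ q := by
    rintro rfl
    exact hp ((hbz p).1 (hq x))
  have hAq : A q = A p := by
    have h1 := hA q
    rw [hq, Complex.conj_conj, add_comm, hA] at h1
    exact_mod_cast h1.symm
  have hbq : b q ^ 2 = b p ^ 2 := by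
    have h1 := hb q
    rw [hq, Complex.conj_conj] at h1
    have : (b q : ℂ) ^ 2 = (b p : ℂ) ^ 2 := by linear_combination (h1 - hb p) / 11
    exact_mod_cast this
  have hqp : q ∈ univ.erase p := mem_erase.2 ⟨hpq.symm, mem_univ _⟩
  rw [← Finset.add_sum_erase _ _ (mem_univ p), ← Finset.add_sum_erase _ _ hqp] at hb2 hA2
  have hnn : ∀ i ∈ (univ.erase p).erase q, 0 ≤ b i ^ 2 := fun i _ => sq_nonneg _
  have hbp : b p ^ 2 = 1 := by
    have h1 := Finset.sum_nonneg hnn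
    have h2 := pow_pos (abs_pos.2 hp) 2
    rw [sq_abs] at h2
    omega
  have hb0 : ∀ i, i ≠ p → i ≠ q → b i = 0 := fun i h1 h2 =>
    pow_eq_zero_iff (two_ne_zero) |>.1 ((Finset.sum_eq_zero_iff_of_nonneg hnn).1 (by omega) i
      (mem_erase.2 ⟨h2, mem_erase.2 ⟨h1, mem_univ _⟩⟩))
  have hi₀b : b i₀ = 0 := (hbz i₀).1 (by rw [hi₀, map_one])
  have hpi₀ : p ≠ i₀ := by rintro rfl; exact hp hi₀b
  have hqi₀ : q ≠ i₀ := by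
    rintro rfl
    rw [hi₀b, hbp] at hbq
    norm_num at hbq
  have hc : ∀ i, i ≠ p → i ≠ q → chi e i x = (A i / 2 : ℤ) ∧ A i = 2 * (A i / 2) := by
    intro i h1 h2
    have h3 := hpar i
    rw [hb0 i h1 h2, sub_zero] at h3
    have h4 : A i = 2 * (A i / 2) := by omega
    have h5 := hA i
    rw [← (hbz i).2 (hb0 i h1 h2)] at h5
    refine ⟨?_, h4⟩
    rw [h4] at h5
    push_cast at h5
    linear_combination h5 / 2
  set c : Fin r → ℤ := fun i => A i / 2 with hcdef
  set T := ((univ.erase p).erase q).erase i₀ with hT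
  have hTm : ∀ i, i ∈ T ↔ i ≠ i₀ ∧ i ≠ q ∧ i ≠ p := by simp [hT]
  have hi₀m : i₀ ∈ (univ.erase p).erase q := by simp [hpi₀.symm, hqi₀.symm]
  rw [← Finset.add_sum_erase _ _ hi₀m, ← hT, hAq, hAi₀,
    Finset.sum_congr rfl (g := fun i => 4 * c i ^ 2) (fun i hi => by
      rw [hTm] at hi
      rw [(hc i hi.2.2 hi.2.1).2]; simp only [hcdef]; ring), ← Finset.mul_sum] at hA2
  have hApodd : ¬ (2 : ℤ) ∣ A p := by
    have h1 := hpar p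
    have h2 : ¬ (2 : ℤ) ∣ b p := by
      rintro ⟨k, hk⟩
      rw [hk] at hbp
      have : (2 * k) ^ 2 = 4 * k ^ 2 := by ring
      omega
    omega
  have hcnn : ∀ i ∈ T, 0 ≤ c i ^ 2 := fun i _ => sq_nonneg _
  have hcs := Finset.sum_nonneg hcnn
  have hdeg : 1 + ∑ i ∈ T, c i * (d i : ℤ) + A p * d p = 0 := by
    have h1 := sum_dim_chi e x
    rw [if_neg (by rintro rfl; simp at hx),
      ← Finset.add_sum_erase _ _ (mem_univ p), ← Finset.add_sum_erase _ _ hqp,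
      ← Finset.add_sum_erase _ _ hi₀m, ← hT, dim_eq_of_conj e hq, dim_trivial e hi₀, hi₀, hq,
      Finset.sum_congr rfl (g := fun i => ((c i * (d i : ℤ) : ℤ) : ℂ)) (fun i hi => by
        rw [hTm] at hi
        rw [(hc i hi.2.2 hi.2.1).1]; push_cast; ring)] at h1
    have h2 := hA p
    rw [← Int.cast_inj (α := ℂ)]
    push_cast at h1 ⊢
    linear_combination h1 - d p * h2
  have hAp : A p ^ 2 = 1 := by
    rcases odd_sq_le_nine hApodd (by omega) with h | h | h
    · exact h
    all_goals
      rw [h] at hA2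
      have h0 := (Finset.sum_eq_zero_iff_of_nonneg hcnn).1 (by omega)
      rw [Finset.sum_eq_zero (fun i hi => by
        rw [pow_eq_zero_iff (two_ne_zero) |>.1 (h0 i hi), zero_mul]), h] at hdeg
      omega
  have hdp : d p ∣ 8640 := by
    have h1 := isIntegral_eleven e hcard hC p
    have h2 := h1.add (isIntegral_conj h1)
    rw [map_div₀, map_mul, map_natCast, map_ofNat, ← add_div, ← mul_add, hA,
      show 8640 * (A p : ℂ) / (d p : ℂ) = ((8640 * A p : ℤ) : ℂ) / ((d p : ℤ) : ℂ) by
        push_cast; rfl] at h2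
    have h3 := dvd_of_isIntegral_div (by exact_mod_cast NeZero.ne (d p)) h2
    have h4 : (d p : ℤ) ∣ 8640 * A p * A p := h3.mul_right _
    rw [mul_assoc, ← sq, hAp, mul_one] at h4
    exact_mod_cast h4
  rcases sum_sq_eq_four T c (by omega) with ⟨f, hfT, hf4, hf0⟩ | ⟨hT4, hT1⟩
  · exfalso
    rw [← Finset.add_sum_erase _ _ hfT, Finset.sum_eq_zero (s := T.erase f) (fun i hi => by
      rw [hf0 i (mem_of_mem_erase hi) (ne_of_mem_erase hi), zero_mul]), add_zero] at hdeg
    rw [hTm] at hfT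
    obtain ⟨hcf, hcf2⟩ := hc f hfT.2.2 hfT.2.1
    have hdf : d f ∣ 17280 := by
      have h1 := isIntegral_eleven e hcard hC f
      rw [hcf, show 8640 * ((A f / 2 : ℤ) : ℂ) / (d f : ℂ) =
        ((8640 * c f : ℤ) : ℂ) / ((d f : ℤ) : ℂ) by rw [Int.cast_mul]; rfl] at h1
      have h3 := dvd_of_isIntegral_div (by exact_mod_cast NeZero.ne (d f)) h1
      have h4 : (d f : ℤ) ∣ 8640 * c f * c f := h3.mul_right _
      rw [mul_assoc, ← sq, hf4] at h4
      have h5 : d f ∣ 34560 := by exact_mod_cast h4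
      have hc' : c f = 2 ∨ c f = -2 := by
        have : (c f - 2) * (c f + 2) = 0 := by linear_combination hf4
        rcases mul_eq_zero.1 this with h | h <;> omega
      rcases hc' with h | h <;> rw [h] at h3
      · exact_mod_cast h3
      · rw [mul_neg, dvd_neg] at h3; exact_mod_cast h3
    have h2 := no_double_value hdf hdp hf4 hAp (by
      have := hmod f
      change (11 : ℤ) ∣ A f / 2 - _
      omega) hdeg
    obtain ⟨t, ht⟩ := exists_prime_orderOf_dvd_card' (G := G) 2 (by rw [hcard]; norm_num)
    obtain ⟨m, -, h3, h4, h5⟩ := chi_involution e hi₀ hfT.1 hG (t := t) (ht ▸ pow_orderOf_eq_one t)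
      (by rintro rfl; simp at ht)
    rw [h2] at h5
    obtain ⟨k, hk⟩ := h3
    omega
  · set T' := {i ∈ T | c i ≠ 0} with hT'
    let f₀ := T'.orderEmbOfFin hT4
    let σ := Tuple.sort fun j => c (f₀ j) * (d (f₀ j) : ℤ)
    have hfT' : ∀ j, f₀ j ∈ T' := fun j => T'.orderEmbOfFin_mem hT4 j
    have hfm : ∀ j, (f₀ j ≠ i₀ ∧ f₀ j ≠ q ∧ f₀ j ≠ p) ∧ c (f₀ j) ≠ 0 := fun j => by
      have := hfT' j
      rwa [hT', mem_filter, hTm] at this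
    have hcsq : ∀ j, c (f₀ j) ^ 2 = 1 := fun j => hT1 _ ((hTm _).2 (hfm j).1) (hfm j).2
    have hone : ∀ a : ℤ, a ^ 2 = 1 → a = 1 ∨ a = -1 := fun a ha => sq_eq_one_iff.1 ha
    have hzero : ∀ i, i ≠ i₀ → i ≠ p → i ≠ q → (∀ j, i ≠ f₀ (σ j)) → c i = 0 := by
      intro i h1 h2 h3 h4
      by_contra h5
      have h6 : i ∈ T' := by rw [hT', mem_filter, hTm]; exact ⟨⟨h1, h3, h2⟩, h5⟩
      have h7 : i ∈ Set.range f₀ := by rw [Finset.range_orderEmbOfFin]; exact h6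
      obtain ⟨j, rfl⟩ := h7
      exact h4 (σ.symm j) (by rw [Equiv.apply_symm_apply])
    refine ⟨{ i₀ := i₀, p := p, q := q, f := f₀ ∘ σ, c := fun j => c (f₀ (σ j)), a := A p,
              chi_i₀ := hi₀, f_inj := f₀.injective.comp σ.injective,
              f_ne := fun j => ⟨(hfm (σ j)).1.1, (hfm (σ j)).1.2.2, (hfm (σ j)).1.2.1⟩,
              p_ne := hpi₀, q_ne := hqi₀, p_ne_q := hpq, chi_q := hq,
              c_sq := fun j => hcsq (σ j), a_sq := hAp,
              chi_f := fun j => (hc _ (hfm (σ j)).1.2.2 (hfm (σ j)).1.2.1).1,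
              chi_pq := by rw [hq]; exact hA p,
              chi_else := fun i h1 h2 h3 h4 => ?_,
              chi_p_im := fun h => hp ((hbz p).1 h),
              dim_f := fun j => ?_, dim_p := ?_,
              dvd_f := fun j => ?_, dvd_p := hdp,
              dim_else := fun i h1 h2 h3 h4 => ?_, 
              mono := Tuple.monotone_sort fun j => c (f₀ j) * (d (f₀ j) : ℤ) }⟩
    · rw [(hc i h2 h3).1, ← Int.cast_zero]
      exact congrArg _ (hzero i h1 h2 h3 h4)
    · have h1 := hmod (f₀ (σ j))
      have h2 := (hc _ (hfm (σ j)).1.2.2 (hfm (σ j)).1.2.1).2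
      have h3 := hone _ (hcsq (σ j))
      change A (f₀ (σ j)) = 2 * c (f₀ (σ j)) at h2
      simp only [Function.comp]
      rcases h3 with h3 | h3 <;> rw [h3] at h2 ⊢ <;> omega
    · have h1 := hmod p
      rcases hone _ hAp with h3 | h3 <;> rw [h3] at h1 ⊢ <;> omega
    · have h1 := isIntegral_eleven e hcard hC (f₀ (σ j))
      rw [(hc _ (hfm (σ j)).1.2.2 (hfm (σ j)).1.2.1).1,
        show 8640 * ((A (f₀ (σ j)) / 2 : ℤ) : ℂ) / (d (f₀ (σ j)) : ℂ) =
        ((8640 * c (f₀ (σ j)) : ℤ) : ℂ) / ((d (f₀ (σ j)) : ℤ) : ℂ) by rw [Int.cast_mul]; rfl] at h1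
      have h3 := dvd_of_isIntegral_div (by exact_mod_cast NeZero.ne (d (f₀ (σ j)))) h1
      simp only [Function.comp]
      rcases hone _ (hcsq (σ j)) with h4 | h4 <;> rw [h4] at h3
      · exact_mod_cast h3
      · rw [mul_neg, dvd_neg] at h3; exact_mod_cast h3
    · have h5 := hmod i
      have h6 := (hc i h2 h3).2
      have h7 : A i / 2 = 0 := hzero i h1 h2 h3 h4
      omega

end GroupChar

namespace GroupChar
open Matrix Finset
variable {G : Type*} [Group G] [Fintype G] [DecidableEq G] {r : ℕ} {d : Fin r → ℕ}
  [∀ i, NeZero (d i)] {e : Wedderburn G r d} {x : G}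

namespace Block
variable (B : Block e x)

/-- The characters vanishing on the chosen element of order 11. -/
def rest : Finset (Fin r) :=
  univ.filter fun i => i ≠ B.i₀ ∧ i ≠ B.p ∧ i ≠ B.q ∧ ∀ j, i ≠ B.f j

theorem sum_split {M : Type*} [AddCommMonoid M] (φ : Fin r → M) :
    ∑ i, φ i = φ B.i₀ + (∑ j, φ (B.f j) + (φ B.p + φ B.q)) + ∑ i ∈ B.rest, φ i := by
  have h1 : (univ : Finset (Fin r)) =
      ((insert B.i₀ (univ.image B.f ∪ {B.p, B.q})) : Finset (Fin r)) ∪ B.rest := by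
    ext i
    simp only [rest, mem_univ, mem_union, mem_insert, mem_image, mem_singleton, mem_filter, true_and,
      true_iff]
    by_cases h : ∃ j, B.f j = i
    · exact Or.inl (Or.inr (Or.inl h))
    · push Not at h
      by_cases h1 : i = B.i₀
      · tauto
      by_cases h2 : i = B.p
      · tauto
      by_cases h3 : i = B.q
      · tauto
      exact Or.inr ⟨h1, h2, h3, fun j hj => h j hj.symm⟩
  rw [h1, Finset.sum_union, Finset.sum_insert, Finset.sum_union,
    Finset.sum_image (fun a _ b _ h => B.f_inj h), Finset.sum_pair B.p_ne_q]
  · rw [Finset.disjoint_left]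
    intro i hi
    obtain ⟨j, -, rfl⟩ := mem_image.1 hi
    have := B.f_ne j
    simp [this]
  · have h1 : ∀ j, ¬ B.f j = B.i₀ := fun j => (B.f_ne j).1
    simp [h1, B.p_ne.symm, B.q_ne.symm]
  · rw [Finset.disjoint_left]
    intro i hi hr
    rw [rest, mem_filter] at hr
    simp only [mem_union, mem_insert, mem_image, mem_singleton, mem_univ, true_and] at hi
    rcases hi with h | ⟨j, h⟩ | h | h
    · exact hr.2.1 h
    · exact hr.2.2.2.2 j h.symm
    · exact hr.2.2.1 h
    · exact hr.2.2.2.1 h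

theorem sum_mul_chi (φ : Fin r → ℂ) (hφ : φ B.q = φ B.p) :
    ∑ i, φ i * chi e i x = φ B.i₀ + (∑ j, φ (B.f j) * B.c j + φ B.p * B.a) := by
  rw [B.sum_split, Finset.sum_eq_zero (s := B.rest) (fun i hi => by
    rw [rest, mem_filter] at hi
    rw [B.chi_else i hi.2.1 hi.2.2.1 hi.2.2.2.1 hi.2.2.2.2, mul_zero]), add_zero, B.chi_i₀, mul_one,
    hφ, ← mul_add, B.chi_pq]
  simp only [B.chi_f]

/-- The signed degrees of the real characters in the block. -/
def F (j : Fin 4) : ℤ := B.c j * d (B.f j)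

/-- The signed degree of the exceptional characters in the block. -/
def E : ℤ := B.a * d B.p

theorem F_ne_zero (j : Fin 4) : B.F j ≠ 0 := by
  have h1 := B.c_sq j
  refine mul_ne_zero ?_ (by exact_mod_cast NeZero.ne (d (B.f j)))
  intro h
  rw [h] at h1
  norm_num at h1

theorem E_ne_zero : B.E ≠ 0 := by
  have h1 := B.a_sq
  refine mul_ne_zero ?_ (by exact_mod_cast NeZero.ne (d B.p))
  intro h
  rw [h] at h1
  norm_num at h1

theorem chi_i₀_ne_zero : chi e B.i₀ x ≠ 0 := by
  rw [B.chi_i₀]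
  exact one_ne_zero

theorem chi_f_ne_zero (j : Fin 4) : chi e (B.f j) x ≠ 0 := by
  have h1 := B.c_sq j
  rw [B.chi_f]
  intro h
  rw [Int.cast_eq_zero.1 h] at h1
  norm_num at h1

theorem chi_p_ne_zero : chi e B.p x ≠ 0 := fun h => B.chi_p_im (by rw [h, map_zero])

theorem chi_q_ne_zero : chi e B.q x ≠ 0 := by
  rw [B.chi_q, Ne, map_eq_zero]
  exact B.chi_p_ne_zero

theorem dim_q : d B.q = d B.p := dim_eq_of_conj e B.chi_q

theorem dim_i₀ : d B.i₀ = 1 := dim_trivial e B.chi_i₀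

theorem F_dvd (j : Fin 4) : B.F j ∣ 8640 := by
  have h1 : (d (B.f j) : ℤ) ∣ 8640 := by exact_mod_cast B.dvd_f j
  rcases sq_eq_one_iff.1 (B.c_sq j) with h | h <;> simp [F, h, h1]

theorem E_dvd : B.E ∣ 8640 := by
  have h1 : (d B.p : ℤ) ∣ 8640 := by exact_mod_cast B.dvd_p
  rcases sq_eq_one_iff.1 B.a_sq with h | h <;> simp [E, h, h1]

theorem sum_degrees (hx : x ≠ 1) : 1 + (∑ j, B.F j + B.E) = 0 := by
  have h := sum_dim_chi e x
  rw [if_neg hx, B.sum_mul_chi _ (by rw [B.dim_q]), B.dim_i₀] at h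
  rw [← Int.cast_inj (α := ℂ)]
  simp only [F, E]
  push_cast at h ⊢
  rw [← h]
  simp only [mul_comm]

theorem sum_sq_degrees (hcard : Nat.card G = 95040) :
    1 + (∑ j, B.F j ^ 2 + 2 * B.E ^ 2) + ∑ i ∈ B.rest, (d i : ℤ) ^ 2 = 95040 := by
  have h := sum_dim_chi e 1
  simp only [chi_one, if_true] at h
  rw [← Nat.card_eq_fintype_card, hcard, B.sum_split, B.dim_i₀, B.dim_q] at h
  have h2 : (1 : ℤ) * 1 + (∑ j, (d (B.f j) : ℤ) * d (B.f j) + ((d B.p : ℤ) * d B.p + d B.p * d B.p)) +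
    ∑ i ∈ B.rest, (d i : ℤ) * d i = 95040 := by exact_mod_cast h
  simp only [F, E, mul_pow, B.c_sq, B.a_sq]
  rw [← h2]
  simp only [sq]
  ring

theorem sum_sq_degrees_mod (hcard : Nat.card G = 95040) :
    ∃ k : ℕ, 1 + (∑ j, B.F j ^ 2 + 2 * B.E ^ 2) + 121 * k = 95040 := by
  have h := B.sum_sq_degrees hcard
  have h1 : 121 ∣ ∑ i ∈ B.rest, d i ^ 2 := Finset.dvd_sum fun i hi => by
    rw [rest, mem_filter] at hi
    exact pow_dvd_pow_of_dvd (B.dim_else i hi.2.1 hi.2.2.1 hi.2.2.2.1 hi.2.2.2.2) 2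
  obtain ⟨k, hk⟩ := h1
  refine ⟨k, ?_⟩
  rw [← h]
  congr 1
  exact_mod_cast hk.symm

theorem F_mod (j : Fin 4) : (11 : ℤ) ∣ B.F j - 1 := B.dim_f j

theorem E_mod : (11 : ℤ) ∣ B.E - 6 := B.dim_p

end Block

/-- A conjugation-invariant set avoiding the centralizer of `x`, on which every irreducible
character not vanishing at `x` has sum an integral multiple of `n`. -/
structure IsColumn (e : Wedderburn G r d) (x : G) (K : Finset G) (n M : ℕ) (S : Fin r → ℤ) :
    Prop where
  conj : ∀ g, ∀ c ∈ K, g * c * g⁻¹ ∈ K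
  sum : ∀ i, chi e i x ≠ 0 → ∑ c ∈ K, chi e i c = n * S i
  avoid : ∀ c ∈ K, ¬ Commute x c
  mul_eq : n * M = 95040

namespace IsColumn
variable {K K' : Finset G} {n n' M M' : ℕ} {S S' : Fin r → ℤ} (hK : IsColumn e x K n M S)
  (hK' : IsColumn e x K' n' M' S') (B : Block e x)

/-- The signed value of a column at a real character in the block. -/
def _root_.GroupChar.Block.V (B : Block e x) (S : Fin r → ℤ) (j : Fin 4) : ℤ := B.c j * S (B.f j)

/-- The signed value of a column at the exceptional characters in the block. -/
def _root_.GroupChar.Block.W (B : Block e x) (S : Fin r → ℤ) : ℤ := B.a * S B.p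

include hK

theorem n_ne_zero : (n : ℂ) ≠ 0 := by
  have := hK.mul_eq
  intro h
  have h2 : n = 0 := by exact_mod_cast h
  rw [h2] at this
  omega

theorem eq_of_conj {p q : Fin r} (h : ∀ g, chi e q g = starRingEnd ℂ (chi e p g))
    (hp : chi e p x ≠ 0) : S q = S p := by
  have h1 := hK.sum q (by rwa [h, Ne, map_eq_zero])
  simp only [h] at h1
  rw [← map_sum, hK.sum p hp, map_mul, map_natCast, map_intCast] at h1
  exact_mod_cast (mul_left_cancel₀ hK.n_ne_zero h1).symm

theorem dvd (i : Fin r) (hi : chi e i x ≠ 0) : (d i : ℤ) ∣ n * S i := by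
  have h := class_isIntegral e i K hK.conj
  rw [hK.sum i hi, show (n * S i : ℂ) / (d i : ℂ) = ((n * S i : ℤ) : ℂ) / ((d i : ℤ) : ℂ) by
    push_cast; rfl] at h
  exact dvd_of_isIntegral_div (by exact_mod_cast NeZero.ne (d i)) h

theorem F_dvd (j : Fin 4) : B.F j ∣ n * B.V S j := by
  have := hK.dvd (B.f j) (B.chi_f_ne_zero j)
  rw [Block.F, Block.V, mul_left_comm]
  exact mul_dvd_mul_left _ this

theorem E_dvd : B.E ∣ n * B.W S := by
  have := hK.dvd B.p B.chi_p_ne_zero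
  rw [Block.E, Block.W, mul_left_comm]
  exact mul_dvd_mul_left _ this

theorem sum_q : ∑ c ∈ K, chi e B.q c = n * S B.p := by
  rw [hK.sum _ B.chi_q_ne_zero, hK.eq_of_conj B.chi_q B.chi_p_ne_zero]

theorem sum_eq_zero : S B.i₀ + (∑ j, B.V S j + B.W S) = 0 := by
  have h : ∑ i, (∑ c ∈ K, chi e i c) * chi e i x = 0 := by
    simp only [Finset.sum_mul]
    rw [Finset.sum_comm]
    refine Finset.sum_eq_zero fun c hc => ?_
    rw [column_orthogonality, Nat.cast_eq_zero, Finset.card_eq_zero, Finset.filter_eq_empty_iff]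
    intro g _ h
    refine hK.avoid _ (hK.conj g c hc) ?_
    rw [eq_inv_of_mul_eq_one_left h]
    exact (Commute.refl x).inv_right
  rw [B.sum_mul_chi _ (by rw [hK.sum_q, hK.sum _ B.chi_p_ne_zero]), hK.sum _ B.chi_i₀_ne_zero,
    hK.sum _ B.chi_p_ne_zero] at h
  simp only [fun j => hK.sum _ (B.chi_f_ne_zero j)] at h
  have h2 : (n : ℂ) * ((S B.i₀ + (∑ j, B.V S j + B.W S) : ℤ) : ℂ) = 0 := by
    rw [← h]
    simp only [Block.V, Block.W]
    push_cast
    rw [mul_add, mul_add, Finset.mul_sum]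
    congr 2
    · exact Finset.sum_congr rfl fun j _ => by ring
    · ring
  exact_mod_cast (mul_eq_zero.1 h2).resolve_left hK.n_ne_zero

include hK' in
theorem exists_structure_constant (hcard : Nat.card G = 95040) (hx : orderOf x = 11) :
    ∃ m : ℕ, #{c ∈ K | c⁻¹ * x⁻¹ ∈ K'} = 11 * m ∧ 8640 * (S B.i₀ * S' B.i₀) + (∑ j, B.V S j * B.V S' j * (8640 / B.F j) +
      B.W S * B.W S' * (8640 / B.E)) = M * M' * m := by
  haveI : Fact (Nat.Prime 11) := ⟨by norm_num⟩
  have h := class_mul e K K' hK.conj hK'.conj x⁻¹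
  obtain ⟨m, hm⟩ := prime_dvd_card_factorizations K K' hK.conj hK'.conj (x := x⁻¹) (p := 11)
    (by rw [orderOf_inv, hx]) (fun c hc h => hK.avoid c hc (Commute.inv_left_iff.1 h))
  rw [hm, inv_inv, ← Nat.card_eq_fintype_card, hcard] at h
  simp only [mul_div_right_comm _ (chi e _ x)] at h
  rw [B.sum_mul_chi _ (by rw [hK.sum_q, hK'.sum_q, hK.sum _ B.chi_p_ne_zero,
    hK'.sum _ B.chi_p_ne_zero, B.dim_q]), B.dim_i₀, hK.sum _ B.chi_i₀_ne_zero,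
    hK'.sum _ B.chi_i₀_ne_zero, hK.sum _ B.chi_p_ne_zero, hK'.sum _ B.chi_p_ne_zero] at h
  simp only [fun j => hK.sum _ (B.chi_f_ne_zero j), fun j => hK'.sum _ (B.chi_f_ne_zero j)] at h
  refine ⟨m, hm, ?_⟩
  have key : ∀ (c s s' : ℤ) (D : ℕ), c ^ 2 = 1 → c * D ≠ 0 → c * D ∣ 8640 →
      (((c * s) * (c * s') * (8640 / (c * D)) : ℤ) : ℂ) = 8640 * (s * s' / D * c) := by
    intro c s s' D hc h0 h1
    obtain ⟨k, hk⟩ := h1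
    have h0' : ((c * D : ℤ) : ℂ) ≠ 0 := by exact_mod_cast h0
    have hD : (D : ℂ) ≠ 0 := by
      intro h; apply h0'; push_cast; rw [h, mul_zero]
    have hk' : (8640 : ℂ) = c * D * k := by exact_mod_cast hk
    have hc' : (c : ℂ) ^ 2 = 1 := by exact_mod_cast hc
    rw [Int.ediv_eq_of_eq_mul_right h0 hk, hk']
    push_cast
    field_simp
  have h3 : ((8640 * (S B.i₀ * S' B.i₀) + (∑ j, B.V S j * B.V S' j * (8640 / B.F j) +
      B.W S * B.W S' * (8640 / B.E)) : ℤ) : ℂ) = 8640 * ((S B.i₀ : ℂ) * (S' B.i₀ : ℂ) +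
        (∑ j, (S (B.f j) : ℂ) * (S' (B.f j) : ℂ) / (d (B.f j) : ℂ) * (B.c j : ℂ) +
          (S B.p : ℂ) * (S' B.p : ℂ) / (d B.p : ℂ) * (B.a : ℂ))) := by
    have hE := key (B.a) (S B.p) (S' B.p) (d B.p) B.a_sq B.E_ne_zero B.E_dvd
    have hF := fun j => key (B.c j) (S (B.f j)) (S' (B.f j)) (d (B.f j)) (B.c_sq j) (B.F_ne_zero j)
      (B.F_dvd j)
    simp only [Block.V, Block.W, Block.F, Block.E]
    rw [Int.cast_add, Int.cast_add, Int.cast_sum, hE, Finset.sum_congr rfl (fun j _ => hF j),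
      mul_add, mul_add, Finset.mul_sum]
    push_cast
    rfl
  rw [← Int.cast_inj (α := ℂ), h3]
  have h4 : (n : ℂ) * n' * ((S B.i₀ : ℂ) * (S' B.i₀ : ℂ) +
        (∑ j, (S (B.f j) : ℂ) * (S' (B.f j) : ℂ) / (d (B.f j) : ℂ) * (B.c j : ℂ) +
          (S B.p : ℂ) * (S' B.p : ℂ) / (d B.p : ℂ) * (B.a : ℂ))) =
        95040 * (11 * m) := by
    rw [mul_add, mul_add, Finset.mul_sum]
    push_cast at h
    rw [← h, div_one]
    congr 1
    · ring
    · congr 1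
      · exact Finset.sum_congr rfl fun j _ => by ring
      · ring
  have h5 : (n : ℂ) * M = 95040 := by exact_mod_cast hK.mul_eq
  have h6 : (n' : ℂ) * M' = 95040 := by exact_mod_cast hK'.mul_eq
  push_cast
  generalize (S B.i₀ : ℂ) * (S' B.i₀ : ℂ) + _ = Z at h4 ⊢
  have h7 : (95040 : ℂ) * 95040 * Z = 95040 * 11 * (M * M' * m) := by
    linear_combination M * M' * h4 - Z * (n' * M') * h5 - Z * 95040 * h6
  linear_combination h7 / (95040 * 11)

end IsColumn
end GroupChar

namespace ColumnSearch

/-- The signed values of a rational column on a block: four real characters and one pair of complex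
conjugate characters, the value at the trivial character being kept apart. -/
structure Row where
  a : ℤ
  b : ℤ
  c : ℤ
  d : ℤ
  w : ℤ

/-- The candidates for the signed value of the power sum of an element of order `p` at a character
of signed degree `f`. -/
def cand (p : ℕ) (n R : ℤ) (f : ℤ) : List ℤ :=
  ((List.range f.natAbs).map fun m : ℕ => f.sign * ((p * m : ℕ) : ℤ) - f).filter fun v =>
    decide (v * v ≤ R) && n * v % f == 0

/-- Test all rows with entries in the given lists, total zero and squared norm at most `R`. -/
def search (u R : ℤ) (A B C D W : List ℤ) (P : Row → Bool) : Bool :=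
  A.all fun a => decide (R < u * u + a * a) ||
  B.all fun b => decide (R < u * u + a * a + b * b) ||
  C.all fun c => decide (R < u * u + a * a + b * b + c * c) ||
  D.all fun d => decide (R < u * u + a * a + b * b + c * c + d * d +
      2 * ((u + a + b + c + d) * (u + a + b + c + d))) ||
    !W.contains (-(u + a + b + c + d)) || P ⟨a, b, c, d, -(u + a + b + c + d)⟩

def dot (u v : ℤ) (x y : Row) : ℤ :=
  u * v + (x.a * y.a + x.b * y.b + x.c * y.c + x.d * y.d + 2 * (x.w * y.w))

/-- A multiple of the structure constant at an element of order 11. -/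
def sc (u v : ℤ) (f x y : Row) : ℤ :=
  8640 * (u * v) + (x.a * y.a * (8640 / f.a) + x.b * y.b * (8640 / f.b) +
    x.c * y.c * (8640 / f.c) + x.d * y.d * (8640 / f.d) + x.w * y.w * (8640 / f.w))

def quad (p q r x y z : ℤ) : ℤ :=
  (x * z - y * q) ^ 2 * p + (x * y - p * z) ^ 2 * q + (p * q - x ^ 2) ^ 2 * r +
    2 * ((x * z - y * q) * (x * y - p * z) * x + (x * z - y * q) * (p * q - x ^ 2) * y +
      (x * y - p * z) * (p * q - x ^ 2) * z)

def gram (f t : Row) (M : ℤ) (s : Row) (u N : ℤ) : ℤ :=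
  quad (95040 - dot 1 1 f f) (M - dot 1 1 t t) (u * N - dot u u s s)
    (-dot 1 1 f t) (-dot 1 u f s) (-dot 1 u t s)

def divides (m z : ℤ) : Bool := decide (0 ≤ z) && z % m == 0

/-- The rows of power sums for the elements of order `p` compatible with an involution. -/
def compat (f t : Row) (M : ℤ) (u N : ℤ) (s : Row) : Bool :=
  divides (N * N) (sc u u f s s) && divides (M * N) (sc 1 u f t s) && decide (0 ≤ gram f t M s u N)

def ev (b : Bool) (l : List ℤ) : List ℤ := if b then l.filter fun v => v % 2 == 0 else l

def searchFive (f t : Row) (M N : ℤ) : Bool :=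
  let n := 95040 / N
  let R := 4 * N
  search 4 R (ev true (cand 5 n R f.a)) (ev true (cand 5 n R f.b)) (ev true (cand 5 n R f.c))
    (ev true (cand 5 n R f.d)) (ev true (cand 5 n R f.w)) fun s => !compat f t M 4 N s

def searchThree (f t : Row) (M N : ℤ) : Bool :=
  let n := 95040 / N
  let R := 2 * N
  search 2 R
    (ev (f.a != f.b && f.a != f.c && f.a != f.d) (cand 3 n R f.a))
    (ev (f.b != f.a && f.b != f.c && f.b != f.d) (cand 3 n R f.b))
    (ev (f.c != f.a && f.c != f.b && f.c != f.d) (cand 3 n R f.c))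
    (ev (f.d != f.a && f.d != f.b && f.d != f.c) (cand 3 n R f.d))
    (ev true (cand 3 n R f.w)) fun s => !compat f t M 2 N s

/-- The candidates for the signed value of an involution at a character of signed degree `f`. -/
def candTwo (n R f : ℤ) : List ℤ :=
  ((List.range' 1 ((f.natAbs - 1) / 2)).map fun k : ℕ => f - f.sign * ((4 * k : ℕ) : ℤ)).filter fun v =>
    decide (v * v ≤ R) && n * v % f == 0

def searchTwo (f : Row) (M : ℤ) (P : Row → Bool) : Bool :=
  let n := 95040 / M
  search 1 M (candTwo n M f.a) (candTwo n M f.b) (candTwo n M f.c) (candTwo n M f.d)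
    (candTwo n M f.w) fun t => sc 1 1 f t t != 0 ||
      decide ((dot 1 1 f t) ^ 2 * (95040 - dot 1 1 f f) - 2 * (95040 - dot 1 1 f f) * (dot 1 1 f t) ^ 2
        + (95040 - dot 1 1 f f) ^ 2 * (M - dot 1 1 t t) < 0) || P t

/-- The exceptional solution not excluded by the numerical conditions. -/
def isM12 (f : Row) : Bool := f.a == -120 && f.b == -54 && f.c == 45 && f.d == 144 && f.w == -16

/-- A solution excluded by decomposing tensor products. -/
def isTensor (f t : Row) : Bool :=
  f.a == -10 && f.b == 12 && f.c == 12 && f.d == 45 && f.w == -60 &&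
    t.a == 6 && t.b == -4 && t.c == -4 && t.d == -3 && t.w == 4

def test (f t : Row) (M : ℤ) : Bool :=
  isTensor f t ||
    (([45, 135, 90, 270, 180, 540, 360, 1080, 720, 2160, 1440, 4320, 2880, 8640] : List ℤ).all
        (searchThree f t M) ||
      ([90, 540, 240, 1440, 8640] : List ℤ).all (searchFive f t M)) &&
    (searchFive f t M 40 ||
      ([27, 135, 54, 270, 108, 540, 216, 1080, 432, 2160, 864, 4320, 1728, 8640] : List ℤ).all
        fun N => searchThree f t M N || isM12 f && N == 108)

def degrees : List ℤ := [-120, -54, -32, -10, 12, 45, 144]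

def degreesPair : List ℤ := [6, 72, 160, 270, -5, -16, -27, -60, -192]

def searchDegrees (P : Row → Bool) : Bool :=
  degrees.all fun a => degrees.all fun b => decide (b < a) || degrees.all fun c => decide (c < b) ||
    degrees.all fun d => decide (d < c) || !degreesPair.contains (-(1 + a + b + c + d)) ||
    (fun f => decide (95040 < dot 1 1 f f) || (95040 - dot 1 1 f f) % 121 != 0 || P f)
      (Row.mk a b c d (-(1 + a + b + c + d)))

def searchAll : Bool :=
  searchDegrees fun f =>
    ([64, 192, 576, 1728, 320, 960, 2880, 8640] : List ℤ).all fun M =>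
      searchTwo f M fun t => test f t M

theorem searchAll_eq_true : searchAll = true := by decide +kernel

end ColumnSearch

namespace ColumnSearch

theorem search_sound {u R : ℤ} {A B C D W : List ℤ} {P : Row → Bool}
    (h : search u R A B C D W P = true) {s : Row} (ha : s.a ∈ A) (hb : s.b ∈ B) (hc : s.c ∈ C)
    (hd : s.d ∈ D) (hw : s.w ∈ W) (hsum : u + (s.a + s.b + s.c + s.d + s.w) = 0)
    (hnorm : dot u u s s ≤ R) : P s = true := by
  obtain ⟨a, b, c, d, w⟩ := s
  simp only [dot] at *
  obtain rfl : w = -(u + a + b + c + d) := by linarith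
  have h1 := List.all_eq_true.1 h a ha
  rw [Bool.or_eq_true, decide_eq_true_eq, or_iff_right (by
    nlinarith [mul_self_nonneg b, mul_self_nonneg c, mul_self_nonneg d,
      mul_self_nonneg (u + a + b + c + d)])] at h1
  have h2 := List.all_eq_true.1 h1 b hb
  rw [Bool.or_eq_true, decide_eq_true_eq, or_iff_right (by
    nlinarith [mul_self_nonneg c, mul_self_nonneg d, mul_self_nonneg (u + a + b + c + d)])] at h2
  have h3 := List.all_eq_true.1 h2 c hc
  rw [Bool.or_eq_true, decide_eq_true_eq, or_iff_right (by
    nlinarith [mul_self_nonneg d, mul_self_nonneg (u + a + b + c + d)])] at h3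
  have h4 := List.all_eq_true.1 h3 d hd
  rw [Bool.or_eq_true, Bool.or_eq_true, decide_eq_true_eq, or_iff_right (by
    intro h5
    rcases h5 with h5 | h5
    · nlinarith
    · simp only [Bool.not_eq_true', List.contains_eq_mem, decide_eq_false_iff_not] at h5
      exact h5 hw)] at h4
  exact h4

theorem mem_cand {p m D : ℕ} {n R c : ℤ} (hc : c ^ 2 = 1) (hm : m < D)
    (hR : (c * (p * m - D)) ^ 2 ≤ R) (hn : c * D ∣ n * (c * (p * m - D))) :
    c * (p * m - D) ∈ cand p n R (c * D) := by
  have hD : (D : ℤ).sign = 1 := Int.sign_eq_one_of_pos (by omega)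
  rw [cand, List.mem_filter]
  refine ⟨List.mem_map.2 ⟨m, List.mem_range.2 ?_, ?_⟩, ?_⟩
  · rcases sq_eq_one_iff.1 hc with rfl | rfl <;> simpa using hm
  · rcases sq_eq_one_iff.1 hc with rfl | rfl
    · simp [hD]
    · simp [hD, Int.sign_neg]; ring
  · simp only [Bool.and_eq_true, decide_eq_true_eq, beq_iff_eq]
    exact ⟨by rw [← sq]; exact hR, Int.emod_eq_zero_of_dvd hn⟩

theorem mem_candTwo {m D : ℕ} {n R c : ℤ} (hc : c ^ 2 = 1) (hm0 : 0 < m) (hm : m < D)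
    (he : Even m) (hR : (c * (D - 2 * m)) ^ 2 ≤ R) (hn : c * D ∣ n * (c * (D - 2 * m))) :
    c * (D - 2 * m) ∈ candTwo n R (c * D) := by
  have hD : (D : ℤ).sign = 1 := Int.sign_eq_one_of_pos (by omega)
  obtain ⟨k, rfl⟩ := he
  rw [candTwo, List.mem_filter]
  refine ⟨List.mem_map.2 ⟨k, List.mem_range'_1.2 ?_, ?_⟩, ?_⟩
  · rcases sq_eq_one_iff.1 hc with rfl | rfl
    · rw [one_mul, Int.natAbs_natCast]; omega
    · rw [neg_one_mul, Int.natAbs_neg, Int.natAbs_natCast]; omega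
  · rcases sq_eq_one_iff.1 hc with rfl | rfl
    · simp [hD]; ring
    · simp [hD, Int.sign_neg]; ring
  · simp only [Bool.and_eq_true, decide_eq_true_eq, beq_iff_eq]
    exact ⟨by rw [← sq]; exact hR, Int.emod_eq_zero_of_dvd hn⟩

theorem mem_ev {b : Bool} {l : List ℤ} {v : ℤ} (hv : v ∈ l) (h : b = true → 2 ∣ v) :
    v ∈ ev b l := by
  unfold ev
  split_ifs with hb
  · exact List.mem_filter.2 ⟨hv, by simpa using Int.emod_eq_zero_of_dvd (h hb)⟩
  · exact hv

/-- The entries of `s` are candidates for power sums of elements of order `p`. -/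
structure IsCand (p : ℕ) (f s : Row) (N : ℤ) : Prop where
  a : s.a ∈ cand p (95040 / N) ((p - 1) * N) f.a
  b : s.b ∈ cand p (95040 / N) ((p - 1) * N) f.b
  c : s.c ∈ cand p (95040 / N) ((p - 1) * N) f.c
  d : s.d ∈ cand p (95040 / N) ((p - 1) * N) f.d
  w : s.w ∈ cand p (95040 / N) ((p - 1) * N) f.w
  sum : (p - 1 : ℤ) + (s.a + s.b + s.c + s.d + s.w) = 0
  norm : dot (p - 1) (p - 1) s s ≤ (p - 1) * N

theorem searchFive_eq_false {f t s : Row} {M N : ℤ} (h : IsCand 5 f s N) (ha : 2 ∣ s.a)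
    (hb : 2 ∣ s.b) (hc : 2 ∣ s.c) (hd : 2 ∣ s.d) (hw : 2 ∣ s.w) (hs : compat f t M 4 N s = true) :
    searchFive f t M N = false := by
  rw [← Bool.not_eq_true]
  intro h1
  dsimp only [searchFive] at h1
  obtain ⟨ka, kb, kc, kd, kw, ks, kn⟩ := h
  rw [show (((5 : ℕ) : ℤ) - 1) = 4 from rfl] at *
  have := search_sound h1 (mem_ev ka fun _ => ha) (mem_ev kb fun _ => hb) (mem_ev kc fun _ => hc)
    (mem_ev kd fun _ => hd) (mem_ev kw fun _ => hw) ks kn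
  rw [hs] at this
  exact absurd this (by decide)

theorem searchThree_eq_false {f t s : Row} {M N : ℤ} (h : IsCand 3 f s N)
    (ha : f.a ≠ f.b → f.a ≠ f.c → f.a ≠ f.d → 2 ∣ s.a)
    (hb : f.b ≠ f.a → f.b ≠ f.c → f.b ≠ f.d → 2 ∣ s.b)
    (hc : f.c ≠ f.a → f.c ≠ f.b → f.c ≠ f.d → 2 ∣ s.c)
    (hd : f.d ≠ f.a → f.d ≠ f.b → f.d ≠ f.c → 2 ∣ s.d) (hw : 2 ∣ s.w)
    (hs : compat f t M 2 N s = true) : searchThree f t M N = false := by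
  rw [← Bool.not_eq_true]
  intro h1
  dsimp only [searchThree] at h1
  obtain ⟨ka, kb, kc, kd, kw, ks, kn⟩ := h
  rw [show (((3 : ℕ) : ℤ) - 1) = 2 from rfl] at *
  have key : ∀ x y z w : ℤ, (x != y && x != z && x != w) = true → x ≠ y ∧ x ≠ z ∧ x ≠ w := by
    intro x y z w h
    simpa [and_assoc] using h
  have := search_sound h1
    (mem_ev ka fun h => ha (key _ _ _ _ h).1 (key _ _ _ _ h).2.1 (key _ _ _ _ h).2.2)
    (mem_ev kb fun h => hb (key _ _ _ _ h).1 (key _ _ _ _ h).2.1 (key _ _ _ _ h).2.2)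
    (mem_ev kc fun h => hc (key _ _ _ _ h).1 (key _ _ _ _ h).2.1 (key _ _ _ _ h).2.2)
    (mem_ev kd fun h => hd (key _ _ _ _ h).1 (key _ _ _ _ h).2.1 (key _ _ _ _ h).2.2)
    (mem_ev kw fun _ => hw) ks kn
  rw [hs] at this
  exact absurd this (by decide)

theorem quad_nonneg {ι : Type*} (s : Finset ι) (x y z : ι → ℤ) :
    0 ≤ quad (∑ i ∈ s, x i ^ 2) (∑ i ∈ s, y i ^ 2) (∑ i ∈ s, z i ^ 2) (∑ i ∈ s, x i * y i)
      (∑ i ∈ s, x i * z i) (∑ i ∈ s, y i * z i) := by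
  set p := ∑ i ∈ s, x i ^ 2
  set q := ∑ i ∈ s, y i ^ 2
  set r := ∑ i ∈ s, z i ^ 2
  set k := ∑ i ∈ s, x i * y i with hk
  set l := ∑ i ∈ s, x i * z i
  set m := ∑ i ∈ s, y i * z i
  have key : ∀ a b c : ℤ, 0 ≤ a ^ 2 * p + b ^ 2 * q + c ^ 2 * r +
      2 * (a * b * k + a * c * l + b * c * m) := by
    intro a b c
    have h : a ^ 2 * p + b ^ 2 * q + c ^ 2 * r + 2 * (a * b * k + a * c * l + b * c * m) =
        ∑ i ∈ s, (a * x i + b * y i + c * z i) ^ 2 := by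
      simp only [p, q, r, k, l, m, mul_add, Finset.mul_sum, ← Finset.sum_add_distrib]
      exact Finset.sum_congr rfl fun i _ => by ring
    rw [h]
    positivity
  exact key _ _ _

theorem searchDegrees_sound {P : Row → Bool} (h : searchDegrees P = true) {f : Row}
    (ha : f.a ∈ degrees) (hb : f.b ∈ degrees) (hc : f.c ∈ degrees) (hd : f.d ∈ degrees)
    (hw : f.w ∈ degreesPair) (hab : f.a ≤ f.b) (hbc : f.b ≤ f.c) (hcd : f.c ≤ f.d)
    (hsum : 1 + (f.a + f.b + f.c + f.d + f.w) = 0) (hle : dot 1 1 f f ≤ 95040)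
    (h121 : 121 ∣ 95040 - dot 1 1 f f) : P f = true := by
  obtain ⟨a, b, c, d, w⟩ := f
  obtain rfl : w = -(1 + a + b + c + d) := by simp only at hsum; linarith
  have h1 := List.all_eq_true.1 (List.all_eq_true.1 h a ha) b hb
  rw [Bool.or_eq_true, decide_eq_true_eq, or_iff_right hab.not_gt] at h1
  have h2 := List.all_eq_true.1 h1 c hc
  rw [Bool.or_eq_true, decide_eq_true_eq, or_iff_right hbc.not_gt] at h2
  have h3 := List.all_eq_true.1 h2 d hd
  rw [Bool.or_eq_true, Bool.or_eq_true, decide_eq_true_eq, or_iff_right (by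
    intro h5
    rcases h5 with h5 | h5
    · exact absurd h5 hcd.not_gt
    · simp only [Bool.not_eq_true', List.contains_eq_mem, decide_eq_false_iff_not] at h5
      exact h5 hw), Bool.or_eq_true, Bool.or_eq_true, decide_eq_true_eq, or_iff_right (by
    intro h5
    rcases h5 with h5 | h5
    · exact absurd h5 hle.not_gt
    · exact (bne_iff_ne.1 h5) (Int.emod_eq_zero_of_dvd h121))] at h3
  exact h3

theorem searchTwo_sound {f t : Row} {M : ℤ} {P : Row → Bool} (h : searchTwo f M P = true)
    (ha : t.a ∈ candTwo (95040 / M) M f.a) (hb : t.b ∈ candTwo (95040 / M) M f.b)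
    (hc : t.c ∈ candTwo (95040 / M) M f.c) (hd : t.d ∈ candTwo (95040 / M) M f.d)
    (hw : t.w ∈ candTwo (95040 / M) M f.w) (hsum : 1 + (t.a + t.b + t.c + t.d + t.w) = 0)
    (hnorm : dot 1 1 t t ≤ M) (hsc : sc 1 1 f t t = 0)
    (hgram : 0 ≤ (dot 1 1 f t) ^ 2 * (95040 - dot 1 1 f f) -
      2 * (95040 - dot 1 1 f f) * (dot 1 1 f t) ^ 2 + (95040 - dot 1 1 f f) ^ 2 * (M - dot 1 1 t t)) :
    P t = true := by
  dsimp only [searchTwo] at h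
  have h1 := search_sound h ha hb hc hd hw hsum hnorm
  rw [Bool.or_eq_true, Bool.or_eq_true, decide_eq_true_eq, or_iff_right (by
    intro h5
    rcases h5 with h5 | h5
    · exact (bne_iff_ne.1 h5) hsc
    · exact absurd h5 hgram.not_gt)] at h1
  exact h1

theorem compat_eq_true {f t s : Row} {M u N : ℤ} {k l : ℕ} (h1 : sc u u f s s = N * N * k)
    (h2 : sc 1 u f t s = M * N * l) (h3 : 0 ≤ gram f t M s u N) (hM : 0 ≤ M) (hN : 0 ≤ N) :
    compat f t M u N s = true := by
  simp only [compat, divides, h1, h2, Bool.and_eq_true, decide_eq_true_eq, beq_iff_eq]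
  exact ⟨⟨⟨by positivity, Int.mul_emod_right _ _⟩, by positivity, Int.mul_emod_right _ _⟩, h3⟩

end ColumnSearch

namespace GroupChar
open Matrix Finset
open ColumnSearch
variable {G : Type*} [Group G] [Fintype G] [DecidableEq G] {r : ℕ} {d : Fin r → ℕ}
  [∀ i, NeZero (d i)] {e : Wedderburn G r d} {x h : G} {p N : ℕ} {S : Fin r → ℤ}

/-- The column of sums of the irreducible characters over the nontrivial powers of an element of
prime order. -/
structure IsPowerColumn (e : Wedderburn G r d) (x h : G) (p N : ℕ) (S : Fin r → ℤ) : Prop where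
  prime : p.Prime
  order : orderOf h = p
  column : IsColumn e x (rationalClass h) (95040 / N) N S
  eq : ∀ i, (S i : ℂ) = powerSum e i h p
  mean : ∀ i, ∃ m : ℕ, S i = p * m - d i ∧ m ≤ d i ∧ (m = d i → irrep e i h = 1)
  sum_sq : ∑ i, S i ^ 2 = (p - 1) * N

theorem orderOf_of_mem_rationalClass {c : G} (hp : p.Prime) (hh : orderOf h = p)
    (hc : c ∈ rationalClass h) : orderOf c = p := by
  obtain ⟨h1, a, ha⟩ := mem_rationalClass.1 hc
  have h2 : orderOf (a⁻¹ * c * a) ∣ p := hh ▸ Nat.card_zpowers h ▸ Subgroup.orderOf_dvd_natCard _ ha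
  have h3 : orderOf (a⁻¹ * c * a) = orderOf c := by
    have := orderOf_injective (MulAut.conj a⁻¹).toMonoidHom (MulAut.conj a⁻¹).injective c
    rw [← this]
    simp
  rw [h3] at h2
  rcases (Nat.dvd_prime hp).1 h2 with h4 | h4
  · exact absurd (orderOf_eq_one_iff.1 h4) h1
  · exact h4

theorem not_commute_of_orderOf {c : G} (hC : Nat.card (Subgroup.centralizer {x}) = 11)
    (hp : p.Prime) (hp11 : p ≠ 11) (hc : orderOf c = p) : ¬ Commute x c := by
  intro hxc
  have h1 : c ∈ Subgroup.centralizer {x} := Subgroup.mem_centralizer_singleton_iff.2 hxc.eq.symm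
  have h2 := Subgroup.orderOf_dvd_natCard _ h1
  rw [hC, hc] at h2
  exact hp11 ((Nat.prime_dvd_prime_iff_eq hp (by norm_num)).1 h2)

theorem exists_isPowerColumn (e : Wedderburn G r d) (hcard : Nat.card G = 95040)
    (hC : Nat.card (Subgroup.centralizer {x}) = 11) (hp : p.Prime) (hp11 : p ≠ 11)
    (hh : orderOf h = p) :
    ∃ S, IsPowerColumn e x h p (Nat.card (Subgroup.normalizer (Subgroup.zpowers h : Set G))) S := by
  haveI : Fact p.Prime := ⟨hp⟩
  set N := Nat.card (Subgroup.normalizer (Subgroup.zpowers h : Set G)) with hN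
  have hh1 : h ^ p = 1 := by rw [← hh, pow_orderOf_eq_one]
  choose m hm hmd hm1 using fun i => chi_mean e i hp.pos hh1
  have hS : ∀ i, ((p * m i - d i : ℤ) : ℂ) = powerSum e i h p := fun i => by
    rw [powerSum, hm]; push_cast; rfl
  have hn : 95040 / N * N = 95040 :=
    Nat.div_mul_cancel (hcard ▸ Subgroup.card_subgroup_dvd_card _)
  have hN0 : (N : ℂ) ≠ 0 := by
    intro h0
    rw [Nat.cast_eq_zero.1 h0] at hn
    omega
  refine ⟨fun i => p * m i - d i, hp, hh, ⟨rationalClass_conj h, fun i _ => ?_, fun c hc =>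
    not_commute_of_orderOf hC hp hp11 (orderOf_of_mem_rationalClass hp hh hc), hn⟩, hS,
    fun i => ⟨m i, rfl, hmd i, hm1 i⟩, ?_⟩
  · have h1 := sum_rationalClass e hh i
    rw [← Nat.card_eq_fintype_card, hcard, ← hn] at h1
    refine mul_left_cancel₀ hN0 (h1.trans ?_)
    rw [show (∑ k ∈ range p, chi e i (h ^ k) - d i) = powerSum e i h p from rfl, ← hS]
    push_cast
    ring
  · have h1 := sum_powerSum_sq e hh
    simp only [← hS] at h1
    rw [Nat.cast_sub hp.one_le] at h1
    exact_mod_cast h1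

namespace Block
variable (B : Block e x)

def row (S : Fin r → ℤ) : Row := ⟨B.V S 0, B.V S 1, B.V S 2, B.V S 3, B.W S⟩

/-- The signed degrees of the characters in the block. -/
def degRow : Row := B.row fun i => d i

theorem sum_mul (S T : Fin r → ℤ) (hS : S B.q = S B.p) (hT : T B.q = T B.p) :
    ∑ i ∈ B.rest, S i * T i = ∑ i, S i * T i - dot (S B.i₀) (T B.i₀) (B.row S) (B.row T) := by
  have hc : ∀ j, B.V S j * B.V T j = S (B.f j) * T (B.f j) := fun j => by
    rw [V, V, mul_mul_mul_comm, ← sq, B.c_sq, one_mul]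
  have ha : B.W S * B.W T = S B.p * T B.p := by
    rw [W, W, mul_mul_mul_comm, ← sq, B.a_sq, one_mul]
  rw [B.sum_split fun i => S i * T i, Fin.sum_univ_four, hS, hT]
  simp only [dot, row, hc, ha]
  ring

theorem dim_trivial' : (d B.i₀ : ℤ) = 1 := by
  rw [B.dim_i₀, Nat.cast_one]

end Block

namespace IsPowerColumn
variable (hS : IsPowerColumn e x h p N S) (B : Block e x)
include hS

theorem apply_i₀ : S B.i₀ = p - 1 := by
  have h1 := hS.eq B.i₀
  simp only [powerSum, B.chi_i₀, B.dim_i₀] at h1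
  simp only [sum_const, card_range, nsmul_eq_mul, mul_one, Nat.cast_one] at h1
  exact_mod_cast h1

theorem apply_q : S B.q = S B.p := hS.column.eq_of_conj B.chi_q B.chi_p_ne_zero

theorem sum_eq_zero : (p - 1 : ℤ) + ((B.row S).a + (B.row S).b + (B.row S).c + (B.row S).d +
    (B.row S).w) = 0 := by
  have := hS.column.sum_eq_zero B
  rwa [Fin.sum_univ_four, hS.apply_i₀ B] at this

theorem dot_le : dot (p - 1) (p - 1) (B.row S) (B.row S) ≤ (p - 1) * N := by
  have h1 := B.sum_mul S S (hS.apply_q B) (hS.apply_q B)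
  simp only [← sq] at h1
  rw [hS.sum_sq, hS.apply_i₀ B] at h1
  have h2 : 0 ≤ ∑ i ∈ B.rest, S i ^ 2 := Finset.sum_nonneg fun i _ => sq_nonneg _
  linarith

theorem exists_sc {h' : G} {p' N' : ℕ} {S' : Fin r → ℤ} (hS' : IsPowerColumn e x h' p' N' S')
    (hcard : Nat.card G = 95040) (hx : orderOf x = 11) :
    ∃ m : ℕ, #{c ∈ rationalClass h | c⁻¹ * x⁻¹ ∈ rationalClass h'} = 11 * m ∧
      sc (p - 1) (p' - 1) B.degRow (B.row S) (B.row S') = N * N' * m := by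
  obtain ⟨m, hm, h1⟩ := hS.column.exists_structure_constant hS'.column B hcard hx
  refine ⟨m, hm, ?_⟩
  rw [← h1, Fin.sum_univ_four, hS.apply_i₀ B, hS'.apply_i₀ B]
  rfl

theorem natCast_div : ((95040 / N : ℕ) : ℤ) = 95040 / (N : ℤ) := by
  rw [Int.natCast_div]; rfl

theorem norm_bound : (∀ j, B.V S j ^ 2 ≤ (p - 1) * N) ∧ B.W S ^ 2 ≤ (p - 1) * N := by
  have h1 := hS.dot_le B
  simp only [dot, Block.row] at h1
  refine ⟨fun j => ?_, ?_⟩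
  · have : ∀ j, 0 ≤ B.V S j * B.V S j := fun j => mul_self_nonneg _
    have h2 := this 0; have h3 := this 1; have h4 := this 2; have h5 := this 3
    have h6 := mul_self_nonneg (B.W S)
    have h7 := mul_self_nonneg (p - 1 : ℤ)
    fin_cases j <;> simp only [Fin.zero_eta, Fin.mk_one, Fin.reduceFinMk, sq] <;> linarith
  · have : ∀ j, 0 ≤ B.V S j * B.V S j := fun j => mul_self_nonneg _
    have h2 := this 0; have h3 := this 1; have h4 := this 2; have h5 := this 3
    have h6 := mul_self_nonneg (B.W S)
    have h7 := mul_self_nonneg (p - 1 : ℤ)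
    rw [sq]
    linarith

theorem mem_cand_of_ne {i : Fin r} (hi : irrep e i h ≠ 1) {c n : ℤ} (hc : c ^ 2 = 1)
    (hR : (c * S i) ^ 2 ≤ (p - 1) * N) (hn : c * d i ∣ n * (c * S i)) :
    c * S i ∈ cand p n ((p - 1) * N) (c * d i) := by
  obtain ⟨m, hm, hmd, hm1⟩ := hS.mean i
  rw [hm] at hR hn ⊢
  exact mem_cand hc (lt_of_le_of_ne hmd fun h => hi (hm1 h)) hR hn

theorem ne_one : h ≠ 1 := by
  intro h1
  have := hS.order
  rw [h1, orderOf_one] at this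
  exact hS.prime.one_lt.ne this

theorem isCand [IsSimpleGroup G] : IsCand p B.degRow (B.row S) N := by
  have hi : ∀ i, i ≠ B.i₀ → irrep e i h ≠ 1 := fun i hi h1 =>
    hS.ne_one (irrep_injective e B.chi_i₀ hi h1)
  have hV : ∀ j, B.V S j ∈ cand p (95040 / N) ((p - 1) * N) (B.F j) := fun j =>
    hS.mem_cand_of_ne (hi _ (B.f_ne j).1) (B.c_sq j) ((hS.norm_bound B).1 j)
      (hS.natCast_div ▸ hS.column.F_dvd B j)
  exact ⟨hV 0, hV 1, hV 2, hV 3, hS.mem_cand_of_ne (hi _ B.p_ne) B.a_sq (hS.norm_bound B).2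
    (hS.natCast_div ▸ hS.column.E_dvd B), hS.sum_eq_zero B, hS.dot_le B⟩

theorem sum_dim_mul : ∑ i, (d i : ℤ) * S i = 0 := by
  haveI : Fact p.Prime := ⟨hS.prime⟩
  have := sum_dim_mul_powerSum e hS.order
  simp only [← hS.eq] at this
  exact_mod_cast this

theorem sum_mul {h' : G} {p' N' : ℕ} {S' : Fin r → ℤ} (hS' : IsPowerColumn e x h' p' N' S')
    (hp : p ≠ p') : ∑ i, S i * S' i = 0 := by
  haveI : Fact p.Prime := ⟨hS.prime⟩
  haveI : Fact p'.Prime := ⟨hS'.prime⟩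
  have := sum_powerSum_mul_powerSum e hp hS.order hS'.order
  simp only [← hS.eq, ← hS'.eq] at this
  exact_mod_cast this

theorem gram_nonneg (hcard : Nat.card G = 95040) {t : G} {M : ℕ} {T : Fin r → ℤ}
    (hT : IsPowerColumn e x t 2 M T) (hp : p ≠ 2) :
    0 ≤ gram B.degRow (B.row T) M (B.row S) (p - 1) N := by
  have hd : ((d B.q : ℕ) : ℤ) = d B.p := by rw [B.dim_q]
  have h1 := quad_nonneg B.rest (fun i => (d i : ℤ)) T S
  have h2 : ∑ i, (d i : ℤ) * d i = 95040 := by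
    have := sum_dim_chi e 1
    simp only [chi_one, if_true] at this
    rw [← Nat.card_eq_fintype_card, hcard] at this
    exact_mod_cast this
  have h3 := hT.sum_sq
  have h4 := hS.sum_sq
  simp only [sq] at h1 h3 h4
  rw [B.sum_mul (fun i => (d i : ℤ)) _ hd hd, B.sum_mul (fun i => (d i : ℤ)) T hd (hT.apply_q B),
    B.sum_mul (fun i => (d i : ℤ)) S hd (hS.apply_q B), B.sum_mul T T (hT.apply_q B) (hT.apply_q B),
    B.sum_mul T S (hT.apply_q B) (hS.apply_q B), B.sum_mul S S (hS.apply_q B) (hS.apply_q B),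
    h2, hT.sum_dim_mul, hS.sum_dim_mul,
    hT.sum_mul hS hp.symm, h3, h4, B.dim_trivial', hT.apply_i₀ B, hS.apply_i₀ B] at h1
  norm_num at h1
  exact h1

theorem compat (hcard : Nat.card G = 95040) (hx : orderOf x = 11) {t : G} {M : ℕ} {T : Fin r → ℤ}
    (hT : IsPowerColumn e x t 2 M T) (hp : p ≠ 2) :
    compat B.degRow (B.row T) M (p - 1) N (B.row S) = true := by
  obtain ⟨k, -, hk⟩ := hS.exists_sc B hS hcard hx
  obtain ⟨l, -, hl⟩ := hT.exists_sc B hS hcard hx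
  norm_num at hl
  exact compat_eq_true hk hl (hS.gram_nonneg B hcard hT hp) (by positivity) (by positivity)

end IsPowerColumn
end GroupChar

namespace GroupChar
open Matrix Finset
open ColumnSearch
variable {G : Type*} [Group G] [Fintype G] [DecidableEq G] {r : ℕ} {d : Fin r → ℕ}
  [∀ i, NeZero (d i)] {e : Wedderburn G r d} {x h : G} {p N : ℕ} {S : Fin r → ℤ}

theorem two_dvd_of_isIntegral {n : ℤ} {z : ℂ} (hz : IsIntegral ℤ z) (h : (n : ℂ) = 2 * z) : 2 ∣ n := by
  obtain ⟨m, hm⟩ := exists_int_of_isIntegral hz (q := n / 2) (by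
    push_cast; rw [h]; ring)
  refine ⟨m, ?_⟩
  rw [hm] at h
  exact_mod_cast h

theorem column_orthogonality_of_orderOf_ne (e : Wedderburn G r d) {a b : G}
    (hab : orderOf a ≠ orderOf b) : ∑ i, chi e i a * chi e i b = 0 := by
  rw [column_orthogonality, Nat.cast_eq_zero, Finset.card_eq_zero, Finset.filter_eq_empty_iff]
  intro g _ h1
  apply hab
  have h2 := orderOf_injective (MulAut.conj g).toMonoidHom (MulAut.conj g).injective a
  rw [← h2, ← orderOf_inv b, ← eq_inv_of_mul_eq_one_left h1]
  rfl

namespace Block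
variable (B : Block e x)

theorem chi_p_eq_conj (hh : orderOf h ≠ orderOf x) :
    starRingEnd ℂ (chi e B.p h) = chi e B.p h := by
  have h1 := column_orthogonality_of_orderOf_ne e hh
  have h2 := column_orthogonality_of_orderOf_ne e (a := h) (b := x⁻¹) (by rwa [orderOf_inv])
  simp only [chi_inv] at h2
  have h3 : ∑ i, chi e i h * (chi e i x - starRingEnd ℂ (chi e i x)) = 0 := by
    simp only [mul_sub, Finset.sum_sub_distrib, h1, h2, sub_zero]
  rw [B.sum_split, Finset.sum_eq_zero (s := B.rest) (fun i hi => by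
    rw [rest, mem_filter] at hi
    rw [B.chi_else i hi.2.1 hi.2.2.1 hi.2.2.2.1 hi.2.2.2.2]
    simp)] at h3
  simp only [B.chi_i₀, B.chi_f, map_one, map_intCast, sub_self, mul_zero, sum_const_zero, zero_add,
    add_zero, B.chi_q, Complex.conj_conj] at h3
  have h4 : (chi e B.p h - starRingEnd ℂ (chi e B.p h)) *
      (chi e B.p x - starRingEnd ℂ (chi e B.p x)) = 0 := by
    linear_combination h3
  rcases mul_eq_zero.1 h4 with h5 | h5
  · exact (sub_eq_zero.1 h5).symm
  · exact absurd (sub_eq_zero.1 h5) B.chi_p_im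

theorem eq_f_of_chi_ne_zero {i : Fin r} (h0 : chi e i x ≠ 0) (h1 : i ≠ B.i₀)
    (hr : starRingEnd ℂ (chi e i x) = chi e i x) : ∃ j, i = B.f j := by
  by_contra hj
  push Not at hj
  by_cases hp : i = B.p
  · exact B.chi_p_im (hp ▸ hr.symm)
  by_cases hq : i = B.q
  · rw [hq, B.chi_q, Complex.conj_conj] at hr
    exact B.chi_p_im hr
  exact h0 (B.chi_else i h1 hp hq hj)

theorem chi_f_eq_conj {j : Fin 4} (hj : ∀ l, l ≠ j → B.F l ≠ B.F j) (g : G) :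
    starRingEnd ℂ (chi e (B.f j) g) = chi e (B.f j) g := by
  obtain ⟨k, hk⟩ := exists_dual e (B.f j)
  have h1 : chi e k x = B.c j := by rw [hk, B.chi_f, map_intCast]
  have h2 : k ≠ B.i₀ := by
    rintro rfl
    refine (B.f_ne j).1 (chi_injective e fun g => ?_)
    have := hk g
    rw [B.chi_i₀] at this ⊢
    rw [← Complex.conj_conj (chi e (B.f j) g), ← this, map_one]
  obtain ⟨l, rfl⟩ := B.eq_f_of_chi_ne_zero (by
    rw [h1, ← B.chi_f j]; exact B.chi_f_ne_zero j) h2 (by rw [h1, map_intCast])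
  have h3 : B.F l = B.F j := by
    have : B.c l = B.c j := by
      rw [B.chi_f] at h1
      exact_mod_cast h1
    rw [F, F, this, dim_eq_of_conj e hk]
  have h4 : l = j := by
    by_contra h4
    exact hj l h4 h3
  rw [← hk, h4]

end Block

namespace IsPowerColumn

theorem eq_two_mul (hS : IsPowerColumn e x h 3 N S) {i : Fin r}
    (hi : starRingEnd ℂ (chi e i h) = chi e i h) : (S i : ℂ) = 2 * chi e i h := by
  have h3 : h ^ 3 = 1 := by rw [← hS.order, pow_orderOf_eq_one]
  have h2 : h ^ 2 = h⁻¹ := by rw [eq_inv_iff_mul_eq_one, ← pow_succ, h3]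
  rw [hS.eq, powerSum_eq e i h (by norm_num), Finset.sum_Ico_eq_sum_range]
  simp only [Finset.sum_range_succ, Finset.sum_range_zero]
  norm_num
  rw [h2, chi_inv, hi]
  ring

theorem two_dvd_of_three (hS : IsPowerColumn e x h 3 N S) {i : Fin r}
    (hi : starRingEnd ℂ (chi e i h) = chi e i h) : 2 ∣ S i :=
  two_dvd_of_isIntegral (chi_isIntegral e i h) (hS.eq_two_mul hi)

theorem two_dvd_of_five (hS : IsPowerColumn e x h 5 N S) {g : G} (hg : g * h * g⁻¹ = h⁻¹)
    (i : Fin r) : 2 ∣ S i := by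
  refine two_dvd_of_isIntegral ((chi_isIntegral e i h).add (chi_isIntegral e i (h ^ 2))) ?_
  have h5 : h ^ 5 = 1 := by rw [← hS.order, pow_orderOf_eq_one]
  have h4 : h ^ 4 = g * h * g⁻¹ := by rw [hg, eq_inv_iff_mul_eq_one, ← pow_succ, h5]
  have h3 : h ^ 3 = g * h ^ 2 * g⁻¹ := by
    rw [← conj_pow, hg, inv_pow, eq_inv_iff_mul_eq_one, ← pow_add, h5]
  rw [hS.eq, powerSum_eq e i h (by norm_num), Finset.sum_Ico_eq_sum_range]
  simp only [Finset.sum_range_succ, Finset.sum_range_zero]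
  norm_num
  rw [h4, h3, chi_conj, chi_conj]
  ring

theorem searchThree_eq_false [IsSimpleGroup G] (hS : IsPowerColumn e x h 3 N S) (B : Block e x)
    (hcard : Nat.card G = 95040) (hx : orderOf x = 11) {t : G} {M : ℕ} {T : Fin r → ℤ}
    (hT : IsPowerColumn e x t 2 M T) : searchThree B.degRow (B.row T) M N = false := by
  have key : ∀ j : Fin 4, (∀ l, l ≠ j → B.F l ≠ B.F j) → 2 ∣ B.V S j := fun j hj =>
    (hS.two_dvd_of_three (B.chi_f_eq_conj hj h)).mul_left _
  refine ColumnSearch.searchThree_eq_false (hS.isCand B) (fun h1 h2 h3 => key 0 ?_)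
    (fun h1 h2 h3 => key 1 ?_) (fun h1 h2 h3 => key 2 ?_) (fun h1 h2 h3 => key 3 ?_)
    ((hS.two_dvd_of_three (B.chi_p_eq_conj (by rw [hS.order, hx]; norm_num))).mul_left _)
    (hS.compat B hcard hx hT (by norm_num))
  · intro l hl; fin_cases l
    exacts [absurd rfl hl, h1.symm, h2.symm, h3.symm]
  · intro l hl; fin_cases l
    exacts [h1.symm, absurd rfl hl, h2.symm, h3.symm]
  · intro l hl; fin_cases l
    exacts [h1.symm, h2.symm, absurd rfl hl, h3.symm]
  · intro l hl; fin_cases l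
    exacts [h1.symm, h2.symm, h3.symm, absurd rfl hl]

theorem searchFive_eq_false [IsSimpleGroup G] (hS : IsPowerColumn e x h 5 N S) (B : Block e x)
    (hcard : Nat.card G = 95040) (hx : orderOf x = 11) {t : G} {M : ℕ} {T : Fin r → ℤ}
    (hT : IsPowerColumn e x t 2 M T) {g : G} (hg : g * h * g⁻¹ = h⁻¹) :
    searchFive B.degRow (B.row T) M N = false := by
  have key := hS.two_dvd_of_five hg
  exact ColumnSearch.searchFive_eq_false (hS.isCand B) ((key _).mul_left _) ((key _).mul_left _)
    ((key _).mul_left _) ((key _).mul_left _) ((key _).mul_left _)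
    (hS.compat B hcard hx hT (by norm_num))

end IsPowerColumn
end GroupChar

namespace GroupChar
open Matrix Finset
open ColumnSearch
variable {G : Type*} [Group G] [Fintype G] [DecidableEq G] {r : ℕ} {d : Fin r → ℕ}
  [∀ i, NeZero (d i)] {e : Wedderburn G r d} {x t : G} {M : ℕ} {T : Fin r → ℤ}

namespace Block
variable (B : Block e x)

theorem degRow_mem [IsSimpleGroup G] (hcard : Nat.card G = 95040)
    (hG : ¬ ∀ a b : G, a * b = b * a) :
    (∀ j, B.F j ∈ degrees) ∧ B.E ∈ degreesPair := by
  have key : (∀ z ∈ Finset.Icc (-308 : ℤ) 308, z ∣ 8640 → 11 ∣ z - 1 → z ≠ 1 → z ∈ degrees) ∧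
      ∀ z ∈ Finset.Icc (-308 : ℤ) 308, z ∣ 8640 → 11 ∣ z - 6 → z ∈ degreesPair := by
    decide +kernel
  have hsum := B.sum_sq_degrees hcard
  have h0 : 0 ≤ ∑ i ∈ B.rest, (d i : ℤ) ^ 2 := Finset.sum_nonneg fun i _ => sq_nonneg _
  have hle : ∀ z : ℤ, z ^ 2 ≤ 95040 → z ∈ Finset.Icc (-308 : ℤ) 308 := fun z hz => by
    rw [Finset.mem_Icc]; constructor <;> nlinarith
  refine ⟨fun j => key.1 _ (hle _ ?_) (B.F_dvd j) (B.F_mod j) fun h => ?_,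
    key.2 _ (hle _ ?_) B.E_dvd B.E_mod⟩
  · have := Finset.single_le_sum (f := fun j => B.F j ^ 2) (fun _ _ => sq_nonneg _) (mem_univ j)
    have := sq_nonneg B.E
    linarith
  · have h1 := one_lt_dim e B.chi_i₀ (B.f_ne j).1 hG
    rcases sq_eq_one_iff.1 (B.c_sq j) with h2 | h2 <;> rw [F, h2] at h <;> omega
  · have : 0 ≤ ∑ j, B.F j ^ 2 := Finset.sum_nonneg fun j _ => sq_nonneg _
    have := sq_nonneg B.E
    linarith

theorem searchDegrees_degRow [IsSimpleGroup G] (hcard : Nat.card G = 95040) (hx : x ≠ 1)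
    (hG : ¬ ∀ a b : G, a * b = b * a) {P : Row → Bool} (h : searchDegrees P = true) :
    P B.degRow = true := by
  obtain ⟨hF, hE⟩ := B.degRow_mem hcard hG
  have hsum := B.sum_degrees hx
  rw [Fin.sum_univ_four] at hsum
  obtain ⟨k, hk⟩ := B.sum_sq_degrees_mod hcard
  rw [Fin.sum_univ_four] at hk
  have hdot : dot 1 1 B.degRow B.degRow =
      1 + (B.F 0 ^ 2 + B.F 1 ^ 2 + B.F 2 ^ 2 + B.F 3 ^ 2 + 2 * B.E ^ 2) := by
    simp only [dot, degRow, row, F, E, V, W]; ring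
  exact searchDegrees_sound h (hF 0) (hF 1) (hF 2) (hF 3) hE (B.mono (by decide))
    (B.mono (by decide)) (B.mono (by decide)) hsum (by rw [hdot]; linarith)
    ⟨k, by rw [hdot]; linarith⟩

end Block

/-- An element conjugate to no inverse of itself is not a product of two involutions. -/
theorem not_isPowerColumn_count (hr : ∀ g, g * x * g⁻¹ ≠ x⁻¹) (ht : orderOf t = 2) :
    #{c ∈ rationalClass t | c⁻¹ * x⁻¹ ∈ rationalClass t} = 0 := by
  rw [Finset.card_eq_zero, Finset.filter_eq_empty_iff]
  intro c hc h
  have hs : ∀ c ∈ rationalClass t, c * c = 1 := fun c hc => by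
    rw [← sq, ← orderOf_of_mem_rationalClass Nat.prime_two ht hc, pow_orderOf_eq_one]
  have h1 := hs _ hc
  have h2 := hs _ h
  refine hr c⁻¹ ?_
  rw [inv_eq_of_mul_eq_one_right h1] at h2 ⊢
  have h3 : (c * x⁻¹)⁻¹ = c * x⁻¹ := inv_eq_of_mul_eq_one_right h2
  rw [_root_.mul_inv_rev, _root_.inv_inv, inv_eq_of_mul_eq_one_right h1] at h3
  rw [inv_eq_of_mul_eq_one_right h1, mul_assoc, h3, ← mul_assoc, h1, one_mul]

theorem IsPowerColumn.test_eq_true [IsSimpleGroup G] (hT : IsPowerColumn e x t 2 M T)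
    (B : Block e x) (hcard : Nat.card G = 95040) (hx : orderOf x = 11)
    (hr : ∀ g, g * x * g⁻¹ ≠ x⁻¹) (hG : ¬ ∀ a b : G, a * b = b * a)
    (hM : (M : ℤ) ∈ ([64, 192, 576, 1728, 320, 960, 2880, 8640] : List ℤ)) :
    test B.degRow (B.row T) M = true := by
  have hx1 : x ≠ 1 := fun h => by rw [h, orderOf_one] at hx; norm_num at hx
  have h1 := B.searchDegrees_degRow hcard hx1 hG searchAll_eq_true
  have h2 := List.all_eq_true.1 h1 M hM
  have ht2 : t ^ 2 = 1 := by rw [← hT.order, pow_orderOf_eq_one]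
  have hchi : ∀ i, i ≠ B.i₀ → ∃ m : ℕ, T i = d i - 2 * m ∧ Even m ∧ 0 < m ∧ m < d i := fun i hi => by
    obtain ⟨m, hm, h⟩ := chi_involution e B.chi_i₀ hi hG ht2 hT.ne_one
    refine ⟨m, ?_, h⟩
    have h3 := hT.eq i
    rw [powerSum_eq e i t (by norm_num)] at h3
    simp only [Nat.Ico_succ_singleton, Finset.sum_singleton, pow_one, hm] at h3
    exact_mod_cast h3
  have hcand : ∀ i, i ≠ B.i₀ → ∀ c n : ℤ, c ^ 2 = 1 → (c * T i) ^ 2 ≤ M → c * d i ∣ n * (c * T i) →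
      c * T i ∈ candTwo n M (c * d i) := fun i hi c n hc hR hn => by
    obtain ⟨m, hm, he, h0, hlt⟩ := hchi i hi
    rw [hm] at hR hn ⊢
    exact mem_candTwo hc h0 hlt he hR hn
  have hb := hT.norm_bound B
  norm_num at hb
  have hV : ∀ j, B.V T j ∈ candTwo (95040 / M) M (B.F j) := fun j =>
    hcand _ (B.f_ne j).1 _ _ (B.c_sq j) (hb.1 j) (hT.natCast_div ▸ hT.column.F_dvd B j)
  obtain ⟨m, hm, hsc⟩ := hT.exists_sc B hT hcard hx
  rw [not_isPowerColumn_count hr hT.order] at hm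
  obtain rfl : m = 0 := by omega
  norm_num at hsc
  have hsum := hT.sum_eq_zero B
  norm_num at hsum
  have hdot := hT.dot_le B
  norm_num at hdot
  refine searchTwo_sound h2 (hV 0) (hV 1) (hV 2) (hV 3)
    (hcand _ B.p_ne _ _ B.a_sq hb.2 (hT.natCast_div ▸ hT.column.E_dvd B)) hsum hdot hsc ?_
  have hd : ((d B.q : ℕ) : ℤ) = d B.p := by rw [B.dim_q]
  have h3 : ∑ i, (d i : ℤ) * d i = 95040 := by
    have := sum_dim_chi e 1
    simp only [chi_one, if_true] at this
    rw [← Nat.card_eq_fintype_card, hcard] at this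
    exact_mod_cast this
  have h4 := hT.sum_sq
  norm_num at h4
  simp only [sq] at h4
  have hq := hT.apply_q B
  have e1 := B.sum_mul (fun i => (d i : ℤ)) (fun i => (d i : ℤ)) hd hd
  have e2 := B.sum_mul (fun i => (d i : ℤ)) T hd hq
  have e3 := B.sum_mul T T hq hq
  have hi : T B.i₀ = 1 := by rw [hT.apply_i₀ B]; norm_num
  simp only [h3, h4, hT.sum_dim_mul, hi, B.dim_trivial'] at e1 e2 e3
  set A := 95040 - dot 1 1 B.degRow B.degRow
  set D := dot 1 1 B.degRow (B.row T)
  have h5 : ∑ i ∈ B.rest, (D * d i + A * T i) ^ 2 = D ^ 2 * A - 2 * A * D ^ 2 +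
      A ^ 2 * (M - dot 1 1 (B.row T) (B.row T)) := by
    have : ∀ i, (D * (d i : ℤ) + A * T i) ^ 2 = D ^ 2 * (d i * d i) + 2 * D * A * (d i * T i) +
      A ^ 2 * (T i * T i) := fun i => by ring
    simp only [this, Finset.sum_add_distrib, ← Finset.mul_sum]
    rw [e1, e2, e3]
    show D ^ 2 * A + 2 * D * A * (0 - D) + _ = _
    ring
  rw [← h5]
  exact Finset.sum_nonneg fun i _ => sq_nonneg _

end GroupChar

namespace LocalSubgroup
open Subgroup
variable {G : Type*} [Group G]

theorem centralizer_le_normalizer_zpowers (h : G) :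
    centralizer {h} ≤ normalizer (zpowers h : Set G) := fun g hg => by
  rw [Subgroup.mem_normalizer_iff]
  have hgh : g * h * g⁻¹ = h := by
    rw [mem_centralizer_singleton_iff.1 hg, mul_inv_cancel_right]
  intro z
  constructor
  · rintro ⟨k, rfl⟩
    exact ⟨k, by simp only; rw [← conj_zpow, hgh]⟩
  · rintro ⟨k, hk⟩
    refine ⟨k, ?_⟩
    simp only at hk ⊢
    have h1 : g⁻¹ * h * g⁻¹⁻¹ = h := by
      calc g⁻¹ * h * g⁻¹⁻¹ = g⁻¹ * (g * h * g⁻¹) * g⁻¹⁻¹ := by rw [hgh]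
        _ = h := by group
    rw [show z = g⁻¹ * (g * z * g⁻¹) * g⁻¹⁻¹ by group, ← hk, ← conj_zpow, h1]

theorem mem_normalizer_zpowers {g h : G} (hg : g ∈ normalizer (zpowers h : Set G)) :
    ∃ k : ℤ, g * h * g⁻¹ = h ^ k := by
  obtain ⟨k, hk⟩ := (Subgroup.mem_normalizer_iff.1 hg h).1 (mem_zpowers h)
  exact ⟨k, hk.symm⟩

theorem conj_pow_eq {g h : G} {k : ℤ} (hk : g * h * g⁻¹ = h ^ k) (n : ℕ) :
    g ^ n * h * (g ^ n)⁻¹ = h ^ k ^ n := by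
  induction n with
  | zero => simp
  | succ n ih =>
    rw [pow_succ' g, mul_inv_rev, show g * g ^ n * h * ((g ^ n)⁻¹ * g⁻¹) =
      g * (g ^ n * h * (g ^ n)⁻¹) * g⁻¹ by group, ih, ← conj_zpow, hk, ← zpow_mul, pow_succ', mul_comm]

theorem zpow_eq_zpow_iff_zmod {h : G} {p : ℕ} (hh : orderOf h = p) (a b : ℤ) :
    h ^ a = h ^ b ↔ (a : ZMod p) = b := by
  rw [zpow_eq_zpow_iff_modEq, hh, ZMod.intCast_eq_intCast_iff]

theorem commute_of_coprime {g h : G} {p : ℕ} (hp : p.Prime) (hh : orderOf h = p)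
    (hg : g ∈ normalizer (zpowers h : Set G)) (hc : (orderOf g).Coprime (p - 1)) : Commute g h := by
  haveI : Fact p.Prime := ⟨hp⟩
  obtain ⟨k, hk⟩ := mem_normalizer_zpowers hg
  have h1 := conj_pow_eq hk (orderOf g)
  rw [pow_orderOf_eq_one, one_mul, inv_one, mul_one] at h1
  nth_rewrite 1 [← zpow_one h] at h1
  rw [zpow_eq_zpow_iff_zmod hh] at h1
  push_cast at h1
  have hk0 : (k : ZMod p) ≠ 0 := fun h0 => by
    have : g * h * g⁻¹ = 1 := by
      rw [hk, ← zpow_zero h, zpow_eq_zpow_iff_zmod hh, h0, Int.cast_zero]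
    rw [conj_eq_one_iff] at this
    rw [this, orderOf_one] at hh
    exact hp.one_lt.ne hh
  have h2 := ZMod.pow_card_sub_one_eq_one hk0
  have h3 : orderOf (k : ZMod p) = 1 :=
    Nat.dvd_one.1 (hc ▸ Nat.dvd_gcd (orderOf_dvd_of_pow_eq_one h1.symm) (orderOf_dvd_of_pow_eq_one h2))
  rw [orderOf_eq_one_iff] at h3
  have : g * h * g⁻¹ = h := by
    rw [hk]
    nth_rewrite 2 [← zpow_one h]
    rw [zpow_eq_zpow_iff_zmod hh, h3, Int.cast_one]
  exact mul_inv_eq_iff_eq_mul.1 this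

variable [Finite G]

theorem exists_sylow_eq {p k : ℕ} [Fact p.Prime] {H : Subgroup G} (hH : Nat.card H = p ^ k)
    (hG : ¬ p ^ (k + 1) ∣ Nat.card G) : ∃ P : Sylow p G, (P : Subgroup G) = H := by
  obtain ⟨P, hP⟩ := (IsPGroup.of_card hH).exists_le_sylow
  refine ⟨P, (eq_of_le_of_card_ge hP ?_).symm⟩
  obtain ⟨j, hj⟩ := IsPGroup.iff_card.1 P.2
  rw [hj, hH]
  refine Nat.pow_le_pow_right (Fact.out : p.Prime).pos ?_
  by_contra h
  exact hG ((pow_dvd_pow p (by omega)).trans (hj ▸ card_subgroup_dvd_card _))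

theorem exists_orderOf_of_dvd {p : ℕ} [Fact p.Prime] {H : Subgroup G} (hp : p ∣ Nat.card H) :
    ∃ z ∈ H, orderOf z = p := by
  obtain ⟨z, hz⟩ := exists_prime_orderOf_dvd_card' p hp
  exact ⟨z, z.2, by rw [← hz, orderOf_coe]⟩

theorem eleven_not_dvd_normalizer (hcard : Nat.card G = 95040) {x h : G} {p : ℕ}
    (hx : orderOf x = 11) (hC : Nat.card (centralizer {x}) = 11) (hp : p.Prime) (hp11 : p < 11)
    (hh : orderOf h = p) : ¬ 11 ∣ Nat.card (normalizer (zpowers h : Set G)) := by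
  intro hd
  haveI : Fact (Nat.Prime 11) := ⟨by norm_num⟩
  obtain ⟨z, hzN, hz⟩ := exists_orderOf_of_dvd hd
  have hzh : Commute z h := commute_of_coprime hp hh hzN (by
    rw [hz, Nat.Prime.coprime_iff_not_dvd (by norm_num)]
    intro h
    have := Nat.le_of_dvd (by have := hp.two_le; omega) h
    omega)
  have hcyc : ∀ w : G, orderOf w = 11 → ∃ P : Sylow 11 G, (P : Subgroup G) = zpowers w := fun w hw =>
    exists_sylow_eq (k := 1) (by rw [Nat.card_zpowers, hw, pow_one]) (by rw [hcard]; norm_num)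
  obtain ⟨P, hP⟩ := hcyc z hz
  obtain ⟨Q, hQ⟩ := hcyc x hx
  obtain ⟨g, hg⟩ := MulAction.exists_smul_eq G P Q
  have hxP : g⁻¹ * x * g ∈ zpowers z := by
    have h1 : x ∈ (g • P : Sylow 11 G) := by
      rw [hg]; show x ∈ (Q : Subgroup G); rw [hQ]; exact mem_zpowers x
    have h2 : x ∈ ((g • P : Sylow 11 G) : Subgroup G) := h1
    rw [Sylow.coe_subgroup_smul, Subgroup.mem_pointwise_smul_iff_inv_smul_mem, hP] at h2
    simpa [MulAut.smul_def, ← map_inv] using h2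
  obtain ⟨k, hk⟩ := hxP
  have h3 : Commute (g⁻¹ * x * g) h := by
    simp only at hk
    rw [← hk]; exact hzh.zpow_left k
  have h4 : g * h * g⁻¹ ∈ centralizer {x} := by
    rw [mem_centralizer_singleton_iff]
    have := h3.eq
    calc g * h * g⁻¹ * x = g * (h * (g⁻¹ * x * g)) * g⁻¹ := by group
      _ = g * (g⁻¹ * x * g * h) * g⁻¹ := by rw [this]
      _ = x * (g * h * g⁻¹) := by group
  have h5 := orderOf_dvd_natCard _ h4
  have h6 : orderOf (g * h * g⁻¹) = orderOf h :=
    orderOf_injective (MulAut.conj g).toMonoidHom (MulAut.conj g).injective h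
  rw [h6, hh, hC] at h5
  have := (Nat.prime_dvd_prime_iff_eq hp (by norm_num)).1 h5
  omega

theorem normalizer_dvd (hcard : Nat.card G = 95040) {x h : G} {p : ℕ}
    (hx : orderOf x = 11) (hC : Nat.card (centralizer {x}) = 11) (hp : p.Prime) (hp11 : p < 11)
    (hh : orderOf h = p) : Nat.card (normalizer (zpowers h : Set G)) ∣ 8640 := by
  have h1 : Nat.card (normalizer (zpowers h : Set G)) ∣ 11 * 8640 := by
    have := hcard ▸ card_subgroup_dvd_card (normalizer (zpowers h : Set G))
    norm_num; exact this
  exact (((Nat.Prime.coprime_iff_not_dvd (by norm_num)).2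
    (eleven_not_dvd_normalizer hcard hx hC hp hp11 hh)).symm).dvd_of_dvd_mul_left h1

theorem card_centralizer_dvd (h : G) :
    Nat.card (centralizer {h}) ∣ Nat.card (normalizer (zpowers h : Set G)) :=
  card_dvd_of_le (centralizer_le_normalizer_zpowers h)

theorem exists_central {p k : ℕ} [Fact p.Prime] (hk : k ≠ 0) {P : Subgroup G}
    (hP : Nat.card P = p ^ k) : ∃ h ∈ P, orderOf h = p ∧ P ≤ centralizer {h} := by
  have hPp := IsPGroup.of_card hP
  have htop : (⊤ : Subgroup P) ≠ ⊥ := by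
    intro h
    have := congrArg (fun H : Subgroup P => Nat.card H) h
    simp only [card_top, card_bot, hP] at this
    exact (Nat.one_lt_pow hk (Fact.out : p.Prime).one_lt).ne' this
  obtain ⟨t, -, ht, hc⟩ := FixCount.exists_orderOf_mem_center hPp (normal_of_characteristic ⊤) htop
  refine ⟨t, t.2, by rw [orderOf_coe, ht], fun z hz => ?_⟩
  rw [mem_centralizer_singleton_iff]
  exact congrArg Subtype.val (hc ⟨z, hz⟩).eq

theorem exists_pow_dvd_centralizer {p k : ℕ} [Fact p.Prime] (hk : k ≠ 0) (hG : p ^ k ∣ Nat.card G) :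
    ∃ h : G, orderOf h = p ∧ p ^ k ∣ Nat.card (centralizer {h}) := by
  obtain ⟨P, hP⟩ := Sylow.exists_subgroup_card_pow_prime p hG
  obtain ⟨h, -, hh, hle⟩ := exists_central hk hP
  exact ⟨h, hh, hP ▸ card_dvd_of_le hle⟩

theorem sq_dvd_centralizer {p : ℕ} [Fact p.Prime] (hG : p ^ 2 ∣ Nat.card G)
    {s : G} (hs : orderOf s = p) : p ^ 2 ∣ Nat.card (centralizer {s}) := by
  obtain ⟨P, hP, hle⟩ := Sylow.exists_subgroup_card_pow_succ (p := p) (n := 1) (H := zpowers s)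
    hG (by rw [Nat.card_zpowers, hs, pow_one])
  have hs' : s ∈ P := hle (mem_zpowers s)
  have hcomm := (IsPGroup.isMulCommutative_of_card_eq_prime_sq hP).is_comm.comm
  have : P ≤ centralizer {s} := fun z hz => by
    rw [mem_centralizer_singleton_iff]
    exact congrArg Subtype.val (hcomm ⟨z, hz⟩ ⟨s, hs'⟩)
  exact hP ▸ card_dvd_of_le this

end LocalSubgroup

namespace LocalSubgroup
open Subgroup
variable {G : Type*} [Group G] [Finite G]

theorem exists_real_of_order_five [IsSimpleGroup G] (hcard : Nat.card G = 95040) {r : G}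
    (hr : orderOf r = 5) : ∃ g, g * r * g⁻¹ = r⁻¹ := by
  have key : ∀ z : ZMod 5, z ≠ 1 → z ≠ 0 → z = -1 ∨ z ^ 2 = -1 := by decide
  haveI : Fact (Nat.Prime 5) := ⟨by norm_num⟩
  obtain ⟨P, hP⟩ := exists_sylow_eq (p := 5) (k := 1) (H := zpowers r)
    (by rw [Nat.card_zpowers, hr, pow_one]) (by rw [hcard]; norm_num)
  have hPc : Nat.card P = 5 := by
    show Nat.card (P : Subgroup G) = 5
    rw [hP, Nat.card_zpowers, hr]
  haveI : Fact (Nat.Prime 11) := ⟨by norm_num⟩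
  have h1 := FixCount.not_normalizer_le_centralizer P (by omega) (by omega)
  rw [show (P : Set G) = (zpowers r : Set G) from
    congrArg (fun H : Subgroup G => (H : Set G)) hP] at h1
  obtain ⟨g, hg, hgc⟩ := Set.not_subset.1 h1
  obtain ⟨k, hk⟩ := mem_normalizer_zpowers hg
  have h2 := conj_pow_eq hk 2
  have hk1 : (k : ZMod 5) ≠ 1 := fun h => hgc <| by
    have h3 : g * r * g⁻¹ = r := by
      rw [hk]
      nth_rewrite 2 [← zpow_one r]
      rw [zpow_eq_zpow_iff_zmod hr, h, Int.cast_one]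
    rw [SetLike.mem_coe, mem_centralizer_iff]
    rintro _ ⟨m, rfl⟩
    have h4 : Commute g r := mul_inv_eq_iff_eq_mul.1 h3
    exact (h4.zpow_right m).eq.symm
  have hk0 : (k : ZMod 5) ≠ 0 := fun h0 => by
    have : g * r * g⁻¹ = 1 := by
      rw [hk, ← zpow_zero r, zpow_eq_zpow_iff_zmod hr, h0, Int.cast_zero]
    rw [conj_eq_one_iff] at this
    rw [this, orderOf_one] at hr
    norm_num at hr
  rcases key _ hk1 hk0 with h | h
  · refine ⟨g, ?_⟩
    rw [hk, ← zpow_neg_one, zpow_eq_zpow_iff_zmod hr, h]; simp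
  · refine ⟨g ^ 2, ?_⟩
    rw [h2, ← zpow_neg_one, zpow_eq_zpow_iff_zmod hr]; push_cast; rw [h]

theorem mem_normalizer_of_conj_eq_inv {g y : G} (hg : g * y * g⁻¹ = y⁻¹) :
    g ∈ normalizer (zpowers y : Set G) := by
  have : ∀ k : ℤ, g * y ^ k * g⁻¹ = y ^ (-k) := fun k => by
    rw [← conj_zpow, hg, inv_zpow, zpow_neg]
  rw [Subgroup.mem_normalizer_iff]
  intro z
  constructor
  · rintro ⟨k, rfl⟩
    exact ⟨-k, (this k).symm⟩
  · rintro ⟨k, hk⟩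
    refine ⟨-k, ?_⟩
    have h1 := this (-k)
    rw [neg_neg, show y ^ k = g * z * g⁻¹ from hk] at h1
    exact mul_left_cancel (mul_right_cancel h1)

theorem two_dvd_normalizer {p : ℕ} (hp : p.Prime) (hp2 : p ≠ 2) {h g : G} (hh : orderOf h = p)
    (hg : g * h * g⁻¹ = h⁻¹) : 2 ∣ Nat.card (normalizer (zpowers h : Set G)) := by
  have hgN := mem_normalizer_of_conj_eq_inv hg
  refine dvd_trans ?_ (orderOf_dvd_natCard _ hgN)
  by_contra h2
  have h3 := conj_pow_eq (g := g) (h := h) (k := -1) (by rw [hg, zpow_neg_one]) (orderOf g)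
  rw [pow_orderOf_eq_one, one_mul, inv_one, mul_one, Odd.neg_one_pow (by
    rw [← Nat.not_even_iff_odd]; exact fun h => h2 h.two_dvd), zpow_neg_one] at h3
  have h4 : h ^ 2 = 1 := by
    rw [sq]; nth_rewrite 2 [h3]; exact mul_inv_cancel h
  have h5 := orderOf_dvd_of_pow_eq_one h4
  rw [hh] at h5
  exact hp2 ((Nat.prime_dvd_prime_iff_eq hp Nat.prime_two).1 h5)

theorem card_normalizer_order_five [IsSimpleGroup G] (hcard : Nat.card G = 95040) {x r : G}
    (hx : orderOf x = 11) (hC : Nat.card (centralizer {x}) = 11) (hr : orderOf r = 5) :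
    Nat.card (normalizer (zpowers r : Set G)) ∈ [40, 90, 540, 240, 1440, 8640] := by
  haveI : Fact (Nat.Prime 5) := ⟨by norm_num⟩
  set N := Nat.card (normalizer (zpowers r : Set G)) with hN
  have h1 : N ∣ 8640 := normalizer_dvd hcard hx hC (by norm_num) (by norm_num) hr
  obtain ⟨g, hg⟩ := exists_real_of_order_five hcard hr
  have h2 : 2 ∣ N := two_dvd_normalizer (by norm_num) (by norm_num) hr hg
  have h3 : 5 ∣ N := by
    have := card_dvd_of_le (Subgroup.le_normalizer (H := zpowers r))
    rwa [Nat.card_zpowers, hr] at this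
  obtain ⟨P, hP⟩ := exists_sylow_eq (p := 5) (k := 1) (H := zpowers r)
    (by rw [Nat.card_zpowers, hr, pow_one]) (by rw [hcard]; norm_num)
  have h4 := card_sylow_modEq_one 5 G
  rw [P.card_eq_index_normalizer, show (P : Set G) = (zpowers r : Set G) from
    congrArg (fun H : Subgroup G => (H : Set G)) hP] at h4
  have h5 : N * (normalizer (zpowers r : Set G)).index = 95040 := hcard ▸ card_mul_index _
  have h6 : 95040 / N % 5 = 1 := by
    rw [← h5, Nat.mul_div_cancel_left _ (Nat.pos_of_dvd_of_pos h1 (by norm_num))]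
    exact h4
  obtain ⟨m, hm⟩ := h2
  obtain ⟨k, rfl⟩ : 5 ∣ m := by omega
  have h7 : k ∣ 864 := by
    rw [hm] at h1
    have : 10 * k ∣ 10 * 864 := by convert h1 using 1; ring
    exact Nat.dvd_of_mul_dvd_mul_left (by norm_num) this
  rw [hm] at h6 ⊢
  have key : ∀ k ∈ Nat.divisors 864, 95040 / (2 * (5 * k)) % 5 = 1 →
    2 * (5 * k) ∈ [40, 90, 540, 240, 1440, 8640] := by decide +kernel
  exact key k (by simp [h7]) h6

theorem eq_or_eq_inv_of_mem_normalizer {g y : G} (hy : orderOf y = 3)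
    (hg : g ∈ normalizer (zpowers y : Set G)) : g * y * g⁻¹ = y ∨ g * y * g⁻¹ = y⁻¹ := by
  have key : ∀ z : ZMod 3, z = 0 ∨ z = 1 ∨ z = -1 := by decide
  obtain ⟨k, hk⟩ := mem_normalizer_zpowers hg
  rcases key k with h | h | h
  · have : g * y * g⁻¹ = 1 := by
      rw [hk, ← zpow_zero y, zpow_eq_zpow_iff_zmod hy, h, Int.cast_zero]
    rw [conj_eq_one_iff] at this
    rw [this, orderOf_one] at hy
    norm_num at hy
  · left
    rw [hk]
    nth_rewrite 2 [← zpow_one y]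
    rw [zpow_eq_zpow_iff_zmod hy, h, Int.cast_one]
  · right
    rw [hk, ← zpow_neg_one, zpow_eq_zpow_iff_zmod hy, h]
    simp

theorem normalizer_eq_centralizer {y : G} (hy : orderOf y = 3) (hr : ∀ g, g * y * g⁻¹ ≠ y⁻¹) :
    normalizer (zpowers y : Set G) = centralizer {y} :=
  le_antisymm (fun g hg => mem_centralizer_singleton_iff.2 (mul_inv_eq_iff_eq_mul.1
    ((eq_or_eq_inv_of_mem_normalizer hy hg).resolve_right (hr g))))
    (centralizer_le_normalizer_zpowers y)

theorem card_normalizer_of_real {g y : G} (hy : orderOf y = 3) (hg : g * y * g⁻¹ = y⁻¹) :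
    Nat.card (normalizer (zpowers y : Set G)) = 2 * Nat.card (centralizer {y}) := by
  have hgN := mem_normalizer_of_conj_eq_inv hg
  have hle := centralizer_le_normalizer_zpowers y
  have hy2 : y ≠ y⁻¹ := fun h => by
    have h2 : y ^ 2 = 1 := by rw [sq]; nth_rewrite 2 [h]; exact mul_inv_cancel y
    have := orderOf_dvd_of_pow_eq_one h2
    rw [hy] at this
    norm_num at this
  have hC : ∀ b : G, b ∈ centralizer {y} ↔ b * y * b⁻¹ = y := fun b => by
    rw [mem_centralizer_singleton_iff, mul_inv_eq_iff_eq_mul]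
  have h2 : ((centralizer {y}).subgroupOf (normalizer (zpowers y : Set G))).index = 2 := by
    rw [index_eq_two_iff]
    refine ⟨⟨g, hgN⟩, fun ⟨b, hb⟩ => ?_⟩
    simp only [mem_subgroupOf, coe_mul, hC]
    have h3 : b * g * y * (b * g)⁻¹ = (b * y * b⁻¹)⁻¹ := by
      calc b * g * y * (b * g)⁻¹ = b * (g * y * g⁻¹) * b⁻¹ := by group
        _ = _ := by rw [hg]; group
    rw [h3]
    rcases eq_or_eq_inv_of_mem_normalizer hy hb with h | h <;> rw [h] <;>
      simp [Xor', hy2, hy2.symm]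
  have h3 := card_mul_index ((centralizer {y}).subgroupOf (normalizer (zpowers y : Set G)))
  rw [h2, Nat.card_congr (subgroupOfEquivOfLe hle).toEquiv] at h3
  omega

theorem mem_list_of_dvd {a b N : ℕ} {l : List ℤ} (ha : 0 < a) (hb : b ≠ 0) (h1 : a ∣ N)
    (h2 : N ∣ a * b) (hl : ∀ k ∈ Nat.divisors b, ((a * k : ℕ) : ℤ) ∈ l) : (N : ℤ) ∈ l := by
  obtain ⟨k, rfl⟩ := h1
  exact hl k (by simp [Nat.dvd_of_mul_dvd_mul_left ha h2, hb])

end LocalSubgroup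

namespace GroupChar
open Matrix Finset
open ColumnSearch LocalSubgroup
variable {G : Type*} [Group G] [Fintype G] [DecidableEq G] {r : ℕ} {d : Fin r → ℕ}
  [∀ i, NeZero (d i)]

theorem exists_involution_column [IsSimpleGroup G] (e : Wedderburn G r d) {x : G} (B : Block e x)
    (hcard : Nat.card G = 95040)
    (hx : orderOf x = 11) (hC : Nat.card (Subgroup.centralizer {x}) = 11)
    (hr : ∀ g, g * x * g⁻¹ ≠ x⁻¹) (hG : ¬ ∀ a b : G, a * b = b * a) :
    ∃ t M T, IsPowerColumn e x t 2 M T ∧ test B.degRow (B.row T) M = true := by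
  haveI : Fact (Nat.Prime 2) := ⟨by norm_num⟩
  obtain ⟨t, ht, h64⟩ := exists_pow_dvd_centralizer (G := G) (p := 2) (k := 6) (by norm_num)
    (by rw [hcard]; norm_num)
  obtain ⟨T, hT⟩ := exists_isPowerColumn (x := x) e hcard hC Nat.prime_two (by norm_num) ht
  refine ⟨t, _, T, hT, hT.test_eq_true B hcard hx hr hG ?_⟩
  exact mem_list_of_dvd (a := 64) (b := 135) (by norm_num) (by norm_num)
    (h64.trans (card_centralizer_dvd t))
    (normalizer_dvd hcard hx hC Nat.prime_two (by norm_num) ht) (by decide +kernel)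

/-- The alternative between the degrees of the Mathieu group and those excluded by decomposing
tensor products. -/
theorem isTensor_or_isM12 [IsSimpleGroup G] {e : Wedderburn G r d} {x t : G} {M : ℕ}
    {T : Fin r → ℤ} (B : Block e x) (hcard : Nat.card G = 95040)
    (hx : orderOf x = 11) (hC : Nat.card (Subgroup.centralizer {x}) = 11)
    (hT : IsPowerColumn e x t 2 M T) (htest : test B.degRow (B.row T) M = true) :
    isTensor B.degRow (B.row T) = true ∨ ∀ y : G, orderOf y = 3 →
      27 ∣ Nat.card (Subgroup.centralizer {y}) → isM12 B.degRow = true ∧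
        Nat.card (Subgroup.normalizer (Subgroup.zpowers y : Set G)) = 108 := by
  haveI : Fact (Nat.Prime 3) := ⟨by norm_num⟩
  haveI : Fact (Nat.Prime 5) := ⟨by norm_num⟩
  have three : ∀ y : G, orderOf y = 3 → searchThree B.degRow (B.row T) M
      (Nat.card (Subgroup.normalizer (Subgroup.zpowers y : Set G))) = false := fun y hy => by
    obtain ⟨S, hS⟩ := exists_isPowerColumn (x := x) e hcard hC Nat.prime_three (by norm_num) hy
    exact hS.searchThree_eq_false B hcard hx hT
  rw [test, Bool.or_eq_true, Bool.and_eq_true] at htest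
  refine htest.imp_right fun ⟨h1, h2⟩ => ?_
  obtain ⟨s, hs⟩ := exists_prime_orderOf_dvd_card' (G := G) 5 (by rw [hcard]; norm_num)
  obtain ⟨g, hg⟩ := exists_real_of_order_five hcard hs
  obtain ⟨S, hS⟩ := exists_isPowerColumn (x := x) e hcard hC (by norm_num : Nat.Prime 5)
    (by norm_num) hs
  have h5 := hS.searchFive_eq_false B hcard hx hT hg
  have hN : Nat.card (Subgroup.normalizer (Subgroup.zpowers s : Set G)) = 40 := by
    have hmem := card_normalizer_order_five hcard hx hC hs
    set N := Nat.card (Subgroup.normalizer (Subgroup.zpowers s : Set G)) with hN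
    rcases List.mem_cons.1 hmem with h40 | hmem
    · exact h40
    · exfalso
      have h3 : 3 ∣ N := by
        simp only [List.mem_cons, List.not_mem_nil, or_false] at hmem
        omega
      have h540 : (N : ℤ) ∈ ([90, 540, 240, 1440, 8640] : List ℤ) := by
        simp only [List.mem_cons, List.not_mem_nil, or_false] at hmem ⊢
        omega
      obtain ⟨z, hzN, hz⟩ := exists_orderOf_of_dvd h3
      have hzs : Commute z s := commute_of_coprime (by norm_num) hs hzN (by rw [hz]; norm_num)
      have h5z : 5 ∣ Nat.card (Subgroup.centralizer {z}) := hs ▸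
        Subgroup.orderOf_dvd_natCard _ (Subgroup.mem_centralizer_singleton_iff.2 hzs.eq.symm)
      have h9z := sq_dvd_centralizer (p := 3) (by rw [hcard]; norm_num) hz
      have h45 : 45 ∣ Nat.card (Subgroup.normalizer (Subgroup.zpowers z : Set G)) :=
        (Nat.Coprime.mul_dvd_of_dvd_of_dvd (m := 5) (n := 9) (by norm_num) h5z (by simpa using h9z)).trans
          (card_centralizer_dvd z)
      rw [Bool.or_eq_true] at h1
      rcases h1 with h1 | h1
      · have := List.all_eq_true.1 h1 _ (mem_list_of_dvd (a := 45) (b := 192) (by norm_num)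
          (by norm_num) h45 (normalizer_dvd hcard hx hC Nat.prime_three (by norm_num) hz)
          (by decide +kernel))
        rw [three z hz] at this
        exact Bool.false_ne_true this
      · have := List.all_eq_true.1 h1 _ h540
        rw [h5] at this
        exact Bool.false_ne_true this
  rw [hN] at h5
  intro y hy h27
  rw [show ((40 : ℕ) : ℤ) = 40 from rfl] at h5
  rw [h5, Bool.false_or] at h2
  have h4 := List.all_eq_true.1 h2 _ (mem_list_of_dvd (a := 27) (b := 320) (by norm_num)
    (by norm_num) (h27.trans (card_centralizer_dvd y))
    (normalizer_dvd hcard hx hC Nat.prime_three (by norm_num) hy) (by decide +kernel))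
  rw [three y hy, Bool.false_or, Bool.and_eq_true, beq_iff_eq] at h4
  exact ⟨h4.1, by exact_mod_cast h4.2⟩

end GroupChar

namespace GroupChar
open Matrix Finset
open ColumnSearch LocalSubgroup
variable {G : Type*} [Group G] [Fintype G] [DecidableEq G] {r : ℕ} {d : Fin r → ℕ}
  [∀ i, NeZero (d i)] {e : Wedderburn G r d} {x y : G} {S : Fin r → ℤ}

theorem eq_of_norm_le {a b c v w m : ℤ} (t0 : 2 ∣ a) (t1 : 2 ∣ b) (t2 : 2 ∣ c) (t3 : 2 ∣ v)
    (t4 : 2 ∣ w) (k0 : 120 ∣ 880 * a) (k1 : 54 ∣ 880 * b) (k2 : 45 ∣ 880 * c)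
    (k3 : 144 ∣ 880 * v) (k4 : 16 ∣ 880 * w) (n0 : a ^ 2 ≤ 216) (n1 : b ^ 2 ≤ 216)
    (n2 : c ^ 2 ≤ 216) (n3 : v ^ 2 ≤ 216) (n4 : w ^ 2 ≤ 216) (hsum : 2 + (a + b + c + v + w) = 0)
    (hdot : 4 + (a * a + b * b + c * c + v * v + 2 * (w * w)) ≤ 216)
    (hsc : 34560 + (-(a * a * 72) + -(b * b * 160) + c * c * 192 + v * v * 60 + -(w * w * 540)) =
      11664 * m) : a = -6 ∧ b = 0 ∧ c = 0 ∧ v = 0 ∧ w = 4 := by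
  have hbd : ∀ z : ℤ, z ^ 2 ≤ 216 → -14 ≤ z ∧ z ≤ 14 := fun z hz => by
    constructor <;> nlinarith
  have m0 := hbd _ n0; have m1 := hbd _ n1; have m2 := hbd _ n2; have m3 := hbd _ n3
  have m4 := hbd _ n4
  obtain rfl : b = 0 := by omega
  obtain rfl : c = 0 := by omega
  obtain rfl : v = 0 := by omega
  obtain rfl : a = -2 - w := by omega
  clear n0 n1 n2 n3 n4 t0 t1 t2 t3 k1 k2 k3 k4
  obtain ⟨u, rfl⟩ := t4
  have : -7 ≤ u ∧ u ≤ 7 := by omega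
  obtain ⟨h7, h8⟩ := this
  interval_cases u <;> omega

theorem IsPowerColumn.row_of_isM12 (hS : IsPowerColumn e x y 3 108 S)
    (B : Block e x) (hcard : Nat.card G = 95040) (hx : orderOf x = 11)
    (hf : isM12 B.degRow = true) :
    (∀ i, chi e i x ≠ 0 → starRingEnd ℂ (chi e i y) = chi e i y) ∧
      B.row S = ⟨-6, 0, 0, 0, 4⟩ := by
  simp only [isM12, Bool.and_eq_true, beq_iff_eq] at hf
  obtain ⟨⟨⟨⟨ha, hb⟩, hc⟩, hd⟩, hw⟩ := hf
  have e0 : B.F 0 = -120 := ha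
  have e1 : B.F 1 = -54 := hb
  have e2 : B.F 2 = 45 := hc
  have e3 : B.F 3 = 144 := hd
  have e4 : B.E = -16 := hw
  have hreal : ∀ j, starRingEnd ℂ (chi e (B.f j) y) = chi e (B.f j) y := fun j =>
    B.chi_f_eq_conj (fun l hl => by fin_cases j <;> fin_cases l <;> simp_all) y
  have hp := B.chi_p_eq_conj (h := y) (by rw [hS.order, hx]; norm_num)
  refine ⟨fun i hi => ?_, ?_⟩
  · by_cases h0 : i = B.i₀
    · rw [h0, B.chi_i₀, map_one]
    by_cases h1 : i = B.p
    · rw [h1, hp]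
    by_cases h2 : i = B.q
    · rw [h2, B.chi_q, Complex.conj_conj, hp]
    by_cases h3 : ∃ j, i = B.f j
    · obtain ⟨j, rfl⟩ := h3
      exact hreal j
    · push Not at h3
      exact absurd (B.chi_else i h0 h1 h2 h3) hi
  · have hn := hS.norm_bound B
    have hsum := hS.sum_eq_zero B
    have hdot := hS.dot_le B
    obtain ⟨m, -, hsc⟩ := hS.exists_sc B hS hcard hx
    have k0 := hS.column.F_dvd B 0
    have k1 := hS.column.F_dvd B 1
    have k2 := hS.column.F_dvd B 2
    have k3 := hS.column.F_dvd B 3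
    have k4 := hS.column.E_dvd B
    have t : ∀ j, 2 ∣ B.V S j := fun j => (hS.two_dvd_of_three (hreal j)).mul_left _
    have t4 : 2 ∣ B.W S := (hS.two_dvd_of_three hp).mul_left _
    have t0 := t 0; have t1 := t 1; have t2 := t 2; have t3 := t 3
    have n0 := hn.1 0; have n1 := hn.1 1; have n2 := hn.1 2; have n3 := hn.1 3
    have n4 := hn.2
    rw [e0] at k0; rw [e1] at k1; rw [e2] at k2; rw [e3] at k3; rw [e4] at k4
    simp only [sc, dot, Block.row, ha, hb, hc, hd, hw] at hsc hsum hdot ⊢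
    rw [Block.degRow, Block.row] at ha hb hc hd hw
    rw [neg_dvd] at k0 k1 k4
    norm_num at n0 n1 n2 n3 n4 hsum hsc hdot
    obtain ⟨h0, h1, h2, h3, h4⟩ := eq_of_norm_le t0 t1 t2 t3 t4 k0 k1 k2 k3 k4 n0 n1 n2 n3 n4
      hsum hdot hsc
    rw [h0, h1, h2, h3, h4]

/-- In the exceptional solution, the central elements of order 3 are real. -/
theorem exists_conj_eq_inv [IsSimpleGroup G] (B : Block e x) (hcard : Nat.card G = 95040)
    (hx : orderOf x = 11) (hC : Nat.card (Subgroup.centralizer {x}) = 11) (hy : orderOf y = 3)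
    (hf : isM12 B.degRow = true)
    (hN : Nat.card (Subgroup.normalizer (Subgroup.zpowers y : Set G)) = 108) :
    ∃ g, g * y * g⁻¹ = y⁻¹ := by
  by_contra hr
  push Not at hr
  obtain ⟨S, hS⟩ := exists_isPowerColumn (x := x) e hcard hC Nat.prime_three (by norm_num) hy
  rw [hN] at hS
  obtain ⟨hreal, hrow⟩ := hS.row_of_isM12 B hcard hx hf
  rw [normalizer_eq_centralizer hy hr] at hN
  have hn : #(conjClass y) = 880 := by
    have := card_conjClass y
    rw [hN, hcard] at this
    omega
  have hK : IsColumn e x (conjClass y) 880 108 (fun i => S i / 2) := by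
    refine ⟨fun g c hc => conj_mem_conjClass hc, fun i hi => ?_, fun c hc => ?_, by norm_num⟩
    · rw [sum_conjClass, hn]
      have h1 := hS.eq_two_mul (hreal i hi)
      obtain ⟨k, hk⟩ := hS.two_dvd_of_three (hreal i hi)
      rw [hk] at h1 ⊢
      rw [Int.mul_ediv_cancel_left _ (by norm_num)]
      push_cast at h1 ⊢
      rw [mul_left_cancel₀ (by norm_num) h1]
    · obtain ⟨g, rfl⟩ := mem_conjClass.1 hc
      refine not_commute_of_orderOf hC Nat.prime_three (by norm_num) ?_
      rw [← hy]
      exact orderOf_injective (MulAut.conj g).toMonoidHom (MulAut.conj g).injective y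
  obtain ⟨m, -, h1⟩ := hK.exists_structure_constant hK B hcard hx
  have hV : ∀ j, B.V S j = 2 * B.V (fun i => S i / 2) j := fun j => by
    obtain ⟨k, hk⟩ := hS.two_dvd_of_three (hreal _ (B.chi_f_ne_zero j))
    simp only [Block.V, hk, Int.mul_ediv_cancel_left _ (two_ne_zero' ℤ)]
    ring
  have hW : B.W S = 2 * B.W fun i => S i / 2 := by
    obtain ⟨k, hk⟩ := hS.two_dvd_of_three (hreal _ B.chi_p_ne_zero)
    simp only [Block.W, hk, Int.mul_ediv_cancel_left _ (two_ne_zero' ℤ)]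
    ring
  simp only [Block.row, Row.mk.injEq, hV, hW] at hrow
  obtain ⟨h2, h3, h4, h5, h6⟩ := hrow
  simp only [isM12, Bool.and_eq_true, beq_iff_eq] at hf
  obtain ⟨⟨⟨⟨ha, -⟩, -⟩, -⟩, hw⟩ := hf
  rw [Fin.sum_univ_four, show B.V (fun i => S i / 2) 0 = -3 by omega,
    show B.V (fun i => S i / 2) 1 = 0 by omega, show B.V (fun i => S i / 2) 2 = 0 by omega,
    show B.V (fun i => S i / 2) 3 = 0 by omega, show (B.W fun i => S i / 2) = 2 by omega,
    show B.F 0 = -120 from ha, show B.E = -16 from hw, hS.apply_i₀ B] at h1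
  omega

end GroupChar

namespace GroupChar
open Matrix Finset
open ColumnSearch LocalSubgroup
variable {G : Type*} [Group G] [Fintype G] [DecidableEq G] {r : ℕ} {d : Fin r → ℕ}
  [∀ i, NeZero (d i)] {e : Wedderburn G r d} {x t : G} {T : Fin r → ℤ} {M : ℕ}

/-- A combination of irreducible characters with an integral value at `x` contains the two
exceptional characters with equal multiplicities. -/
theorem Block.combination_apply (B : Block e x) (m : Fin r → ℕ) {n : ℤ}
    (h : (n : ℂ) = ∑ j, (m j : ℂ) * chi e j x) :
    m B.q = m B.p ∧ n = m B.i₀ + (∑ j, (m (B.f j) : ℤ) * B.c j + m B.p * B.a) := by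
  have hq : m B.q = m B.p := by
    have h1 := h
    rw [B.sum_split, Finset.sum_eq_zero (s := B.rest) (fun i hi => by
      rw [rest, mem_filter] at hi
      rw [B.chi_else i hi.2.1 hi.2.2.1 hi.2.2.2.1 hi.2.2.2.2, mul_zero])] at h1
    have h2 := congrArg (starRingEnd ℂ) h1
    simp only [B.chi_i₀, B.chi_f, B.chi_q, map_add, map_mul, map_sum, map_natCast, map_intCast,
      map_one, Complex.conj_conj, map_zero] at h1 h2
    rw [h1] at h2
    have h3 : ((m B.p : ℂ) - m B.q) * (chi e B.p x - starRingEnd ℂ (chi e B.p x)) = 0 := by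
      linear_combination h2
    rcases mul_eq_zero.1 h3 with h4 | h4
    · exact_mod_cast (sub_eq_zero.1 h4).symm
    · exact absurd (sub_eq_zero.1 h4) B.chi_p_im
  refine ⟨hq, ?_⟩
  rw [B.sum_mul_chi (fun j => (m j : ℂ)) (by simp only [hq])] at h
  exact_mod_cast h

theorem IsPowerColumn.eq_chi (hT : IsPowerColumn e x t 2 M T) (i : Fin r) :
    (T i : ℂ) = chi e i t := by
  rw [hT.eq i, powerSum_eq _ _ _ (by norm_num)]
  simp

theorem IsPowerColumn.le_dim {h : G} {p N : ℕ} {S : Fin r → ℤ} (hS : IsPowerColumn e x h p N S)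
    (i : Fin r) : S i ≤ (p - 1) * d i := by
  obtain ⟨m, h1, h2, -⟩ := hS.mean i
  rw [h1]
  have : (p : ℤ) * m ≤ p * d i := by gcongr
  linarith

theorem IsPowerColumn.lt_dim [IsSimpleGroup G] {h : G} {p N : ℕ} {S : Fin r → ℤ}
    (hS : IsPowerColumn e x h p N S) {i₀ i : Fin r} (h₀ : ∀ g, chi e i₀ g = 1) (hi : i ≠ i₀) :
    S i < (p - 1) * d i := by
  obtain ⟨m, h1, h2, h3⟩ := hS.mean i
  have hp := hS.prime
  have hm : m ≠ d i := fun hm => by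
    have := irrep_injective e h₀ hi (h3 hm)
    rw [← orderOf_eq_one_iff, hS.order] at this
    exact hp.one_lt.ne' this
  have : (p : ℤ) * m < p * d i := by
    have : m < d i := lt_of_le_of_ne h2 hm
    have := hp.pos
    gcongr
  rw [h1]
  linarith

theorem combination_dim {m : Fin r → ℕ} {n : ℕ} (h : (n : ℂ) = ∑ j, (m j : ℂ) * chi e j 1) :
    (n : ℤ) = ∑ j, (m j : ℤ) * d j := by
  simp only [chi_one] at h
  exact_mod_cast h

theorem IsPowerColumn.combination (hT : IsPowerColumn e x t 2 M T) {m : Fin r → ℕ} {n : ℤ}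
    (h : (n : ℂ) = ∑ j, (m j : ℂ) * chi e j t) : n = ∑ j, (m j : ℤ) * T j := by
  simp only [← hT.eq_chi] at h
  exact_mod_cast h

/-- The multiplicity of an irreducible character in a combination of irreducible characters. -/
theorem card_mul_multiplicity (e : Wedderburn G r d) {m : Fin r → ℕ} {φ : G → ℂ}
    (h : ∀ g, φ g = ∑ j, (m j : ℂ) * chi e j g) (i : Fin r) :
    ∑ g, chi e i g⁻¹ * φ g = Fintype.card G * m i := by
  simp only [h, Finset.mul_sum]
  rw [Finset.sum_comm]
  have h1 : ∀ j, ∑ g, chi e i g⁻¹ * ((m j : ℂ) * chi e j g) =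
      m j * if i = j then (Fintype.card G : ℂ) else 0 := fun j => by
    rw [← row_orthogonality e i j, Finset.mul_sum]
    exact Finset.sum_congr rfl fun g _ => by ring
  simp only [h1, mul_ite, mul_zero, Finset.sum_ite_eq, mem_univ, if_true]
  exact mul_comm _ _

/-- The degrees 10, 12, 12, 45, 60 are impossible, since the square of the character of degree 10
would contain both characters of degree 12. -/
theorem isTensor_ne_true [IsSimpleGroup G] (B : Block e x)
    (hT : IsPowerColumn e x t 2 M T) : isTensor B.degRow (B.row T) ≠ true := by
  intro hf
  simp only [isTensor, Bool.and_eq_true, beq_iff_eq] at hf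
  obtain ⟨⟨⟨⟨⟨⟨⟨⟨⟨f0, f1⟩, f2⟩, f3⟩, f4⟩, t0⟩, t1⟩, t2⟩, t3⟩, t4⟩ := hf
  have hreal : ∀ g, starRingEnd ℂ (chi e (B.f 0) g) = chi e (B.f 0) g := B.chi_f_eq_conj
    (fun l hl => by
      change B.F 0 = _ at f0
      change B.F 1 = _ at f1
      change B.F 2 = _ at f2
      change B.F 3 = _ at f3
      fin_cases l <;> simp_all)
  change B.c 0 * _ = _ at f0 t0
  change B.c 1 * _ = _ at f1 t1
  change B.c 2 * _ = _ at f2 t2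
  change B.c 3 * _ = _ at f3 t3
  change B.a * _ = _ at f4 t4
  have sgn : ∀ {c z : ℤ}, c ^ 2 = 1 → 0 < c * z → 0 ≤ z → c = 1 := fun hc h hz => by
    rcases sq_eq_one_iff.1 hc with rfl | rfl <;> [rfl; linarith]
  have sgn' : ∀ {c z : ℤ}, c ^ 2 = 1 → c * z < 0 → 0 ≤ z → c = -1 := fun hc h hz => by
    rcases sq_eq_one_iff.1 hc with rfl | rfl <;> [linarith; rfl]
  have c0 := sgn' (B.c_sq 0) (by rw [f0]; norm_num) (Nat.cast_nonneg _)
  have c1 := sgn (B.c_sq 1) (by rw [f1]; norm_num) (Nat.cast_nonneg _)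
  have c2 := sgn (B.c_sq 2) (by rw [f2]; norm_num) (Nat.cast_nonneg _)
  have c3 := sgn (B.c_sq 3) (by rw [f3]; norm_num) (Nat.cast_nonneg _)
  have a1 := sgn' B.a_sq (by rw [f4]; norm_num) (Nat.cast_nonneg _)
  rw [c0] at f0 t0; rw [c1] at f1 t1; rw [c2] at f2 t2; rw [c3] at f3 t3; rw [a1] at f4 t4
  -- the decomposition of a combination with an integral value at `x`
  have key : ∀ (m : Fin r → ℕ) (nx nt : ℤ) (n : ℕ) (φ : G → ℂ),
      (∀ g, φ g = ∑ j, (m j : ℂ) * chi e j g) → φ x = nx → φ t = nt → φ 1 = n →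
      ∃ R : ℤ, 0 ≤ R ∧ (R = 0 → ∀ i ∈ B.rest, m i = 0) ∧
      nx = m B.i₀ - m (B.f 0) + m (B.f 1) + m (B.f 2) + m (B.f 3) - m B.p ∧
      (n : ℤ) - nt = 16 * m (B.f 0) + 16 * m (B.f 1) + 16 * m (B.f 2) + 48 * m (B.f 3) +
        128 * m B.p + R ∧
      (n : ℤ) = m B.i₀ + 10 * m (B.f 0) + 12 * m (B.f 1) + 12 * m (B.f 2) + 45 * m (B.f 3) +
        120 * m B.p + ∑ i ∈ B.rest, (m i : ℤ) * d i := by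
    intro m nx nt n φ h hx ht h1
    rw [h] at hx ht h1
    obtain ⟨hq, hx⟩ := B.combination_apply m hx.symm
    have ht := hT.combination ht.symm
    have h1 := combination_dim h1.symm
    have hpos : ∀ i ∈ B.rest, 0 ≤ (m i : ℤ) * (d i - T i) := fun i hi => by
      have := hT.le_dim i
      exact mul_nonneg (Nat.cast_nonneg _) (by norm_num at this; linarith)
    refine ⟨∑ i ∈ B.rest, (m i : ℤ) * (d i - T i), Finset.sum_nonneg hpos, fun h i hi => ?_,
      ?_, ?_, ?_⟩
    · have h2 := (Finset.sum_eq_zero_iff_of_nonneg hpos).1 h i hi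
      have h3 := hT.lt_dim B.chi_i₀ (i := i) (by rw [Block.rest, mem_filter] at hi; exact hi.2.1)
      rcases mul_eq_zero.1 h2 with h4 | h4
      · exact_mod_cast h4
      · norm_num at h3; linarith
    · rw [hx, Fin.sum_univ_four, c0, c1, c2, c3, a1]
      ring
    · rw [h1, ht, ← Finset.sum_sub_distrib, B.sum_split, hq, B.dim_q, hT.apply_q B,
        Fin.sum_univ_four, B.dim_i₀, hT.apply_i₀ B]
      simp only [← mul_sub]
      rw [show (d (B.f 0) : ℤ) = 10 by linarith, show (d (B.f 1) : ℤ) = 12 by linarith,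
        show (d (B.f 2) : ℤ) = 12 by linarith, show (d (B.f 3) : ℤ) = 45 by linarith,
        show (d B.p : ℤ) = 60 by linarith, show T (B.f 0) = -6 by linarith,
        show T (B.f 1) = -4 by linarith, show T (B.f 2) = -4 by linarith,
        show T (B.f 3) = -3 by linarith, show T B.p = -4 by linarith]
      push_cast
      ring
    · rw [h1, B.sum_split, hq, B.dim_q, Fin.sum_univ_four, B.dim_i₀,
        show (d (B.f 0) : ℤ) = 10 by linarith, show (d (B.f 1) : ℤ) = 12 by linarith,
        show (d (B.f 2) : ℤ) = 12 by linarith, show (d (B.f 3) : ℤ) = 45 by linarith,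
        show (d B.p : ℤ) = 60 by linarith]
      push_cast
      ring
  have hd : ∀ j n, (d (B.f j) : ℤ) = n → (d (B.f j) : ℂ) = n := fun j n h => by exact_mod_cast h
  have d0 := hd 0 10 (by linarith)
  have tt : ∀ j n, T (B.f j) = n → chi e (B.f j) t = n := fun j n h => by rw [← hT.eq_chi, h]
  have tt0 := tt 0 (-6) (by linarith)
  obtain ⟨n, hn⟩ := chi_mul_chi e (B.f 0) (B.f 0)
  have hinv : ∀ g, chi e (B.f 0) g⁻¹ = chi e (B.f 0) g := fun g => by rw [chi_inv, hreal]
  have n1 : n B.i₀ = 1 := by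
    have h1 := card_mul_multiplicity e hn B.i₀
    have h2 := row_orthogonality e (B.f 0) (B.f 0)
    simp only [B.chi_i₀, one_mul] at h1
    simp only [hinv, if_true] at h2
    rw [h2] at h1
    exact_mod_cast (mul_right_cancel₀ (card_ne_zero' G) (by
      rw [one_mul, mul_comm]; exact h1) : (1 : ℂ) = n B.i₀).symm
  have twelve : ∀ j, B.c j = 1 → d (B.f j) = 12 → T (B.f j) = -4 → 1 ≤ n (B.f j) := by
    intro j hc hdj htj
    obtain ⟨k, hk⟩ := exists_dual e (B.f j)
    obtain ⟨m, hm⟩ := chi_mul_chi e (B.f 0) k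
    have hmn : m (B.f 0) = n (B.f j) := by
      have h1 := card_mul_multiplicity e hm (B.f 0)
      have h2 := card_mul_multiplicity e hn (B.f j)
      have h3 : ∑ g, chi e (B.f 0) g⁻¹ * (chi e (B.f 0) g * chi e k g) =
          ∑ g, chi e (B.f j) g⁻¹ * (chi e (B.f 0) g * chi e (B.f 0) g) :=
        Finset.sum_congr rfl fun g _ => by rw [hinv, chi_inv, hk]; ring
      rw [h1, h2] at h3
      exact_mod_cast mul_left_cancel₀ (card_ne_zero' G) h3
    obtain ⟨R, hR, -, h1, h2, -⟩ := key m (-1) 24 120 _ hm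
      (by rw [hk, B.chi_f, B.chi_f, c0, hc]; simp)
      (by rw [hk, tt0, tt j _ htj, map_intCast]; norm_num)
      (by rw [hk, chi_one, chi_one, d0, hdj, Complex.conj_natCast]; norm_num)
    omega
  have g1 := twelve 1 c1 (by have : (d (B.f 1) : ℤ) = 12 := by linarith
                             exact_mod_cast this) (by linarith)
  have g2 := twelve 2 c2 (by have : (d (B.f 2) : ℤ) = 12 := by linarith
                             exact_mod_cast this) (by linarith)
  obtain ⟨R, hR, hR0, h1, h2, h3⟩ := key n 1 36 100 _ hn
    (by rw [B.chi_f, c0]; simp)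
    (by rw [tt0]; norm_num)
    (by rw [chi_one, d0]; norm_num)
  have hR1 : R = 0 := by omega
  rw [Finset.sum_eq_zero (s := B.rest) fun i hi => by rw [hR0 hR1 i hi]; simp] at h3
  omega

end GroupChar

namespace GroupChar
open Matrix Finset
open ColumnSearch LocalSubgroup

/-- The local structure at the elements of order 3 commuting with a Sylow 3-subgroup. -/
theorem exists_real_of_order_three (G : Type*) [Group G] [Finite G] [IsSimpleGroup G]
    (hcard : Nat.card G = 95040) {y : G} (hy : orderOf y = 3)
    (h27 : 27 ∣ Nat.card (Subgroup.centralizer {y})) :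
    (∃ g, g * y * g⁻¹ = y⁻¹) ∧ Nat.card (Subgroup.centralizer {y}) = 54 := by
  classical
  have := Fintype.ofFinite G
  obtain ⟨x, hx, hC, ⟨g₀, hg₀⟩, hr⟩ := FixCount.exists_order_eleven hcard
  obtain ⟨r, d, hd, ⟨e⟩⟩ := exists_wedderburn G
  obtain ⟨B⟩ := exists_block e hcard hx hC hg₀ hr
  have hG := not_comm_of_centralizer (x := x) (by rw [hC, hcard]; norm_num)
  obtain ⟨t, M, T, hT, htest⟩ := exists_involution_column e B hcard hx hC hr hG
  rcases isTensor_or_isM12 B hcard hx hC hT htest with h | h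
  · exact absurd h (isTensor_ne_true B hT)
  · obtain ⟨hf, hN⟩ := h y hy h27
    obtain ⟨g, hg⟩ := exists_conj_eq_inv B hcard hx hC hy hf hN
    have h1 := card_normalizer_of_real hy hg
    exact ⟨⟨g, hg⟩, by omega⟩

end GroupChar

namespace LocalSubgroup
open Subgroup
variable {G : Type*} [Group G]

theorem pow_mem_of_card [Finite G] {P : Subgroup G} {p k : ℕ} (hP : Nat.card P = p ^ k) {g : G}
    (hg : g ∈ P) : g ^ p ^ k = 1 := by
  rw [← hP]
  exact orderOf_dvd_iff_pow_eq_one.1 (orderOf_dvd_natCard _ hg)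

/-- A subgroup of order 27 commuting with `y` contains all 3-elements commuting with `y` if the
centralizer of `y` has order 54. -/
theorem mem_of_commute [Finite G] {P : Subgroup G} {y g : G} (hP : Nat.card P = 27)
    (hle : P ≤ centralizer {y}) (h54 : Nat.card (centralizer {y}) = 54) (hg : g ^ 27 = 1)
    (hgy : g ∈ centralizer {y}) : g ∈ P := by
  have hi : (P.subgroupOf (centralizer {y})).index = 2 := by
    have h1 := (P.subgroupOf (centralizer {y})).card_mul_index
    rw [Nat.card_congr (subgroupOfEquivOfLe hle).toEquiv, hP, h54] at h1
    omega
  have h2 := sq_mem_of_index_two hi ⟨g, hgy⟩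
  rw [mem_subgroupOf] at h2
  have h3 : (g ^ 2) ^ 14 = g := by
    rw [← pow_mul, show 2 * 14 = 27 + 1 by norm_num, pow_succ, hg, one_mul]
  rw [← h3]
  exact pow_mem h2 14

theorem sq_mem_of_commute [Finite G] {P : Subgroup G} {y g : G} (hP : Nat.card P = 27)
    (hle : P ≤ centralizer {y}) (h54 : Nat.card (centralizer {y}) = 54)
    (hgy : g ∈ centralizer {y}) : g ^ 2 ∈ P := by
  have hi : (P.subgroupOf (centralizer {y})).index = 2 := by
    have h1 := (P.subgroupOf (centralizer {y})).card_mul_index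
    rw [Nat.card_congr (subgroupOfEquivOfLe hle).toEquiv, hP, h54] at h1
    omega
  exact sq_mem_of_index_two hi ⟨g, hgy⟩

theorem eq_of_le_centralizer [Finite G] {P Q : Subgroup G} {y : G} (hP : Nat.card P = 27)
    (hQ : Nat.card Q = 27) (hle : P ≤ centralizer {y}) (hle' : Q ≤ centralizer {y})
    (h54 : Nat.card (centralizer {y}) = 54) : P = Q :=
  (eq_of_le_of_card_ge (fun g hg => mem_of_commute hP hle h54
    (pow_mem_of_card (p := 3) (k := 3) hQ hg) (hle' hg)) (by rw [hP, hQ])).symm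

theorem conj_mem_centralizer {y g z : G} (hg : g ∈ normalizer (zpowers y : Set G))
    (hz : z ∈ centralizer {y}) : g * z * g⁻¹ ∈ centralizer {y} := by
  obtain ⟨k, hk⟩ := mem_normalizer_zpowers (inv_mem hg)
  rw [inv_inv] at hk
  rw [mem_centralizer_singleton_iff] at hz ⊢
  have h1 : Commute z (y ^ k) := Commute.zpow_right hz k
  rw [← hk] at h1
  have h2 : Commute (g * z * g⁻¹) (g * (g⁻¹ * y * g) * g⁻¹) := h1.map (MulAut.conj g)
  have h3 : g * (g⁻¹ * y * g) * g⁻¹ = y := by group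
  rw [h3] at h2
  exact h2

theorem normalizer_zpowers_le [Finite G] {P : Subgroup G} {y : G} (hP : Nat.card P = 27)
    (hle : P ≤ centralizer {y}) (h54 : Nat.card (centralizer {y}) = 54) :
    normalizer (zpowers y : Set G) ≤ normalizer (P : Set G) := by
  have key : ∀ g ∈ normalizer (zpowers y : Set G), ∀ z ∈ P, g * z * g⁻¹ ∈ P := fun g hg z hz =>
    mem_of_commute hP hle h54 (by
      rw [conj_pow, show (27 : ℕ) = 3 ^ 3 by norm_num, pow_mem_of_card hP hz, mul_one,
        mul_inv_cancel])
      (conj_mem_centralizer hg (hle hz))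
  intro g hg
  rw [mem_normalizer_iff]
  refine fun z => ⟨key g hg z, fun h => ?_⟩
  have := key g⁻¹ (inv_mem hg) _ h
  simpa [mul_assoc] using this

section Sylow
variable [Finite G] [Fact (Nat.Prime 3)]

theorem fixedBy_sylow {g : G} {k : ℕ} (hg : g ^ 3 ^ k = 1) :
    MulAction.fixedBy (Sylow 3 G) g = {Q : Sylow 3 G | g ∈ Q} := by
  ext Q
  rw [MulAction.mem_fixedBy, Sylow.smul_eq_iff_mem_normalizer]
  exact ⟨fun h => FixCount.mem_sylow_of_pow Q hg h, fun h => le_normalizer h⟩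

/-- Counting the orbits of a subgroup of order a power of 3 on the Sylow 3-subgroups. -/
theorem card_dvd_sum_sylow (K : Subgroup G) [Fintype K] {k : ℕ} (hK : Nat.card K = 3 ^ k) :
    3 ^ k ∣ ∑ g : K, {Q : Sylow 3 G | (g : G) ∈ Q}.ncard := by
  classical
  have := Fintype.ofFinite (Sylow 3 G)
  have h1 := MulAction.sum_card_fixedBy_eq_card_orbits_mul_card_group K (Sylow 3 G)
  have h2 : ∀ g : K, Fintype.card (MulAction.fixedBy (Sylow 3 G) g) =
      {Q : Sylow 3 G | (g : G) ∈ Q}.ncard := fun g => by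
    rw [← fixedBy_sylow (pow_mem_of_card hK g.2), ← Nat.card_eq_fintype_card]
    rfl
  simp only [h2] at h1
  rw [h1, ← Nat.card_eq_fintype_card (α := K), hK]
  exact dvd_mul_left _ _

end Sylow

end LocalSubgroup

namespace LocalSubgroup
open Subgroup
variable {G : Type*} [Group G] [Finite G]

theorem card_sylow_three [Fact (Nat.Prime 3)] (hcard : Nat.card G = 95040) (P : Sylow 3 G) :
    Nat.card P = 27 := by
  obtain ⟨H, hH⟩ := Sylow.exists_subgroup_card_pow_prime (G := G) 3 (n := 3)
    (by rw [hcard]; norm_num)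
  obtain ⟨Q, hQ⟩ := exists_sylow_eq hH (by rw [hcard]; norm_num)
  rw [Nat.card_congr (P.equiv Q).toEquiv, ← show Nat.card H = 27 by rw [hH]; norm_num, ← hQ]

/-- The number of conjugates of `y` under a subgroup is at most the size of any set containing
them. -/
theorem card_le_of_conj_mem {N P : Subgroup G} {y : G} (h : ∀ g ∈ N, g * y * g⁻¹ ∈ P) :
    Nat.card N ≤ Nat.card (centralizer {y}) * Nat.card P := by
  classical
  have := Fintype.ofFinite G
  let f : N → P := fun g => ⟨g * y * (g : G)⁻¹, h g g.2⟩
  have h1 := Finset.card_le_mul_card_image (f := f) Finset.univ (Nat.card (centralizer {y}))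
    (fun a ha => by
      obtain ⟨g₀, -, rfl⟩ := Finset.mem_image.1 ha
      rw [← Fintype.card_coe, ← Nat.card_eq_fintype_card]
      refine Nat.card_le_card_of_injective (fun g => (⟨(g₀ : G)⁻¹ * g.1, ?_⟩ : centralizer {y})) ?_
      · have h2 := (Finset.mem_filter.1 g.2).2
        have h3 : (g.1 : G) * y * (g.1 : G)⁻¹ = g₀ * y * (g₀ : G)⁻¹ := congrArg Subtype.val h2
        rw [mem_centralizer_singleton_iff]
        rw [mul_inv_eq_iff_eq_mul] at h3
        rw [mul_assoc, h3]
        group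
      · intro a b hab
        exact Subtype.ext (Subtype.ext (mul_left_cancel (congrArg Subtype.val hab))))
  rw [Finset.card_univ, ← Nat.card_eq_fintype_card] at h1
  refine h1.trans (Nat.mul_le_mul_left _ ?_)
  rw [Nat.card_eq_fintype_card (α := P)]
  exact Finset.card_le_univ _

theorem exists_pow_orderOf_three {P : Subgroup G} (hP : Nat.card P = 27) {g : G} (hg : g ∈ P)
    (h1 : g ≠ 1) : ∃ n, orderOf (g ^ n) = 3 := by
  have h2 : orderOf g ∣ 3 ^ 3 := by
    have := orderOf_dvd_natCard P hg
    rw [hP] at this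
    exact this
  obtain ⟨j, hj, h3⟩ := (Nat.dvd_prime_pow Nat.prime_three).1 h2
  obtain ⟨i, rfl⟩ : ∃ i, j = i + 1 := Nat.exists_eq_succ_of_ne_zero (by
    rintro rfl
    exact h1 (orderOf_eq_one_iff.1 h3))
  refine ⟨3 ^ i, ?_⟩
  rw [orderOf_pow_of_dvd (by positivity) (by rw [h3]; exact pow_dvd_pow _ (by omega)), h3, pow_succ]
  exact Nat.mul_div_cancel_left _ (by positivity)

variable (hloc : ∀ y : G, orderOf y = 3 → 27 ∣ Nat.card (centralizer {y}) →
  (∃ g, g * y * g⁻¹ = y⁻¹) ∧ Nat.card (centralizer {y}) = 54)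
include hloc

theorem centralizer_data {P : Subgroup G} (hP : Nat.card P = 27) {y : G} (hy : orderOf y = 3)
    (hle : P ≤ centralizer {y}) : (∃ g, g * y * g⁻¹ = y⁻¹) ∧ Nat.card (centralizer {y}) = 54 :=
  hloc y hy (hP ▸ card_dvd_of_le hle)

theorem dvd_card_normalizer {P : Subgroup G} (hP : Nat.card P = 27) {y : G} (hy : orderOf y = 3)
    (hle : P ≤ centralizer {y}) : 108 ∣ Nat.card (normalizer (P : Set G)) := by
  obtain ⟨⟨g, hg⟩, h54⟩ := centralizer_data hloc hP hy hle
  have h1 := card_normalizer_of_real hy hg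
  rw [h54] at h1
  have h2 := card_dvd_of_le (normalizer_zpowers_le hP hle h54)
  rwa [h1] at h2

/-- The Sylow 3-subgroups are not abelian. -/
theorem exists_not_commute (hcard : Nat.card G = 95040) {P : Subgroup G} (hP : Nat.card P = 27) :
    ∃ u ∈ P, ∃ v ∈ P, u * v ≠ v * u := by
  classical
  haveI : Fact (Nat.Prime 3) := ⟨Nat.prime_three⟩
  have := Fintype.ofFinite G
  by_contra! hab
  obtain ⟨P, rfl⟩ := exists_sylow_eq (p := 3) (k := 3) hP (by rw [hcard]; norm_num)
  have hab' : ∀ Q : Sylow 3 G, ∀ u ∈ Q, ∀ v ∈ Q, u * v = v * u := by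
    intro Q
    obtain ⟨g, rfl⟩ := MulAction.exists_smul_eq G P Q
    rintro _ ⟨u, hu, rfl⟩ _ ⟨v, hv, rfl⟩
    have h : Commute u v := hab u hu v hv
    exact (h.map (MulAut.conj g).toMonoidHom).eq
  have hle : ∀ Q : Sylow 3 G, ∀ u ∈ Q, (Q : Subgroup G) ≤ centralizer {u} := fun Q u hu v hv =>
    mem_centralizer_singleton_iff.2 (hab' Q v hv u hu)
  have hfix : ∀ g ∈ P, g ≠ 1 → {Q : Sylow 3 G | g ∈ Q}.ncard = 1 := by
    intro g hg h1
    obtain ⟨n, hn⟩ := exists_pow_orderOf_three hP hg h1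
    refine Set.ncard_eq_one.2 ⟨P, Set.eq_singleton_iff_unique_mem.2 ⟨hg, fun Q hQ => ?_⟩⟩
    refine (Sylow.ext (eq_of_le_centralizer hP (card_sylow_three hcard Q) (hle P _ (pow_mem hg n))
      (hle Q _ (pow_mem hQ n))
      (centralizer_data hloc hP hn (hle P _ (pow_mem hg n))).2)).symm
  obtain ⟨y, hyP, hy, hley⟩ := exists_central (p := 3) (k := 3) (by norm_num) hP
  have h108 := dvd_card_normalizer hloc hP hy hley
  have hn := P.card_eq_index_normalizer
  have hmul := (normalizer ((P : Subgroup G) : Set G)).card_mul_index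
  have hle := card_le_of_conj_mem (N := normalizer ((P : Subgroup G) : Set G)) (P := P) (y := y)
    (fun g hg => (mem_normalizer_iff.1 hg y).1 hyP)
  have hsum := card_dvd_sum_sylow (P : Subgroup G) (k := 3) hP
  have h26 : ∀ g ∈ (Finset.univ : Finset (P : Subgroup G)).erase 1,
      {Q : Sylow 3 G | (g : G) ∈ Q}.ncard = 1 := fun g hg => hfix g g.2 (by
    simpa using (Finset.mem_erase.1 hg).1)
  rw [← Finset.add_sum_erase _ _ (Finset.mem_univ 1), Finset.sum_congr rfl h26,
    Finset.sum_const, Finset.card_erase_of_mem (Finset.mem_univ 1), Finset.card_univ] at hsum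
  simp only [OneMemClass.coe_one, one_mem, Set.setOf_true, Set.ncard_univ, smul_eq_mul, mul_one,
    ← Nat.card_eq_fintype_card, hP] at hsum
  rw [(centralizer_data hloc hP hy hley).2, hP] at hle
  rw [hcard] at hmul
  change Nat.card (Sylow 3 G) = (normalizer ((P : Subgroup G) : Set G)).index at hn
  rw [← hn] at hmul
  obtain ⟨m, hm⟩ := h108
  rw [hm] at hmul hle
  have hm13 : m ≤ 13 := by omega
  interval_cases m <;> omega

end LocalSubgroup

namespace LocalSubgroup
open Subgroup
variable {G : Type*} [Group G]

theorem commute_of_card_nine [Finite G] {E : Subgroup G} (hE : Nat.card E = 9) {u v : G}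
    (hu : u ∈ E) (hv : v ∈ E) : u * v = v * u := by
  haveI : Fact (Nat.Prime 3) := ⟨Nat.prime_three⟩
  have := IsPGroup.isMulCommutative_of_card_eq_prime_sq (p := 3) (G := E) (by rw [hE]; norm_num)
  exact congrArg Subtype.val (mul_comm' (⟨u, hu⟩ : E) ⟨v, hv⟩)

theorem commutator_mem_zpowers [Finite G] {P : Subgroup G} (hP : Nat.card P = 27) {y : G}
    (hyP : y ∈ P) (hy : orderOf y = 3) (hle : P ≤ centralizer {y}) {u v : G} (hu : u ∈ P)
    (hv : v ∈ P) : u * v * u⁻¹ * v⁻¹ ∈ zpowers y := by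
  haveI : Fact (Nat.Prime 3) := ⟨Nat.prime_three⟩
  have hZP : zpowers y ≤ P := zpowers_le.2 hyP
  let Z := (zpowers y).subgroupOf P
  haveI : Z.Normal := ⟨fun n hn g => by
    rw [mem_subgroupOf] at hn ⊢
    obtain ⟨k, hk⟩ := hn
    refine ⟨k, ?_⟩
    have h1 : Commute (g : G) y := mem_centralizer_singleton_iff.1 (hle g.2)
    have h2 := (h1.zpow_right k).eq
    simp only at hk
    rw [hk] at h2
    simp [hk, h2]⟩
  have hcard : Nat.card (P ⧸ Z) = 3 ^ 2 := by
    have h1 := Z.card_mul_index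
    rw [Nat.card_congr (subgroupOfEquivOfLe hZP).toEquiv, Nat.card_zpowers, hy, hP] at h1
    change Z.index = 3 ^ 2
    omega
  have := IsPGroup.isMulCommutative_of_card_eq_prime_sq hcard
  have h2 := mul_comm' ((⟨v, hv⟩ : P) : P ⧸ Z)⁻¹ ((⟨u, hu⟩ : P) : P ⧸ Z)⁻¹
  rw [← QuotientGroup.mk_inv, ← QuotientGroup.mk_inv, ← QuotientGroup.mk_mul,
    ← QuotientGroup.mk_mul, QuotientGroup.eq, mem_subgroupOf] at h2
  simpa [mul_assoc] using h2

theorem mem_zpowers_symm_of_prime {p : ℕ} [Fact p.Prime] {y c : G} (hy : orderOf y = p)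
    (hc : c ∈ zpowers y) (h1 : c ≠ 1) : y ∈ zpowers c := by
  obtain ⟨k, rfl⟩ := hc
  have h2 : IsCoprime k p := by
    rw [Int.isCoprime_iff_gcd_eq_one, Int.gcd_comm]
    refine (Int.isCoprime_iff_gcd_eq_one).1 ((Prime.coprime_iff_not_dvd
      (Nat.prime_iff_prime_int.1 Fact.out)).2 fun h => h1 ?_)
    rw [← hy] at h
    exact orderOf_dvd_iff_zpow_eq_one.1 h
  obtain ⟨a, b, hab⟩ := h2
  refine ⟨a, ?_⟩
  change (y ^ k) ^ a = y
  rw [← zpow_mul, mul_comm, ← mul_one (y ^ (a * k)), ← one_zpow b,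
    ← pow_orderOf_eq_one y, hy, ← zpow_natCast y p, ← zpow_mul, ← zpow_add, mul_comm (p : ℤ), hab,
    zpow_one]

theorem central_mem_zpowers [Finite G] {P : Subgroup G} (hP : Nat.card P = 27)
    (hab : ∃ u ∈ P, ∃ v ∈ P, u * v ≠ v * u) {y t : G} (hyP : y ∈ P) (hy : orderOf y = 3)
    (hle : P ≤ centralizer {y}) (htP : t ∈ P) (ht : orderOf t = 3) (htle : P ≤ centralizer {t}) :
    t ∈ zpowers y := by
  haveI : Fact (Nat.Prime 3) := ⟨Nat.prime_three⟩
  obtain ⟨u, hu, v, hv, huv⟩ := hab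
  have h1 := commutator_mem_zpowers hP hyP hy hle hu hv
  have h2 := commutator_mem_zpowers hP htP ht htle hu hv
  refine zpowers_le.2 h1 (mem_zpowers_symm_of_prime ht h2 fun h => huv ?_)
  rwa [mul_inv_eq_one, mul_inv_eq_iff_eq_mul] at h

/-- Commutators that commute with `u` turn powers of `u` into powers. -/
theorem pow_mul_eq_of_commute {u v c : G} (h : u * v = c * v * u) (hc : Commute c u) (n : ℕ) :
    u ^ n * v = c ^ n * v * u ^ n := by
  induction n with
  | zero => simp
  | succ n ih =>
    calc u ^ (n + 1) * v = u ^ n * (u * v) := by rw [pow_succ, mul_assoc]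
      _ = (u ^ n * c) * v * u := by rw [h]; simp only [mul_assoc]
      _ = c * (u ^ n * v) * u := by rw [← (hc.pow_right n).eq]; simp only [mul_assoc]
      _ = c ^ (n + 1) * v * u ^ (n + 1) := by rw [ih, pow_succ u, pow_succ' c]; simp only [mul_assoc]

theorem zpow_cube_eq_one {y : G} (hy : orderOf y = 3) (k : ℤ) : (y ^ k) ^ 3 = 1 := by
  rw [← zpow_natCast, ← zpow_mul, mul_comm, zpow_mul, zpow_natCast, ← hy, pow_orderOf_eq_one,
    one_zpow]

theorem cube_central [Finite G] {P : Subgroup G} (hP : Nat.card P = 27) {u : G} (hu : u ∈ P) :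
    P ≤ centralizer {u ^ 3} := by
  haveI : Fact (Nat.Prime 3) := ⟨Nat.prime_three⟩
  obtain ⟨y, hyP, hy, hle⟩ := exists_central (p := 3) (k := 3) (by norm_num) hP
  intro v hv
  obtain ⟨k, hk⟩ := commutator_mem_zpowers hP hyP hy hle hu hv
  have hc : Commute (y ^ k) u :=
    (show Commute u y from mem_centralizer_singleton_iff.1 (hle hu)).symm.zpow_left k
  have h1 := pow_mul_eq_of_commute (u := u) (v := v) (c := y ^ k)
    (by simp only at hk; rw [hk]; group) hc 3
  rw [zpow_cube_eq_one hy, one_mul] at h1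
  exact mem_centralizer_singleton_iff.2 h1.symm

theorem mul_cube [Finite G] {P : Subgroup G} (hP : Nat.card P = 27) {u v : G} (hu : u ∈ P)
    (hv : v ∈ P) : (u * v) ^ 3 = u ^ 3 * v ^ 3 := by
  haveI : Fact (Nat.Prime 3) := ⟨Nat.prime_three⟩
  obtain ⟨y, hyP, hy, hle⟩ := exists_central (p := 3) (k := 3) (by norm_num) hP
  obtain ⟨k, hk⟩ := commutator_mem_zpowers hP hyP hy hle hv hu
  simp only at hk
  have hcy : ∀ w ∈ P, Commute w (y ^ k) := fun w hw =>
    (show Commute w y from mem_centralizer_singleton_iff.1 (hle hw)).zpow_right k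
  set c := y ^ k with hc
  have hc3 : c ^ 3 = 1 := zpow_cube_eq_one hy k
  have h1 : v * u = c * u * v := by rw [hk]; group
  have h2 : v * u = u * v * c := by rw [h1, mul_assoc, ((hcy _ (mul_mem hu hv))).eq]
  calc (u * v) ^ 3 = u * (v * u) * (v * u) * v := by
        simp only [pow_succ, pow_zero, one_mul, mul_assoc]
    _ = u * (u * v * c) * (u * v * c) * v := by rw [h2]
    _ = u * u * (v * (c * u)) * (v * (c * v)) := by simp only [mul_assoc]
    _ = u * u * (v * u) * c * (v * v) * c := by
        rw [← (hcy u hu).eq, ← (hcy v hv).eq]; simp only [mul_assoc]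
    _ = u * u * u * v * (c * c) * (v * v * c) := by rw [h2]; simp only [mul_assoc]
    _ = u * u * u * v * (c * c) * (c * (v * v)) := by rw [(hcy _ (mul_mem hv hv)).eq]
    _ = u ^ 3 * v * c ^ 3 * (v * v) := by simp only [pow_succ, pow_zero, one_mul, mul_assoc]
    _ = u ^ 3 * v ^ 3 := by rw [hc3]; simp only [pow_succ, pow_zero, one_mul, mul_one, mul_assoc]

end LocalSubgroup

namespace LocalSubgroup
open Subgroup
variable {G : Type*} [Group G] [Finite G]
variable (hloc : ∀ y : G, orderOf y = 3 → 27 ∣ Nat.card (centralizer {y}) →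
  (∃ g, g * y * g⁻¹ = y⁻¹) ∧ Nat.card (centralizer {y}) = 54)
include hloc

theorem normalizer_le_normalizer_zpowers (hcard : Nat.card G = 95040) {P : Subgroup G}
    (hP : Nat.card P = 27) {y : G} (hyP : y ∈ P) (hy : orderOf y = 3)
    (hle : P ≤ centralizer {y}) : normalizer (P : Set G) ≤ normalizer (zpowers y : Set G) := by
  have key : ∀ n ∈ normalizer (P : Set G), ∀ z ∈ zpowers y, n * z * n⁻¹ ∈ zpowers y := by
    rintro n hn _ ⟨k, rfl⟩
    have h1 : n * y * n⁻¹ ∈ zpowers y := by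
      refine central_mem_zpowers hP (exists_not_commute hloc hcard hP) hyP hy hle
        ((mem_normalizer_iff.1 hn y).1 hyP) ?_ ?_
      · rw [← hy]
        exact orderOf_injective (MulAut.conj n).toMonoidHom (MulAut.conj n).injective y
      · intro z hz
        have h2 : n⁻¹ * z * n ∈ P := by
          have := (mem_normalizer_iff.1 (inv_mem hn) z).1 hz
          rwa [inv_inv] at this
        have h3 : Commute (n⁻¹ * z * n) y := mem_centralizer_singleton_iff.1 (hle h2)
        have h4 : Commute (n * (n⁻¹ * z * n) * n⁻¹) (n * y * n⁻¹) := h3.map (MulAut.conj n)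
        rw [show n * (n⁻¹ * z * n) * n⁻¹ = z by group] at h4
        exact mem_centralizer_singleton_iff.2 h4
    simp only
    rw [← conj_zpow]
    exact zpow_mem h1 k
  intro n hn
  rw [mem_normalizer_iff]
  refine fun z => ⟨key n hn z, fun h => ?_⟩
  have := key n⁻¹ (inv_mem hn) _ h
  simpa [mul_assoc] using this

theorem card_sylow_eq [Fact (Nat.Prime 3)] (hcard : Nat.card G = 95040) (P : Sylow 3 G) :
    Nat.card (Sylow 3 G) = 880 := by
  have hP := card_sylow_three hcard P
  obtain ⟨y, hyP, hy, hle⟩ := exists_central (p := 3) (k := 3) (by norm_num) hP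
  obtain ⟨⟨g, hg⟩, h54⟩ := centralizer_data hloc hP hy hle
  have h1 := card_normalizer_of_real hy hg
  rw [h54, ← le_antisymm (normalizer_le_normalizer_zpowers hloc hcard hP hyP hy hle)
    (normalizer_zpowers_le hP hle h54)] at h1
  have hn := P.card_eq_index_normalizer
  have hmul := (normalizer ((P : Subgroup G) : Set G)).card_mul_index
  change Nat.card (Sylow 3 G) = (normalizer ((P : Subgroup G) : Set G)).index at hn
  rw [← hn, hcard, h1] at hmul
  omega

/-- If some element of the Sylow subgroup does not have exponent 3, then few Sylow subgroups
contain the central element. -/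
theorem ncard_sylow_mem_le [Fact (Nat.Prime 3)] (hcard : Nat.card G = 95040) {P : Subgroup G}
    (hP : Nat.card P = 27) {y g : G} (hy : orderOf y = 3) (hle : P ≤ centralizer {y})
    (hgP : g ∈ P) (hg : g ^ 3 ≠ 1) : 2 * {Q : Sylow 3 G | y ∈ Q}.ncard ≤ 8 := by
  classical
  have h54 := (centralizer_data hloc hP hy hle).2
  have hex : ∀ Q : Sylow 3 G, ∃ h ∈ Q, orderOf h = 3 ∧ (Q : Subgroup G) ≤ centralizer {h} :=
    fun Q => exists_central (p := 3) (k := 3) (by norm_num) (card_sylow_three hcard Q)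
  choose z hzQ hz hzle using hex
  let Ω : Subgroup G :=
    { carrier := {u | u ∈ P ∧ u ^ 3 = 1}
      one_mem' := ⟨one_mem _, one_pow _⟩
      mul_mem' := fun {a b} ha hb =>
        ⟨mul_mem ha.1 hb.1, by rw [mul_cube hP ha.1 hb.1, ha.2, hb.2, one_mul]⟩
      inv_mem' := fun {a} ha => ⟨inv_mem ha.1, by rw [inv_pow, ha.2, inv_one]⟩ }
  have hΩP : Ω ≤ P := fun u hu => hu.1
  have hΩ : Nat.card Ω ≤ 9 := by
    have h1 := card_dvd_of_le hΩP
    rw [hP, show 27 = 3 ^ 3 by norm_num, Nat.dvd_prime_pow Nat.prime_three] at h1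
    obtain ⟨j, hj, h1⟩ := h1
    have h2 : j ≠ 3 := by
      rintro rfl
      have := eq_of_le_of_card_ge hΩP (by rw [h1, hP]; norm_num)
      exact hg ((this ▸ hgP : g ∈ Ω).2)
    rw [h1, show 9 = 3 ^ 2 by norm_num]
    exact Nat.pow_le_pow_right (by norm_num) (by omega)
  have hzΩ : ∀ Q : Sylow 3 G, y ∈ Q → z Q ∈ Ω := fun Q hQ =>
    ⟨mem_of_commute hP hle h54 (by
      rw [show 27 = 3 * 9 by norm_num, pow_mul, ← hz Q, pow_orderOf_eq_one, one_pow])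
      (mem_centralizer_singleton_iff.2 (mem_centralizer_singleton_iff.1 (hzle Q hQ)).symm), by
      rw [← hz Q, pow_orderOf_eq_one]⟩
  have hz1 : ∀ Q, z Q ≠ 1 := fun Q h => by
    have := hz Q
    rw [h, orderOf_one] at this
    omega
  have hinj : ∀ Q R : Sylow 3 G, (Q : Subgroup G) ≤ centralizer {z R} → Q = R := fun Q R h =>
    Sylow.ext (eq_of_le_centralizer (card_sylow_three hcard Q) (card_sylow_three hcard R) h
      (hzle R) (centralizer_data hloc (card_sylow_three hcard R) (hz R) (hzle R)).2)
  have hne : ∀ Q, z Q ≠ (z Q)⁻¹ := fun Q h => by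
    have h2 : (z Q) ^ 2 = 1 := by rw [pow_two, ← mul_inv_cancel (z Q), ← h]
    have := orderOf_dvd_of_pow_eq_one h2
    rw [hz Q] at this
    omega
  let f : {Q : Sylow 3 G | y ∈ Q} × Bool → {u : Ω // u ≠ 1} := fun x =>
    if x.2 then ⟨⟨z x.1, hzΩ _ x.1.2⟩, fun h => hz1 _ (congrArg Subtype.val h)⟩
    else ⟨⟨(z x.1)⁻¹, inv_mem (hzΩ _ x.1.2)⟩, fun h =>
      hz1 _ (inv_eq_one.1 (congrArg Subtype.val h))⟩
  have hf : Function.Injective f := by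
    rintro ⟨Q, b⟩ ⟨R, c⟩ h
    have h1 : (if b then z Q else (z Q)⁻¹) = if c then z R else (z R)⁻¹ := by
      have := congrArg (fun u : {u : Ω // u ≠ 1} => (u.1 : G)) h
      cases b <;> cases c <;> simpa [f] using this
    have hQR : Q = R := by
      refine Subtype.ext (hinj _ _ fun v hv => ?_)
      have h2 : Commute v (z Q) := mem_centralizer_singleton_iff.1 (hzle Q.1 hv)
      refine mem_centralizer_singleton_iff.2 (show Commute v (z R) from ?_)
      cases b <;> cases c <;> simp only [if_true, if_false, Bool.false_eq_true] at h1
      · rw [← inv_inj.1 h1]; exact h2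
      · rw [← h1]; exact h2.inv_right
      · rw [← inv_inv (z R), ← h1]; exact h2.inv_right
      · rw [← h1]; exact h2
    subst hQR
    congr
    cases b <;> cases c <;> simp only [if_true, if_false, Bool.false_eq_true] at h1 ⊢
    · exact (hne _ h1.symm).elim
    · exact (hne _ h1).elim
  have h1 := Nat.card_le_card_of_injective f hf
  have h2 : Nat.card {u : Ω // u ≠ 1} = Nat.card Ω - 1 := by
    have := Fintype.ofFinite Ω
    rw [Nat.card_eq_fintype_card, Nat.card_eq_fintype_card, Fintype.card_subtype_compl,
      Fintype.card_subtype_eq]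
  rw [h2, Nat.card_prod, Nat.card_coe_set_eq] at h1
  simp only [Nat.card_eq_fintype_card (α := Bool), Fintype.card_bool] at h1
  omega

/-- The Sylow 3-subgroups have exponent 3. -/
theorem cube_eq_one (hcard : Nat.card G = 95040) {P : Subgroup G} (hP : Nat.card P = 27) {u : G}
    (hu : u ∈ P) : u ^ 3 = 1 := by
  classical
  haveI : Fact (Nat.Prime 3) := ⟨Nat.prime_three⟩
  obtain ⟨P, rfl⟩ := exists_sylow_eq (p := 3) (k := 3) hP (by rw [hcard]; norm_num)
  by_contra hu3
  obtain ⟨g, hgP, hg⟩ : ∃ g ∈ P, orderOf (g ^ 3) = 3 := by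
    by_cases h9 : (u ^ 3) ^ 3 = 1
    · exact ⟨u, hu, orderOf_eq_prime h9 hu3⟩
    · refine ⟨u ^ 3, pow_mem hu 3, orderOf_eq_prime ?_ h9⟩
      rw [← pow_mul, ← pow_mul]
      exact pow_mem_of_card (p := 3) (k := 3) hP hu
  have hle := cube_central hP hgP
  have hg9 : orderOf g = 9 := by
    have h1 : g ^ 3 ^ 2 = 1 := by
      rw [show 3 ^ 2 = 3 * 3 by norm_num, pow_mul]
      nth_rewrite 2 [← hg]
      exact pow_orderOf_eq_one _
    have h2 : ¬ g ^ 3 ^ 1 = 1 := fun h => by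
      rw [pow_one] at h
      rw [h, orderOf_one] at hg
      omega
    exact orderOf_eq_prime_pow h2 h1
  have h8 := ncard_sylow_mem_le hloc hcard hP hg hle hgP (fun h => by
    rw [h, orderOf_one] at hg; omega)
  have hone : ∀ n, (g ^ 3) ^ n ≠ 1 → {Q : Sylow 3 G | g ^ n ∈ Q}.ncard = 1 := by
    intro n hn
    refine Set.ncard_eq_one.2 ⟨P, Set.eq_singleton_iff_unique_mem.2 ⟨pow_mem hgP n, fun Q hQ => ?_⟩⟩
    have h1 : orderOf ((g ^ n) ^ 3) = 3 := by
      rw [← pow_mul, mul_comm, pow_mul]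
      refine orderOf_eq_prime ?_ hn
      rw [← pow_mul, mul_comm, pow_mul, orderOf_dvd_iff_pow_eq_one.1 (dvd_of_eq hg), one_pow]
    have hPle := cube_central hP (pow_mem hgP n)
    exact Sylow.ext (eq_of_le_centralizer (card_sylow_three hcard Q) hP
      (cube_central (card_sylow_three hcard Q) hQ) hPle (centralizer_data hloc hP h1 hPle).2)
  have hsix : {Q : Sylow 3 G | g ^ 6 ∈ Q} = {Q : Sylow 3 G | g ^ 3 ∈ Q} := by
    ext Q
    refine ⟨fun h => ?_, fun h => ?_⟩
    · have := pow_mem (show g ^ 6 ∈ Q from h) 2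
      rwa [← pow_mul, show 6 * 2 = 9 + 3 by norm_num, pow_add, ← hg9, pow_orderOf_eq_one,
        one_mul] at this
    · have := pow_mem (show g ^ 3 ∈ Q from h) 2
      rwa [← pow_mul] at this
  have := Fintype.ofFinite (zpowers g)
  have hsum := card_dvd_sum_sylow (zpowers g) (k := 2) (by rw [Nat.card_zpowers, hg9]; norm_num)
  rw [← Fintype.sum_equiv (finEquivZPowers (isOfFinOrder_of_finite g))
    (fun i : Fin (orderOf g) => {Q : Sylow 3 G | g ^ (i : ℕ) ∈ Q}.ncard) _ (fun i => rfl),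
    Fin.sum_univ_eq_sum_range (fun i => {Q : Sylow 3 G | g ^ i ∈ Q}.ncard), hg9] at hsum
  have hpow : ∀ n, ¬ 3 ∣ n → (g ^ 3) ^ n ≠ 1 := fun n hn h => hn (by
    rw [← hg]; exact orderOf_dvd_of_pow_eq_one h)
  simp only [Finset.sum_range_succ, Finset.sum_range_zero, hsix, hone 1 (hpow 1 (by norm_num)),
    hone 2 (hpow 2 (by norm_num)), hone 4 (hpow 4 (by norm_num)), hone 5 (hpow 5 (by norm_num)),
    hone 7 (hpow 7 (by norm_num)), hone 8 (hpow 8 (by norm_num)), pow_zero, one_mem,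
    Set.setOf_true, Set.ncard_univ, card_sylow_eq hloc hcard P] at hsum
  omega

end LocalSubgroup

namespace LocalSubgroup
open Subgroup
variable {G : Type*} [Group G]

open Classical in
/-- The exponent `k` with `u * v = y ^ k * (v * u)`, for `y` of order 3. -/
noncomputable def commForm (y u v : G) : ZMod 3 :=
  if h : ∃ k : ℤ, u * v = y ^ k * (v * u) then (h.choose : ZMod 3) else 0

theorem commForm_eq {y u v : G} {k : ℤ} (hy : orderOf y = 3) (h : u * v = y ^ k * (v * u)) :
    commForm y u v = k := by
  have hex : ∃ k : ℤ, u * v = y ^ k * (v * u) := ⟨k, h⟩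
  rw [commForm, dif_pos hex, ← zpow_eq_zpow_iff_zmod hy]
  exact mul_right_cancel (hex.choose_spec.symm.trans h)

theorem commForm_conj {y n u v : G} {k e : ℤ} (hy : orderOf y = 3) (hn : n * y * n⁻¹ = y ^ e)
    (h : u * v = y ^ k * (v * u)) :
    commForm y (n * u * n⁻¹) (n * v * n⁻¹) = e * commForm y u v := by
  rw [commForm_eq hy h, commForm_eq (k := e * k) hy, Int.cast_mul]
  rw [zpow_mul, ← hn, conj_zpow, show n * u * n⁻¹ * (n * v * n⁻¹) = n * (u * v) * n⁻¹ by group, h]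
  group

theorem card_inf_centralizer [Finite G] {P : Subgroup G} (hP : Nat.card P = 27) {u v : G}
    (hu : u ∈ P) (hv : v ∈ P) (huv : u * v ≠ v * u) :
    Nat.card (P ⊓ centralizer {u} : Subgroup G) = 9 := by
  haveI : Fact (Nat.Prime 3) := ⟨Nat.prime_three⟩
  obtain ⟨y, hyP, hy, hle⟩ := exists_central (p := 3) (k := 3) (by norm_num) hP
  set E := P ⊓ centralizer {u} with hE
  have huE : u ∈ E := ⟨hu, mem_centralizer_singleton_iff.2 rfl⟩
  have hyE : zpowers y ≤ E := zpowers_le.2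
    ⟨hyP, mem_centralizer_singleton_iff.2 (mem_centralizer_singleton_iff.1 (hle hu)).symm⟩
  have h1 := card_dvd_of_le (inf_le_left : E ≤ P)
  rw [hP, show 27 = 3 ^ 3 by norm_num, Nat.dvd_prime_pow Nat.prime_three] at h1
  obtain ⟨j, hj, h1⟩ := h1
  have h3 : j ≠ 3 := by
    rintro rfl
    have h2 := eq_of_le_of_card_ge (inf_le_left : E ≤ P) (by rw [h1, hP]; norm_num)
    rw [← h2] at hv
    exact huv (mem_centralizer_singleton_iff.1 hv.2).symm
  have hlt : ¬ j ≤ 1 := by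
    intro hj1
    have h2 := eq_of_le_of_card_ge hyE (by
      rw [h1, Nat.card_zpowers, hy]
      exact Nat.pow_le_pow_right (by norm_num) hj1)
    rw [← h2] at huE
    obtain ⟨k, rfl⟩ := huE
    have h4 : Commute v y := mem_centralizer_singleton_iff.1 (hle hv)
    exact huv (h4.zpow_right k).eq.symm
  obtain rfl : j = 2 := by omega
  rw [h1]; norm_num

section Form
variable [Finite G] {P : Subgroup G} {y : G} (hP : Nat.card P = 27) (hyP : y ∈ P)
  (hy : orderOf y = 3) (hle : P ≤ centralizer {y})
include hP hyP hy hle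

theorem exists_commForm {u v : G} (hu : u ∈ P) (hv : v ∈ P) :
    ∃ k : ℤ, u * v = y ^ k * (v * u) ∧ commForm y u v = k := by
  obtain ⟨k, hk⟩ := commutator_mem_zpowers hP hyP hy hle hu hv
  simp only at hk
  have h : u * v = y ^ k * (v * u) := by rw [hk]; group
  exact ⟨k, h, commForm_eq hy h⟩

theorem commForm_eq_zero_iff {u v : G} (hu : u ∈ P) (hv : v ∈ P) :
    commForm y u v = 0 ↔ u * v = v * u := by
  obtain ⟨k, h1, h2⟩ := exists_commForm hP hyP hy hle hu hv
  rw [h2, h1, mul_eq_right, ← zpow_zero y, zpow_eq_zpow_iff_zmod hy, Int.cast_zero]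

theorem commForm_self {u : G} (hu : u ∈ P) : commForm y u u = 0 :=
  (commForm_eq_zero_iff hP hyP hy hle hu hu).2 rfl

theorem commForm_swap {u v : G} (hu : u ∈ P) (hv : v ∈ P) : commForm y v u = -commForm y u v := by
  obtain ⟨k, h1, h2⟩ := exists_commForm hP hyP hy hle hu hv
  rw [h2, commForm_eq (k := -k) hy, Int.cast_neg]
  rw [h1, zpow_neg, inv_mul_cancel_left]

theorem commForm_mul_left {u u' v : G} (hu : u ∈ P) (hu' : u' ∈ P) (hv : v ∈ P) :
    commForm y (u * u') v = commForm y u v + commForm y u' v := by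
  obtain ⟨k, h1, h2⟩ := exists_commForm hP hyP hy hle hu hv
  obtain ⟨l, h3, h4⟩ := exists_commForm hP hyP hy hle hu' hv
  have hc : Commute u (y ^ l) :=
    (show Commute u y from mem_centralizer_singleton_iff.1 (hle hu)).zpow_right l
  rw [h2, h4, commForm_eq (k := k + l) hy, Int.cast_add]
  rw [mul_assoc, h3, ← mul_assoc, hc.eq, mul_assoc, ← mul_assoc u, h1, add_comm, zpow_add]
  simp only [mul_assoc]

theorem commForm_mul_right {u v v' : G} (hu : u ∈ P) (hv : v ∈ P) (hv' : v' ∈ P) :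
    commForm y u (v * v') = commForm y u v + commForm y u v' := by
  rw [commForm_swap hP hyP hy hle (mul_mem hv hv') hu, commForm_mul_left hP hyP hy hle hv hv' hu,
    commForm_swap hP hyP hy hle hu hv, commForm_swap hP hyP hy hle hu hv']
  ring

theorem commForm_pow_left {u v : G} (hu : u ∈ P) (hv : v ∈ P) (n : ℕ) :
    commForm y (u ^ n) v = n * commForm y u v := by
  induction n with
  | zero =>
    rw [pow_zero, Nat.cast_zero, zero_mul, commForm_eq_zero_iff hP hyP hy hle (one_mem _) hv,
      one_mul, mul_one]
  | succ n ih =>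
    rw [pow_succ, commForm_mul_left hP hyP hy hle (pow_mem hu n) hu hv, ih]
    push_cast
    ring

theorem commForm_pow_right {u v : G} (hu : u ∈ P) (hv : v ∈ P) (n : ℕ) :
    commForm y u (v ^ n) = n * commForm y u v := by
  rw [commForm_swap hP hyP hy hle (pow_mem hv n) hu, commForm_pow_left hP hyP hy hle hv hu,
    commForm_swap hP hyP hy hle hu hv]
  ring

theorem commForm_conj_mem {p u v : G} (hp : p ∈ P) (hu : u ∈ P) (hv : v ∈ P) :
    commForm y (p * u * p⁻¹) v = commForm y u v := by
  have h1 := commForm_mul_left hP hyP hy hle (mul_mem (mul_mem hp hu) (inv_mem hp)) hp hv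
  rw [inv_mul_cancel_right, commForm_mul_left hP hyP hy hle hp hu hv] at h1
  linear_combination -h1

theorem commForm_eq_zero_of_orthogonal {b v x x' : G} (hb : b ∈ P) (hv : v ∈ P)
    (hbv : commForm y b v ≠ 0) (hx : x ∈ P) (hx' : x' ∈ P) (hbx : commForm y b x = 0)
    (hbx' : commForm y b x' = 0) : commForm y x x' = 0 := by
  rw [Ne, commForm_eq_zero_iff hP hyP hy hle hb hv] at hbv
  rw [commForm_eq_zero_iff hP hyP hy hle hb hx] at hbx
  rw [commForm_eq_zero_iff hP hyP hy hle hb hx'] at hbx'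
  rw [commForm_eq_zero_iff hP hyP hy hle hx hx']
  exact commute_of_card_nine (card_inf_centralizer hP hb hv hbv)
    ⟨hx, mem_centralizer_singleton_iff.2 hbx.symm⟩ ⟨hx', mem_centralizer_singleton_iff.2 hbx'.symm⟩

theorem commForm_eq_zero_of_basis {a b w v : G} (ha : a ∈ P) (hb : b ∈ P)
    (hab : commForm y a b = 1) (hw : w ∈ P) (hv : v ∈ P) (hwb : commForm y w b = 0)
    (hwa : commForm y a w = 0) : commForm y w v = 0 := by
  by_contra h
  have h1 := commForm_eq_zero_of_orthogonal hP hyP hy hle hw hv h ha hb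
    (by rw [commForm_swap hP hyP hy hle ha hw, hwa, neg_zero]) hwb
  rw [hab] at h1
  exact one_ne_zero h1

/-- The form in coordinates. -/
theorem commForm_eq_det {a b u v : G} (ha : a ∈ P) (hb : b ∈ P) (hab : commForm y a b = 1)
    (hu : u ∈ P) (hv : v ∈ P) : commForm y u v =
      commForm y u b * commForm y a v - commForm y v b * commForm y a u := by
  have hA : a ^ (-commForm y u b).val ∈ P := pow_mem ha _
  have hB : b ^ (-commForm y a u).val ∈ P := pow_mem hb _
  have key : ∀ w ∈ P, commForm y (u * a ^ (-commForm y u b).val * b ^ (-commForm y a u).val) w =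
      commForm y u w - commForm y u b * commForm y a w - commForm y a u * commForm y b w := by
    intro w hw
    rw [commForm_mul_left hP hyP hy hle (mul_mem hu hA) hB hw,
      commForm_mul_left hP hyP hy hle hu hA hw, commForm_pow_left hP hyP hy hle ha hw,
      commForm_pow_left hP hyP hy hle hb hw, ZMod.natCast_zmod_val, ZMod.natCast_zmod_val]
    ring
  have hW := mul_mem (mul_mem hu hA) hB
  have h1 := commForm_eq_zero_of_basis hP hyP hy hle ha hb hab hW hv
    (by rw [key b hb, hab, commForm_self hP hyP hy hle hb]; ring)
    (by
      rw [commForm_swap hP hyP hy hle hW ha, key a ha, commForm_self hP hyP hy hle ha,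
        commForm_swap hP hyP hy hle ha hb, commForm_swap hP hyP hy hle ha hu, hab]
      ring)
  rw [key v hv] at h1
  rw [commForm_swap hP hyP hy hle hv hb] at h1
  linear_combination h1

end Form

end LocalSubgroup

namespace LocalSubgroup
open Subgroup
variable {G : Type*} [Group G]

theorem conj_mem_of_mem_normalizer {P : Subgroup G} {n u : G} (hn : n ∈ normalizer (P : Set G))
    (hu : u ∈ P) : n * u * n⁻¹ ∈ P := (mem_normalizer_iff.1 hn u).1 hu

theorem scalar_of_involution : ∀ p q r s : ZMod 3, p * s - r * q = 1 → p * p + q * r = 1 →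
    q * (p + s) = 0 → r * (p + s) = 0 →
    ∃ e : ZMod 3, e * e = 1 ∧ p = e ∧ s = e ∧ q = 0 ∧ r = 0 := by decide

theorem exists_eigenbasis : ∀ p q r s e : ZMod 3, p * s - r * q = -1 → e * e = 1 →
    p * p + q * r = e → q * (p + s) = 0 → r * (p + s) = 0 →
    ∃ x₁ y₁ x₂ y₂ : ZMod 3, x₁ * y₂ - x₂ * y₁ = 1 ∧ x₁ * p + y₁ * r = x₁ ∧ x₁ * q + y₁ * s = y₁ ∧
      x₂ * p + y₂ * r = -x₂ ∧ x₂ * q + y₂ * s = -y₂ := by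
  intro p q r s e h1 he h2 h3 h4
  have hs : s = -p := by
    clear h2
    revert p q r s
    decide
  subst hs
  have he1 : e = 1 := by linear_combination -h2 - h1
  subst he1
  clear h3 h4 he h2
  revert p q r
  decide

section Form
variable [Finite G] {P : Subgroup G} {y : G} (hP : Nat.card P = 27) (hyP : y ∈ P)
  (hy : orderOf y = 3) (hle : P ≤ centralizer {y})
include hP hyP hy hle

theorem commForm_conj_conj {n u v : G} {e : ℤ} (hn : n * y * n⁻¹ = y ^ e) (hu : u ∈ P)
    (hv : v ∈ P) : commForm y (n * u * n⁻¹) (n * v * n⁻¹) = e * commForm y u v := by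
  obtain ⟨k, h, -⟩ := exists_commForm hP hyP hy hle hu hv
  exact commForm_conj hy hn h

variable {a b : G} (ha : a ∈ P) (hb : b ∈ P) (hab : commForm y a b = 1)
include ha hb hab

theorem det_conj {n : G} {e : ℤ} (hnP : n ∈ normalizer (P : Set G)) (hn : n * y * n⁻¹ = y ^ e) :
    commForm y (n * a * n⁻¹) b * commForm y a (n * b * n⁻¹) -
      commForm y (n * b * n⁻¹) b * commForm y a (n * a * n⁻¹) = e := by
  rw [← commForm_eq_det hP hyP hy hle ha hb hab (conj_mem_of_mem_normalizer hnP ha)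
    (conj_mem_of_mem_normalizer hnP hb), commForm_conj_conj hP hyP hy hle hn ha hb, hab, mul_one]

/-- Conjugation acts linearly on the coordinates. -/
theorem coord_conj {n : G} {e : ℤ} (he : (e : ZMod 3) * e = 1) (hnP : n ∈ normalizer (P : Set G))
    (hn : n * y * n⁻¹ = y ^ e) {u : G} (hu : u ∈ P) :
    commForm y (n * u * n⁻¹) b = commForm y u b * commForm y (n * a * n⁻¹) b +
      commForm y a u * commForm y (n * b * n⁻¹) b ∧
    commForm y a (n * u * n⁻¹) = commForm y u b * commForm y a (n * a * n⁻¹) +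
      commForm y a u * commForm y a (n * b * n⁻¹) := by
  have hdet := det_conj hP hyP hy hle ha hb hab hnP hn
  have hu' := conj_mem_of_mem_normalizer hnP hu
  have h1 := commForm_conj_conj hP hyP hy hle hn hu ha
  have h2 := commForm_conj_conj hP hyP hy hle hn hu hb
  rw [commForm_eq_det hP hyP hy hle ha hb hab hu' (conj_mem_of_mem_normalizer hnP ha),
    commForm_swap hP hyP hy hle ha hu] at h1
  rw [commForm_eq_det hP hyP hy hle ha hb hab hu' (conj_mem_of_mem_normalizer hnP hb)] at h2
  generalize commForm y (n * u * n⁻¹) b = X' at *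
  generalize commForm y a (n * u * n⁻¹) = Y' at *
  generalize commForm y (n * a * n⁻¹) b = p at *
  generalize commForm y a (n * a * n⁻¹) = q at *
  generalize commForm y (n * b * n⁻¹) b = r at *
  generalize commForm y a (n * b * n⁻¹) = s at *
  generalize commForm y u b = X at *
  generalize commForm y a u = Y at *
  generalize (e : ZMod 3) = e at *
  constructor
  · linear_combination e * p * h2 - e * r * h1 - e * X' * hdet - (X' - X * p - Y * r) * he
  · linear_combination e * q * h2 - e * s * h1 - e * Y' * hdet - (Y' - X * q - Y * s) * he

theorem coord_conj_mem {p u : G} (hp : p ∈ P) (hu : u ∈ P) :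
    commForm y (p * u * p⁻¹) b = commForm y u b ∧ commForm y a (p * u * p⁻¹) = commForm y a u := by
  have hpu : p * u * p⁻¹ ∈ P := mul_mem (mul_mem hp hu) (inv_mem hp)
  refine ⟨commForm_conj_mem hP hyP hy hle hp hu hb, ?_⟩
  rw [commForm_swap hP hyP hy hle hpu ha, commForm_conj_mem hP hyP hy hle hp hu ha,
    commForm_swap hP hyP hy hle ha hu, neg_neg]

theorem coord_self : commForm y a a = 0 ∧ commForm y b b = 0 :=
  ⟨commForm_self hP hyP hy hle ha, commForm_self hP hyP hy hle hb⟩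

/-- Conjugation by elements of the centralizer of the center acts as a sign. -/
theorem coord_conj_of_commute {c : G} (hcP : c ∈ normalizer (P : Set G)) (hc : c * y * c⁻¹ = y)
    (hc2 : c ^ 2 ∈ P) : ∃ e : ZMod 3, e * e = 1 ∧ ∀ u ∈ P,
      commForm y (c * u * c⁻¹) b = e * commForm y u b ∧
      commForm y a (c * u * c⁻¹) = e * commForm y a u := by
  have hc' : c * y * c⁻¹ = y ^ (1 : ℤ) := by rw [hc, zpow_one]
  have hdet := det_conj hP hyP hy hle ha hb hab hcP hc'
  have hco := fun {u : G} => coord_conj hP hyP hy hle ha hb hab (by simp) hcP hc' (u := u)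
  have hsq : ∀ u, c ^ 2 * u * (c ^ 2)⁻¹ = c * (c * u * c⁻¹) * c⁻¹ := fun u => by
    rw [pow_two]; group
  obtain ⟨haa, hbb⟩ := coord_self hP hyP hy hle ha hb hab
  have ha2 := coord_conj_mem hP hyP hy hle ha hb hab hc2 ha
  have hb2 := coord_conj_mem hP hyP hy hle ha hb hab hc2 hb
  rw [hsq, (hco (conj_mem_of_mem_normalizer hcP ha)).1, (hco (conj_mem_of_mem_normalizer hcP ha)).2,
    hab, haa] at ha2
  rw [hsq, (hco (conj_mem_of_mem_normalizer hcP hb)).1, (hco (conj_mem_of_mem_normalizer hcP hb)).2,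
    hab, hbb] at hb2
  push_cast at hdet
  obtain ⟨e, he, h1, h2, h3, h4⟩ := scalar_of_involution _ _ _ _ hdet ha2.1
    (by linear_combination ha2.2) (by linear_combination hb2.1)
  refine ⟨e, he, fun u hu => ?_⟩
  rw [(hco hu).1, (hco hu).2, h1, h2, h3, h4]
  constructor <;> ring

end Form

section Adapted
variable [Finite G] {P : Subgroup G} {y : G} (hP : Nat.card P = 27) (hyP : y ∈ P)
  (hy : orderOf y = 3) (hle : P ≤ centralizer {y})
  (hsq : ∀ c ∈ centralizer {y}, c ^ 2 ∈ P)
include hP hyP hy hle hsq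

theorem exists_adapted_basis (hnc : ∃ u ∈ P, ∃ v ∈ P, u * v ≠ v * u) {t : G}
    (htP : t ∈ normalizer (P : Set G)) (ht : t * y * t⁻¹ = y⁻¹) :
    ∃ a ∈ P, ∃ b ∈ P, commForm y a b = 1 ∧ ∀ u ∈ P,
      commForm y (t * u * t⁻¹) b = commForm y u b ∧
      commForm y a (t * u * t⁻¹) = -commForm y a u := by
  obtain ⟨a, ha, b, hb, hab⟩ : ∃ a ∈ P, ∃ b ∈ P, commForm y a b = 1 := by
    obtain ⟨u, hu, v, hv, huv⟩ := hnc
    rw [Ne, ← commForm_eq_zero_iff hP hyP hy hle hu hv] at huv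
    have h3 : ∀ k : ZMod 3, k ≠ 0 → k = 1 ∨ -k = 1 := by decide
    rcases h3 _ huv with h | h
    · exact ⟨u, hu, v, hv, h⟩
    · exact ⟨v, hv, u, hu, by rw [commForm_swap hP hyP hy hle hu hv, h]⟩
  have ht' : t * y * t⁻¹ = y ^ (-1 : ℤ) := by rw [ht, zpow_neg_one]
  have hdet := det_conj hP hyP hy hle ha hb hab htP ht'
  have hco := fun {a b : G} (ha : a ∈ P) (hb : b ∈ P) (hab : commForm y a b = 1) {u : G} =>
    coord_conj hP hyP hy hle ha hb hab (by push_cast; ring) htP ht' (u := u)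
  have hsq' : ∀ u, t ^ 2 * u * (t ^ 2)⁻¹ = t * (t * u * t⁻¹) * t⁻¹ := fun u => by
    rw [pow_two]; group
  have ht2 : t ^ 2 * y * (t ^ 2)⁻¹ = y := by
    rw [hsq', ht, ← conj_inv, ht, inv_inv]
  obtain ⟨e, he, hT⟩ := coord_conj_of_commute hP hyP hy hle ha hb hab (pow_mem htP 2) ht2
    (hsq _ (mem_centralizer_singleton_iff.2 (mul_inv_eq_iff_eq_mul.1 ht2)))
  obtain ⟨haa, hbb⟩ := coord_self hP hyP hy hle ha hb hab
  have ha2 := hT a ha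
  have hb2 := hT b hb
  rw [hsq', (hco ha hb hab (conj_mem_of_mem_normalizer htP ha)).1,
    (hco ha hb hab (conj_mem_of_mem_normalizer htP ha)).2, hab, haa] at ha2
  rw [hsq', (hco ha hb hab (conj_mem_of_mem_normalizer htP hb)).1,
    (hco ha hb hab (conj_mem_of_mem_normalizer htP hb)).2, hab, hbb] at hb2
  push_cast at hdet
  obtain ⟨x₁, y₁, x₂, y₂, hd, h1, h2, h3, h4⟩ := exists_eigenbasis _ _ _ _ e hdet he
    (by linear_combination ha2.1) (by linear_combination ha2.2) (by linear_combination hb2.1)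
  have hmem : ∀ i j : ℕ, a ^ i * b ^ j ∈ P := fun i j => mul_mem (pow_mem ha _) (pow_mem hb _)
  have hX : ∀ x z : ZMod 3, commForm y (a ^ x.val * b ^ z.val) b = x := fun x z => by
    rw [commForm_mul_left hP hyP hy hle (pow_mem ha _) (pow_mem hb _) hb,
      commForm_pow_left hP hyP hy hle ha hb, commForm_pow_left hP hyP hy hle hb hb, hab, hbb,
      ZMod.natCast_zmod_val]
    ring
  have hY : ∀ x z : ZMod 3, commForm y a (a ^ x.val * b ^ z.val) = z := fun x z => by
    rw [commForm_mul_right hP hyP hy hle ha (pow_mem ha _) (pow_mem hb _),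
      commForm_pow_right hP hyP hy hle ha ha, commForm_pow_right hP hyP hy hle ha hb, hab, haa,
      ZMod.natCast_zmod_val, ZMod.natCast_zmod_val]
    ring
  refine ⟨_, hmem x₁.val y₁.val, _, hmem x₂.val y₂.val, ?_, fun u hu => ?_⟩
  · rw [commForm_eq_det hP hyP hy hle ha hb hab (hmem _ _) (hmem _ _), hX, hX, hY, hY, hd]
  · have hu' := conj_mem_of_mem_normalizer htP hu
    obtain ⟨hcX, hcY⟩ := hco ha hb hab hu
    rw [commForm_eq_det hP hyP hy hle ha hb hab hu' (hmem _ _),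
      commForm_eq_det hP hyP hy hle ha hb hab (hmem _ _) hu',
      commForm_eq_det hP hyP hy hle ha hb hab hu (hmem _ _),
      commForm_eq_det hP hyP hy hle ha hb hab (hmem _ _) hu, hX, hX, hY, hY, hcX, hcY]
    generalize commForm y (t * a * t⁻¹) b = p at *
    generalize commForm y a (t * a * t⁻¹) = q at *
    generalize commForm y (t * b * t⁻¹) b = r at *
    generalize commForm y a (t * b * t⁻¹) = s at *
    generalize commForm y u b = X at *
    generalize commForm y a u = Y at *
    constructor
    · linear_combination (X * p + Y * r) * h4 - (X * q + Y * s) * h3 - (X * y₂ - x₂ * Y) * hdet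
    · linear_combination (X * p + Y * r) * h2 - (X * q + Y * s) * h1 - (X * y₁ - x₁ * Y) * hdet

/-- All automorphisms induced on the Sylow subgroup are diagonal in an adapted basis. -/
theorem coord_conj_of_adapted {t a b n : G} (htP : t ∈ normalizer (P : Set G))
    (ht : t * y * t⁻¹ = y⁻¹) (ha : a ∈ P) (hb : b ∈ P) (hab : commForm y a b = 1)
    (hT : ∀ u ∈ P, commForm y (t * u * t⁻¹) b = commForm y u b ∧
      commForm y a (t * u * t⁻¹) = -commForm y a u)
    (hnP : n ∈ normalizer (P : Set G)) (hn : n * y * n⁻¹ = y ∨ n * y * n⁻¹ = y⁻¹) :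
    ∃ d e : ZMod 3, d * d = 1 ∧ e * e = 1 ∧ ∀ u ∈ P,
      commForm y (n * u * n⁻¹) b = d * commForm y u b ∧
      commForm y a (n * u * n⁻¹) = e * commForm y a u := by
  have hc : ∀ c ∈ normalizer (P : Set G), c * y * c⁻¹ = y → ∃ e : ZMod 3, e * e = 1 ∧ ∀ u ∈ P,
      commForm y (c * u * c⁻¹) b = e * commForm y u b ∧
      commForm y a (c * u * c⁻¹) = e * commForm y a u := fun c hcP hcy =>
    coord_conj_of_commute hP hyP hy hle ha hb hab hcP hcy
      (hsq _ (mem_centralizer_singleton_iff.2 (mul_inv_eq_iff_eq_mul.1 hcy)))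
  rcases hn with hn | hn
  · obtain ⟨e, he, h⟩ := hc n hnP hn
    exact ⟨e, e, he, he, h⟩
  · have ht' : t⁻¹ * y * t = y⁻¹ := by
      have h : y = t * y⁻¹ * t⁻¹ := by rw [← conj_inv, ht, inv_inv]
      nth_rewrite 1 [h]
      group
    obtain ⟨e, he, h⟩ := hc (n * t⁻¹) (mul_mem hnP (inv_mem htP)) (by
      rw [show n * t⁻¹ * y * (n * t⁻¹)⁻¹ = n * (t⁻¹ * y * t) * n⁻¹ by group, ht', ← conj_inv, hn,
        inv_inv])
    refine ⟨e, -e, he, by rw [neg_mul_neg, he], fun u hu => ?_⟩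
    have h1 := h _ (conj_mem_of_mem_normalizer htP hu)
    rw [show n * t⁻¹ * (t * u * t⁻¹) * (n * t⁻¹)⁻¹ = n * u * n⁻¹ by group, (hT u hu).1,
      (hT u hu).2] at h1
    exact ⟨h1.1, by rw [h1.2]; ring⟩

end Adapted

end LocalSubgroup

namespace LocalSubgroup
open Subgroup
variable {G : Type*} [Group G]

theorem map_conj_inf_centralizer {P : Subgroup G} {n : G} (hn : n ∈ normalizer (P : Set G))
    (u : G) : (P ⊓ centralizer {u}).map (MulAut.conj n).toMonoidHom =
      P ⊓ centralizer {n * u * n⁻¹} := by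
  have hle : ∀ m ∈ normalizer (P : Set G), ∀ u v, v ∈ P ⊓ centralizer {u} →
      m * v * m⁻¹ ∈ P ⊓ centralizer {m * u * m⁻¹} := by
    intro m hm u v hv
    have h1 : Commute v u := mem_centralizer_singleton_iff.1 hv.2
    have h2 : Commute (m * v * m⁻¹) (m * u * m⁻¹) := h1.map (MulAut.conj m)
    exact ⟨conj_mem_of_mem_normalizer hm hv.1, mem_centralizer_singleton_iff.2 h2⟩
  ext w
  constructor
  · rintro ⟨v, hv, rfl⟩
    exact hle n hn u v hv
  · intro hw
    have h1 := hle n⁻¹ (inv_mem hn) _ _ hw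
    rw [show n⁻¹ * (n * u * n⁻¹) * n⁻¹⁻¹ = u by group] at h1
    refine ⟨_, h1, ?_⟩
    change n * (n⁻¹ * w * n⁻¹⁻¹) * n⁻¹ = w
    group

theorem map_conj_mul (E : Subgroup G) (g h : G) :
    E.map (MulAut.conj (g * h)).toMonoidHom =
      (E.map (MulAut.conj h).toMonoidHom).map (MulAut.conj g).toMonoidHom := by
  rw [Subgroup.map_map]
  congr 1
  ext z
  simp [mul_assoc]

theorem map_conj_of_mem_normalizer {E : Subgroup G} {n : G} (hn : n ∈ normalizer (E : Set G)) :
    E.map (MulAut.conj n).toMonoidHom = E := by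
  ext w
  constructor
  · rintro ⟨v, hv, rfl⟩
    exact conj_mem_of_mem_normalizer hn hv
  · intro hw
    refine ⟨_, conj_mem_of_mem_normalizer (inv_mem hn) hw, ?_⟩
    simp [mul_assoc]

/-- Normal subgroups of a Sylow subgroup that are conjugate are conjugate in its normalizer. -/
theorem exists_normalizer_conj [Finite G] {p : ℕ} [Fact p.Prime] (P : Sylow p G) {E F : Subgroup G}
    (hE : (P : Subgroup G) ≤ normalizer (E : Set G))
    (hF : (P : Subgroup G) ≤ normalizer (F : Set G)) {g : G}
    (hg : E.map (MulAut.conj g).toMonoidHom = F) :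
    ∃ n ∈ normalizer ((P : Subgroup G) : Set G), E.map (MulAut.conj n).toMonoidHom = F := by
  have hQ : ((g • P : Sylow p G) : Subgroup G) ≤ normalizer (F : Set G) := by
    rintro _ ⟨u, hu, rfl⟩
    rw [mem_normalizer_iff]
    intro z
    have h1 : ∀ w, w ∈ F ↔ g⁻¹ * w * g ∈ E := fun w => by
      rw [← hg]
      constructor
      · rintro ⟨v, hv, rfl⟩
        simpa [mul_assoc] using hv
      · exact fun h => ⟨_, h, by simp [mul_assoc]⟩
    have h2 := mem_normalizer_iff.1 (hE hu) (g⁻¹ * z * g)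
    rw [h1, h1, h2]
    have h3 : g⁻¹ * (MulAut.conj g u * z * (MulAut.conj g u)⁻¹) * g =
        u * (g⁻¹ * z * g) * u⁻¹ := by
      simp only [MulAut.conj_apply]; group
    change _ ↔ g⁻¹ * (MulAut.conj g u * z * (MulAut.conj g u)⁻¹) * g ∈ E
    rw [h3]
  obtain ⟨n, hn⟩ := MulAction.exists_smul_eq (normalizer (F : Set G)) ((g • P).subtype hQ)
    (P.subtype hF)
  have h4 : ((n : G) * g) • P = P := by
    rw [Sylow.smul_subtype] at hn
    rw [mul_smul]
    exact Sylow.subtype_injective hn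
  refine ⟨n * g, Sylow.smul_eq_iff_mem_normalizer.1 h4, ?_⟩
  rw [map_conj_mul, hg]
  exact map_conj_of_mem_normalizer n.2

section
variable [Finite G] {P : Subgroup G} {y : G} (hP : Nat.card P = 27) (hyP : y ∈ P)
  (hy : orderOf y = 3) (hle : P ≤ centralizer {y})
include hP hyP hy hle

theorem le_normalizer_of_card_nine {E : Subgroup G} (hEP : E ≤ P) (hyE : y ∈ E) :
    P ≤ normalizer (E : Set G) := by
  have key : ∀ p ∈ P, ∀ z ∈ E, p * z * p⁻¹ ∈ E := fun p hp z hz => by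
    have h1 := zpowers_le.2 hyE (commutator_mem_zpowers hP hyP hy hle hp (hEP hz))
    simpa using mul_mem h1 hz
  intro p hp
  rw [mem_normalizer_iff]
  refine fun z => ⟨key p hp z, fun h => ?_⟩
  have := key p⁻¹ (inv_mem hp) _ h
  simpa [mul_assoc] using this

theorem mem_inf_centralizer_iff {u v : G} (hu : u ∈ P) (hv : v ∈ P) :
    v ∈ P ⊓ centralizer {u} ↔ commForm y u v = 0 := by
  rw [commForm_eq_zero_iff hP hyP hy hle hu hv, mem_inf, mem_centralizer_singleton_iff, eq_comm]
  exact and_iff_right hv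

theorem inf_centralizer_eq {u v w w' : G} (hu : u ∈ P) (hv : v ∈ P) (hw : w ∈ P) (hw' : w' ∈ P)
    (huw : commForm y u w ≠ 0) (hvw : commForm y v w' ≠ 0) (huv : commForm y u v = 0) :
    P ⊓ centralizer {u} = P ⊓ centralizer {v} := by
  have key : ∀ u v w, u ∈ P → v ∈ P → w ∈ P → commForm y u w ≠ 0 → commForm y u v = 0 →
      P ⊓ centralizer {u} ≤ P ⊓ centralizer {v} := by
    intro u v w hu hv hw huw huv z hz
    exact (mem_inf_centralizer_iff hP hyP hy hle hv hz.1).2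
      (commForm_eq_zero_of_orthogonal hP hyP hy hle hu hw huw hv hz.1 huv
        ((mem_inf_centralizer_iff hP hyP hy hle hu hz.1).1 hz))
  exact le_antisymm (key u v w hu hv hw huw huv) (key v u w' hv hu hw' hvw
    (by rw [commForm_swap hP hyP hy hle hu hv, huv, neg_zero]))

/-- Subgroups of order 9 are the centralizers of their noncentral elements. -/
theorem exists_eq_inf_centralizer (hnc : ∃ u ∈ P, ∃ v ∈ P, u * v ≠ v * u)
    (h3 : ∀ u ∈ P, u ^ 3 = 1) {E : Subgroup G} (hEP : E ≤ P) (hE : Nat.card E = 9) :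
    ∃ u ∈ P, ∃ v ∈ P, commForm y u v ≠ 0 ∧ E = P ⊓ centralizer {u} := by
  haveI : Fact (Nat.Prime 3) := ⟨Nat.prime_three⟩
  obtain ⟨u, hu, v, hv, huv⟩ : ∃ u ∈ E, ∃ v ∈ P, u * v ≠ v * u := by
    by_contra! h
    have hEy : E ≤ zpowers y := fun u hu => by
      by_cases h1 : u = 1
      · rw [h1]; exact one_mem _
      · exact central_mem_zpowers hP hnc hyP hy hle (hEP hu)
          (orderOf_eq_prime (h3 u (hEP hu)) h1)
          (fun v hv => mem_centralizer_singleton_iff.2 (h u hu v hv).symm)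
    have := card_dvd_of_le hEy
    rw [hE, Nat.card_zpowers, hy] at this
    omega
  refine ⟨u, hEP hu, v, hv, mt (commForm_eq_zero_iff hP hyP hy hle (hEP hu) hv).1 huv,
    eq_of_le_of_card_ge (fun w hw => ⟨hEP hw, mem_centralizer_singleton_iff.2
      (commute_of_card_nine hE hw hu)⟩) ?_⟩
  rw [hE, card_inf_centralizer hP (hEP hu) hv huv]

end

end LocalSubgroup

namespace LocalSubgroup
open Subgroup
variable {G : Type*} [Group G]

theorem isConjSubgroup_equivalence : Equivalence (IsConjSubgroup (G := G)) where
  refl E := ⟨1, map_conj_of_mem_normalizer (one_mem _)⟩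
  symm := by
    rintro E _ ⟨g, rfl⟩
    refine ⟨g⁻¹, ?_⟩
    rw [← map_conj_mul, inv_mul_cancel]
    exact map_conj_of_mem_normalizer (one_mem _)
  trans := by
    rintro E _ _ ⟨g, rfl⟩ ⟨h, rfl⟩
    exact ⟨h * g, map_conj_mul _ _ _⟩

/-- The quotient by conjugacy has three elements if there are three pairwise non-conjugate
representatives. -/
theorem card_quot_eq_three {S : Subgroup G → Prop} {A B C : Subgroup G} (hA : S A) (hB : S B)
    (hC : S C) (hAB : ¬ IsConjSubgroup A B) (hAC : ¬ IsConjSubgroup A C)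
    (hBC : ¬ IsConjSubgroup B C)
    (h : ∀ E, S E → IsConjSubgroup E A ∨ IsConjSubgroup E B ∨ IsConjSubgroup E C) :
    Nat.card (Quot (fun E F : {E : Subgroup G // S E} => IsConjSubgroup E.1 F.1)) = 3 := by
  have hequiv : Equivalence (fun E F : {E : Subgroup G // S E} => IsConjSubgroup E.1 F.1) :=
    ⟨fun E => isConjSubgroup_equivalence.refl E.1, fun h => isConjSubgroup_equivalence.symm h,
      fun h h' => isConjSubgroup_equivalence.trans h h'⟩
  let R : Fin 3 → {E : Subgroup G // S E} := ![⟨A, hA⟩, ⟨B, hB⟩, ⟨C, hC⟩]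
  have hsymm : ∀ {E F : Subgroup G}, IsConjSubgroup E F → IsConjSubgroup F E :=
    fun h => isConjSubgroup_equivalence.symm h
  have hbij : Function.Bijective (fun i => Quot.mk
      (fun E F : {E : Subgroup G // S E} => IsConjSubgroup E.1 F.1) (R i)) := by
    refine ⟨fun i j hij => ?_, fun x => ?_⟩
    · have h1 : IsConjSubgroup (R i).1 (R j).1 :=
        hequiv.eqvGen_iff.1 (Quot.eqvGen_exact hij)
      fin_cases i <;> fin_cases j
      · rfl
      · exact (hAB h1).elim
      · exact (hAC h1).elim
      · exact (hAB (hsymm h1)).elim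
      · rfl
      · exact (hBC h1).elim
      · exact (hAC (hsymm h1)).elim
      · exact (hBC (hsymm h1)).elim
      · rfl
    · obtain ⟨E, rfl⟩ := Quot.exists_rep x
      rcases h E.1 E.2 with h1 | h1 | h1
      · exact ⟨0, Quot.sound (hsymm h1)⟩
      · exact ⟨1, Quot.sound (hsymm h1)⟩
      · exact ⟨2, Quot.sound (hsymm h1)⟩
  rw [← Nat.card_congr (Equiv.ofBijective _ hbij), Nat.card_eq_fintype_card, Fintype.card_fin]

theorem eq_or_eq_neg_of_zmod_three : ∀ X Y : ZMod 3, Y = 0 ∨ X = 0 ∨ X = Y ∨ X = -Y := by decide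

theorem card_quot_elemAb [Finite G] (hcard : Nat.card G = 95040)
    (hloc : ∀ y : G, orderOf y = 3 → 27 ∣ Nat.card (centralizer {y}) →
      (∃ g, g * y * g⁻¹ = y⁻¹) ∧ Nat.card (centralizer {y}) = 54) :
    Nat.card (Quot (fun E F : {E : Subgroup G // IsElementaryAbelian 3 E ∧ Nat.card E = 9} =>
      IsConjSubgroup E.1 F.1)) = 3 := by
  haveI : Fact (Nat.Prime 3) := ⟨Nat.prime_three⟩
  obtain ⟨P⟩ : Nonempty (Sylow 3 G) := inferInstance
  have hP : Nat.card (P : Subgroup G) = 27 := card_sylow_three hcard P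
  obtain ⟨y, hyP, hy, hle⟩ := exists_central (p := 3) (k := 3) (by norm_num) hP
  obtain ⟨⟨t, ht⟩, h54⟩ := centralizer_data hloc hP hy hle
  have hnc := exists_not_commute hloc hcard hP
  have h3 : ∀ u ∈ (P : Subgroup G), u ^ 3 = 1 := fun u hu => cube_eq_one hloc hcard hP hu
  have hsq : ∀ c ∈ centralizer {y}, c ^ 2 ∈ (P : Subgroup G) := fun c hc =>
    sq_mem_of_commute hP hle h54 hc
  have hN : ∀ n ∈ normalizer ((P : Subgroup G) : Set G), n * y * n⁻¹ = y ∨ n * y * n⁻¹ = y⁻¹ :=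
    fun n hn => eq_or_eq_inv_of_mem_normalizer hy
      (normalizer_le_normalizer_zpowers hloc hcard hP hyP hy hle hn)
  have htP := normalizer_zpowers_le hP hle h54 (mem_normalizer_of_conj_eq_inv ht)
  obtain ⟨a, ha, b, hb, hab, hT⟩ := exists_adapted_basis hP hyP hy hle hsq hnc htP ht
  have hconj := fun {n : G} (hn : n ∈ normalizer ((P : Subgroup G) : Set G)) =>
    coord_conj_of_adapted hP hyP hy hle hsq htP ht ha hb hab hT hn (hN n hn)
  have haa := commForm_self hP hyP hy hle ha
  have hbb := commForm_self hP hyP hy hle hb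
  have hba : commForm y b a = -1 := by rw [commForm_swap hP hyP hy hle ha hb, hab]
  have hmem := fun {u v : G} => mem_inf_centralizer_iff hP hyP hy hle (u := u) (v := v)
  have hab' : a * b ∈ (P : Subgroup G) := mul_mem ha hb
  have hne : (1 : ZMod 3) ≠ 0 := one_ne_zero
  have habb : commForm y (a * b) b ≠ 0 := by
    rw [commForm_mul_left hP hyP hy hle ha hb hb, hab, hbb, add_zero]
    exact hne
  have hba' : commForm y b a ≠ 0 := by rw [hba]; exact neg_ne_zero.2 hne
  have hS : ∀ u ∈ (P : Subgroup G), ∀ v ∈ (P : Subgroup G), commForm y u v ≠ 0 →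
      IsElementaryAbelian 3 ((P : Subgroup G) ⊓ centralizer {u}) ∧
        Nat.card ((P : Subgroup G) ⊓ centralizer {u} : Subgroup G) = 9 := by
    intro u hu v hv huv
    rw [Ne, commForm_eq_zero_iff hP hyP hy hle hu hv] at huv
    have h9 := card_inf_centralizer hP hu hv huv
    exact ⟨⟨fun x hx => h3 x hx.1, fun x hx z hz => commute_of_card_nine h9 hx hz⟩, h9⟩
  have hfus : ∀ u ∈ (P : Subgroup G), ∀ v ∈ (P : Subgroup G),
      IsConjSubgroup ((P : Subgroup G) ⊓ centralizer {u}) ((P : Subgroup G) ⊓ centralizer {v}) →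
      ∃ n ∈ normalizer ((P : Subgroup G) : Set G), commForm y v (n * u * n⁻¹) = 0 := by
    rintro u hu v hv ⟨g, hg⟩
    have hyc : ∀ w ∈ (P : Subgroup G), y ∈ (P : Subgroup G) ⊓ centralizer {w} := fun w hw =>
      ⟨hyP, mem_centralizer_singleton_iff.2 (mem_centralizer_singleton_iff.1 (hle hw)).symm⟩
    obtain ⟨n, hn, h⟩ := exists_normalizer_conj P
      (le_normalizer_of_card_nine hP hyP hy hle inf_le_left (hyc u hu))
      (le_normalizer_of_card_nine hP hyP hy hle inf_le_left (hyc v hv)) hg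
    refine ⟨n, hn, (hmem hv (conj_mem_of_mem_normalizer hn hu)).1 ?_⟩
    rw [← h]
    exact ⟨u, ⟨hu, mem_centralizer_singleton_iff.2 rfl⟩, rfl⟩
  have hdiag : ∀ w ∈ (P : Subgroup G), commForm y (a * b) w = commForm y a w - commForm y w b :=
    fun w hw => by
      rw [commForm_mul_left hP hyP hy hle ha hb hw, commForm_swap hP hyP hy hle hw hb,
        sub_eq_add_neg]
  have hunit : ∀ d : ZMod 3, d * d = 1 → d ≠ 0 := fun d hd h => by
    rw [h, mul_zero] at hd
    exact hne hd.symm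
  refine card_quot_eq_three (hS a ha b hb (by rw [hab]; exact hne)) (hS b hb a ha hba')
    (hS (a * b) hab' b hb habb) (fun h => ?_) (fun h => ?_) (fun h => ?_) ?_
  · obtain ⟨n, hn, h1⟩ := hfus a ha b hb h
    obtain ⟨d, e, hd, he, hde⟩ := hconj hn
    rw [commForm_swap hP hyP hy hle (conj_mem_of_mem_normalizer hn ha) hb, (hde a ha).1, hab,
      mul_one, neg_eq_zero] at h1
    exact hunit d hd h1
  · obtain ⟨n, hn, h1⟩ := hfus a ha _ hab' h
    obtain ⟨d, e, hd, he, hde⟩ := hconj hn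
    rw [hdiag _ (conj_mem_of_mem_normalizer hn ha), (hde a ha).1, (hde a ha).2, haa, hab, mul_zero,
      mul_one, zero_sub, neg_eq_zero] at h1
    exact hunit d hd h1
  · obtain ⟨n, hn, h1⟩ := hfus b hb _ hab' h
    obtain ⟨d, e, hd, he, hde⟩ := hconj hn
    rw [hdiag _ (conj_mem_of_mem_normalizer hn hb), (hde b hb).1, (hde b hb).2, hbb, hab, mul_zero,
      mul_one, sub_zero] at h1
    exact hunit e he h1
  · rintro E ⟨⟨-, -⟩, hE⟩
    obtain ⟨Q, hQ⟩ :=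
      (IsPGroup.of_card (p := 3) (n := 2) (G := E) (by rw [hE]; norm_num)).exists_le_sylow
    obtain ⟨g, hg⟩ := MulAction.exists_smul_eq G Q P
    have hEP : E.map (MulAut.conj g).toMonoidHom ≤ (P : Subgroup G) := by
      rw [← hg]
      exact map_mono hQ
    have hE9 : Nat.card (E.map (MulAut.conj g).toMonoidHom) = 9 := by
      rw [← hE]
      exact Nat.card_congr
        (E.equivMapOfInjective (MulAut.conj g).toMonoidHom (MulAut.conj g).injective).toEquiv.symm
    obtain ⟨u, hu, v, hv, huv, hEu⟩ := exists_eq_inf_centralizer hP hyP hy hle hnc h3 hEP hE9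
    have hE' : IsConjSubgroup E ((P : Subgroup G) ⊓ centralizer {u}) := ⟨g, hEu⟩
    have hline := fun {w z x : G} (hw : w ∈ (P : Subgroup G)) (hz : z ∈ (P : Subgroup G))
      (hx : x ∈ (P : Subgroup G)) => inf_centralizer_eq hP hyP hy hle hw hz hx (w' := b)
    by_cases hX : commForm y u b = 0
    · rw [inf_centralizer_eq hP hyP hy hle hu hb hv ha huv hba' hX] at hE'
      exact Or.inr (Or.inl hE')
    rcases eq_or_eq_neg_of_zmod_three (commForm y u b) (commForm y a u) with h | h | h | h
    · rw [hline hu ha hv hb huv (by rw [hab]; exact hne)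
        (by rw [commForm_swap hP hyP hy hle ha hu, h, neg_zero])] at hE'
      exact Or.inl hE'
    · exact (hX h).elim
    · rw [hline hu hab' hv hb huv habb
        (by rw [commForm_swap hP hyP hy hle hab' hu, hdiag u hu, h, sub_self, neg_zero])] at hE'
      exact Or.inr (Or.inr hE')
    · have htu := conj_mem_of_mem_normalizer htP hu
      have h1 := hline htu hab' hb hb (by rw [(hT u hu).1]; exact hX) habb (by
        rw [commForm_swap hP hyP hy hle hab' htu, hdiag _ htu, (hT u hu).1, (hT u hu).2, h,
          sub_self, neg_zero])
      rw [← map_conj_inf_centralizer htP] at h1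
      exact Or.inr (Or.inr (isConjSubgroup_equivalence.trans hE' ⟨t, h1⟩))

end LocalSubgroup

/-- In the Mathieu group `M₁₂`, the unique simple group of order 95040, the elementary
abelian subgroups of order 9 fall into exactly 3 conjugacy classes. -/
theorem M12_three_classes_of_elemAb_nine (G : Type*) [Group G] [Finite G]
    (hsimple : IsSimpleGroup G) (hcard : Nat.card G = 95040) :
    Nat.card (Quot (fun E F : {E : Subgroup G // IsElementaryAbelian 3 E ∧ Nat.card E = 9} =>
      IsConjSubgroup E.1 F.1)) = 3 := by
  haveI := hsimple
  exact LocalSubgroup.card_quot_elemAb hcard fun y hy h27 =>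
    GroupChar.exists_real_of_order_three G hcard hy h27
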